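/- (Principal kinematic formula in the hyperbolic plane, convex case.) Let K and L be compact geodesically convex subsets of the hyperbolic plane H² (of constant curvature −1) with nonempty interiors. Let μ be the left Haar measure on SL(2,ℝ), acting on the upper half-plane by Möbius transformations, normalized so that the pushforward of μ under the orbit map g ↦ g·i equals the hyperbolic area measure. Then ∫_{SL(2,ℝ)} 1[K ∩ gL ≠ ∅] dμ(g) = A_K + A_L + (1/(2π))·(P_K·P_L + A_K·A_L). -/

import Mathlib

open MeasureTheory Metric Real UpperHalfPlane

open scoped UpperHalfPlane

noncomputable section

instance : MeasurableSpace ℍ := borel ℍ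

instance : BorelSpace ℍ := ⟨rfl⟩

/-- The hyperbolic area measure on the upper half-plane: the measure with density
`y⁻²` with respect to the planar Lebesgue measure. -/
def hypAreaMeasure : Measure ℍ :=
  (Measure.comap (fun z : ℍ => (z : ℂ)) volume).withDensity
    (fun z => ENNReal.ofReal ((z.im ^ 2)⁻¹))

/-- The hyperbolic area of a subset of the hyperbolic plane. -/
def hypArea (K : Set ℍ) : ℝ := (hypAreaMeasure K).toReal

/-- The hyperbolic perimeter: one-dimensional Hausdorff measure (with respect to the
hyperbolic metric) of the topological boundary. -/
def hypPerim (K : Set ℍ) : ℝ := (μH[1] (frontier K)).toReal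

/-- Geodesic convexity in the hyperbolic plane. -/
def HypConvex (K : Set ℍ) : Prop :=
  ∀ x ∈ K, ∀ y ∈ K, ∀ z : ℍ, dist x z + dist z y = dist x y → z ∈ K

/-- The hyperbolic circumradius of `K`. -/
def hypCircumradius (K : Set ℍ) : ℝ :=
  sInf {R : ℝ | ∃ c : ℍ, K ⊆ Metric.closedBall c R}

/-- The hyperbolic inradius of `K`. -/
def hypInradius (K : Set ℍ) : ℝ :=
  sSup {r : ℝ | ∃ c : ℍ, Metric.closedBall c r ⊆ K}

/-- `K` is a closed hyperbolic disc of positive radius. -/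
def IsHypDisc (K : Set ℍ) : Prop :=
  ∃ (c : ℍ) (r : ℝ), 0 < r ∧ K = Metric.closedBall c r

end

/-- The Borel measurable structure on `SL(2,ℝ)`, induced from the matrix entries. -/
instance : MeasurableSpace (Matrix.SpecialLinearGroup (Fin 2) ℝ) :=
  MeasurableSpace.comap (fun g => (g : Matrix (Fin 2) (Fin 2) ℝ))
    (inferInstanceAs (MeasurableSpace (Fin 2 → Fin 2 → ℝ)))

noncomputable section

/-- The group `SL(2,ℝ)`. -/
abbrev G2 := Matrix.SpecialLinearGroup (Fin 2) ℝ

/-- squared modulus -/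
def nsq (z : ℍ) : ℝ := z.re ^ 2 + z.im ^ 2

lemma nsq_pos (z : ℍ) : 0 < nsq z := by
  have := z.im_pos; unfold nsq; positivity

/-- squared modulus of the denominator -/
def qden (g : G2) (z : ℍ) : ℝ := (g 1 0) ^ 2 * nsq z + 2 * g 1 0 * g 1 1 * z.re + (g 1 1) ^ 2

lemma g2_det (g : G2) : g 0 0 * g 1 1 - g 0 1 * g 1 0 = 1 := by
  have := g.det_coe; rw [Matrix.det_fin_two] at this; exact this

lemma qden_eq (g : G2) (z : ℍ) :
    qden g z = (g 1 0 * z.re + g 1 1) ^ 2 + (g 1 0 * z.im) ^ 2 := by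
  unfold qden nsq; ring

lemma qden_pos (g : G2) (z : ℍ) : 0 < qden g z := by
  rw [qden_eq]
  have h := g2_det g
  have hz := z.im_pos
  by_cases hc : g 1 0 = 0
  · have : g 1 1 ≠ 0 := by rintro h1; rw [hc, h1] at h; simp at h
    rw [hc]; simp; positivity
  · positivity

lemma smul_coe (g : G2) (z : ℍ) :
    ((g • z : ℍ) : ℂ) = ((g 0 0 : ℂ) * z + g 0 1) / ((g 1 0 : ℂ) * z + g 1 1) := by
  rw [coe_specialLinearGroup_apply]; rfl

lemma smul_re_im (g : G2) (z : ℍ) :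
    (g • z).re * qden g z = g 0 0 * g 1 0 * nsq z + (g 0 0 * g 1 1 + g 0 1 * g 1 0) * z.re
      + g 0 1 * g 1 1 ∧ (g • z).im * qden g z = z.im := by
  have h := smul_coe g z
  have hne : ((g 1 0 : ℂ) * z + g 1 1) ≠ 0 := by
    intro h0
    have := qden_pos g z
    rw [qden_eq] at this
    have h1 := congrArg Complex.re h0
    have h2 := congrArg Complex.im h0
    simp at h1 h2
    rcases h2 with h2 | h2
    · rw [h2] at h1 this; simp at h1; rw [h1] at this; simp at this
    · exact absurd h2 z.im_pos.ne'
  rw [eq_div_iff hne] at h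
  have h1 := congrArg Complex.re h
  have h2 := congrArg Complex.im h
  simp at h1 h2
  have hd := g2_det g
  rw [qden_eq]; unfold nsq
  constructor
  · linear_combination (g 1 0 * z.re + g 1 1) * h1 + (g 1 0 * z.im) * h2
  · linear_combination (g 1 0 * z.re + g 1 1) * h2 - (g 1 0 * z.im) * h1 + z.im * hd

lemma smul_re_q (g : G2) (z : ℍ) :
    (g • z).re * qden g z = g 0 0 * g 1 0 * nsq z + (g 0 0 * g 1 1 + g 0 1 * g 1 0) * z.re
      + g 0 1 * g 1 1 := (smul_re_im g z).1

lemma smul_im_q (g : G2) (z : ℍ) : (g • z).im * qden g z = z.im := (smul_re_im g z).2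

lemma smul_nsq_q (g : G2) (z : ℍ) :
    nsq (g • z) * qden g z = (g 0 0) ^ 2 * nsq z + 2 * g 0 0 * g 0 1 * z.re + (g 0 1) ^ 2 := by
  have h1 := smul_re_q g z
  have h2 := smul_im_q g z
  have hq := qden_pos g z
  have hd := g2_det g
  have : nsq (g • z) * qden g z * qden g z =
      ((g 0 0) ^ 2 * nsq z + 2 * g 0 0 * g 0 1 * z.re + (g 0 1) ^ 2) * qden g z := by
    have : nsq (g • z) * qden g z * qden g z = ((g • z).re * qden g z) ^ 2 +
      ((g • z).im * qden g z) ^ 2 := by rw [nsq]; ring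
    rw [this, h1, h2]
    have hdd : (g 0 0 * g 1 1 - g 0 1 * g 1 0) ^ 2 = 1 := by rw [hd]; ring
    unfold qden nsq
    linear_combination (-z.im^2) * hdd
  exact mul_right_cancel₀ hq.ne' this

/-- Klein-type coordinates: geodesics become straight segments. -/
def kap (z : ℍ) : ℂ := ⟨z.re, nsq z⟩

@[simp] lemma kap_re (z : ℍ) : (kap z).re = z.re := rfl
@[simp] lemma kap_im (z : ℍ) : (kap z).im = nsq z := rfl

lemma kap_inj : Function.Injective kap := by
  intro z w h
  have h1 := congrArg Complex.re h
  have h2 := congrArg Complex.im h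
  simp [nsq] at h1 h2
  rw [h1] at h2
  have := z.im_pos; have := w.im_pos
  have h3 : z.im = w.im := by nlinarith
  exact UpperHalfPlane.ext (by apply Complex.ext <;> assumption)

/-- The region of the model. -/
def kdom : Set ℂ := {p | p.re ^ 2 < p.im}

lemma kap_mem (z : ℍ) : kap z ∈ kdom := by
  have := z.im_pos
  simp [kdom, nsq]; positivity

lemma exists_kap {p : ℂ} (hp : p ∈ kdom) : ∃ z, kap z = p := by
  have h : 0 < p.im - p.re ^ 2 := by simpa [kdom] using hp
  refine ⟨⟨⟨p.re, √(p.im - p.re ^ 2)⟩, Real.sqrt_pos.2 h⟩, ?_⟩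
  apply Complex.ext
  · simp [kap]
  · show (p.re) ^ 2 + (√(p.im - p.re ^ 2)) ^ 2 = p.im
    rw [Real.sq_sqrt h.le]; ring

lemma kdom_convex : Convex ℝ kdom := by
  intro p hp q hq a b ha hb hab
  simp [kdom] at *
  have hb' : b = 1 - a := by linarith
  subst hb'
  rcases eq_or_lt_of_le ha with h | h
  · subst h; simpa using hq
  · nlinarith [sq_nonneg (p.re - q.re), mul_nonneg ha hb, mul_lt_mul_of_pos_left hp h,
      mul_le_mul_of_nonneg_left hq.le hb, mul_nonneg (mul_nonneg ha hb) (sq_nonneg (p.re - q.re))]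

lemma range_kap : Set.range kap = kdom := by
  ext p; constructor
  · rintro ⟨z, rfl⟩; exact kap_mem z
  · intro hp; exact exists_kap hp

lemma mem_seg_iff (p q r : ℂ) : p ∈ segment ℝ q r ↔ ∃ a b : ℝ, 0 ≤ a ∧ 0 ≤ b ∧ a + b = 1 ∧
    p.re = a * q.re + b * r.re ∧ p.im = a * q.im + b * r.im := by
  constructor
  · rintro ⟨a, b, ha, hb, hab, rfl⟩
    exact ⟨a, b, ha, hb, hab, by simp, by simp⟩
  · rintro ⟨a, b, ha, hb, hab, h1, h2⟩
    exact ⟨a, b, ha, hb, hab, by apply Complex.ext <;> simp [h1, h2]⟩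

lemma seg_smul_aux (g : G2) {z w p : ℍ} (h : kap p ∈ segment ℝ (kap z) (kap w)) :
    kap (g • p) ∈ segment ℝ (kap (g • z)) (kap (g • w)) := by
  rw [mem_seg_iff] at *
  obtain ⟨a, b, ha, hb, hab, h1, h2⟩ := h
  simp only [kap_re, kap_im] at *
  have hq : qden g p = a * qden g z + b * qden g w := by
    simp only [qden, h1, h2]; linear_combination (-(g 1 1) ^ 2) * hab
  have hp := qden_pos g p
  refine ⟨a * qden g z / qden g p, b * qden g w / qden g p, ?_, ?_, ?_, ?_, ?_⟩
  · have := qden_pos g z; positivity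
  · have := qden_pos g w; positivity
  · rw [← add_div, ← hq, div_self hp.ne']
  · rw [eq_comm, div_mul_eq_mul_div, div_mul_eq_mul_div, ← add_div, div_eq_iff hp.ne', smul_re_q, h1, h2]
    linear_combination a * smul_re_q g z + b * smul_re_q g w + (g 0 1 * g 1 1) * hab
  · rw [eq_comm, div_mul_eq_mul_div, div_mul_eq_mul_div, ← add_div, div_eq_iff hp.ne', smul_nsq_q, h1, h2]
    linear_combination a * smul_nsq_q g z + b * smul_nsq_q g w + ((g 0 1) ^ 2) * hab

lemma seg_smul (g : G2) (z w p : ℍ) : kap (g • p) ∈ segment ℝ (kap (g • z)) (kap (g • w)) ↔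
    kap p ∈ segment ℝ (kap z) (kap w) := by
  refine ⟨fun h => ?_, seg_smul_aux g⟩
  simpa using seg_smul_aux g⁻¹ h

lemma cosh_dist_nsq (z w : ℍ) :
    cosh (dist z w) * (2 * z.im * w.im) = nsq z + nsq w - 2 * z.re * w.re := by
  have h1 := z.im_pos; have h2 := w.im_pos
  rw [UpperHalfPlane.cosh_dist', div_mul_cancel₀ _ (by positivity)]
  unfold nsq; ring

/-- points of the imaginary axis -/
def ax (t : ℝ) : ℍ := mk ⟨0, exp t⟩ (exp_pos t)

@[simp] lemma ax_re (t : ℝ) : (ax t).re = 0 := rfl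
@[simp] lemma ax_im (t : ℝ) : (ax t).im = exp t := rfl
lemma ax_nsq (t : ℝ) : nsq (ax t) = exp (2 * t) := by
  simp [nsq, ← Real.exp_nat_mul]

lemma ax_zero : ax 0 = I := by
  apply UpperHalfPlane.ext; apply Complex.ext
  · rfl
  · show exp 0 = 1
    exact Real.exp_zero

lemma dist_ax (s t : ℝ) : dist (ax s) (ax t) = |s - t| := by
  have := (isometry_vertical_line 0).dist_eq s t
  rw [Real.dist_eq] at this; exact this

lemma log_nsq_le (z w : ℍ) : log (nsq w) - log (nsq z) ≤ 2 * dist z w := by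
  set A := nsq z
  set B := nsq w
  have hA : 0 < A := nsq_pos z
  have hB : 0 < B := nsq_pos w
  have h1 := z.im_pos; have h2 := w.im_pos
  by_contra! hcon
  have hd : 0 ≤ dist z w := dist_nonneg
  have hlt : dist z w < (log B - log A) / 2 := by linarith
  have hc : cosh (dist z w) < cosh ((log B - log A) / 2) := by
    rw [Real.cosh_lt_cosh, abs_of_nonneg hd]
    exact lt_of_lt_of_le hlt (le_abs_self _)
  set a := √A
  set b := √B
  have ha : 0 < a := Real.sqrt_pos.2 hA
  have hb : 0 < b := Real.sqrt_pos.2 hB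
  have haA : a ^ 2 = A := Real.sq_sqrt hA.le
  have hbB : b ^ 2 = B := Real.sq_sqrt hB.le
  have hl : (log B - log A) / 2 = log (b / a) := by
    rw [Real.log_div hb.ne' ha.ne', ← haA, ← hbB, Real.log_pow, Real.log_pow]; push_cast; ring
  rw [hl, Real.cosh_log (by positivity)] at hc
  have hc2 : (b / a + (b / a)⁻¹) / 2 = (A + B) / (2 * (a * b)) := by
    rw [← haA, ← hbB]; field_simp; ring
  rw [hc2, lt_div_iff₀ (by positivity)] at hc
  have h3 := cosh_dist_nsq z w
  have hAe : A = z.re ^ 2 + z.im ^ 2 := rfl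
  have hBe : B = w.re ^ 2 + w.im ^ 2 := rfl
  have h4 : |z.re * w.re| + z.im * w.im ≤ a * b := by
    apply abs_le_of_sq_le_sq' _ (by positivity) |>.2
    rw [mul_pow, haA, hbB, hAe, hBe]
    rw [abs_mul, ← sq_abs z.re, ← sq_abs w.re]
    nlinarith [sq_nonneg (|z.re| * w.im - |w.re| * z.im)]
  have h5 : 2 * (a * b) ≤ A + B := by rw [← haA, ← hbB]; nlinarith [sq_nonneg (a - b)]
  have h6 := le_abs_self (z.re * w.re)
  have h7 : cosh (dist z w) * (2 * (a * b)) * (z.im * w.im) < (A + B) * (z.im * w.im) :=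
    mul_lt_mul_of_pos_right hc (by positivity)
  have h8 : cosh (dist z w) * (2 * (a * b)) * (z.im * w.im) =
    (A + B - 2 * z.re * w.re) * (a * b) := by rw [← h3]; ring
  have h9 : 0 < a * b := by positivity
  have h10 := abs_nonneg (z.re * w.re)
  nlinarith [mul_le_mul_of_nonneg_left h4 (by linarith : 0 ≤ A + B),
    mul_le_mul_of_nonneg_left h6 h9.le, mul_le_mul_of_nonneg_left h5 h10]

/-- equality case on the axis -/
lemma dist_ax_point (s : ℝ) (z : ℍ) (h : |log (nsq z) / 2 - s| = dist (ax s) z) : z.re = 0 := by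
  have h3 := cosh_dist_nsq (ax s) z
  rw [← h, Real.cosh_abs, ax_nsq, ax_re, ax_im] at h3
  set a := exp s
  have ha : 0 < a := exp_pos s
  have e2 : exp (2 * s) = a ^ 2 := by rw [← Real.exp_nat_mul]; norm_num
  set b := √(nsq z)
  have hb : 0 < b := Real.sqrt_pos.2 (nsq_pos z)
  have hbB : b ^ 2 = nsq z := Real.sq_sqrt (nsq_pos z).le
  have hl : log (nsq z) / 2 - s = log (b / a) := by
    rw [Real.log_div hb.ne' ha.ne', ← hbB, Real.log_pow, Real.log_exp]; push_cast; ring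
  rw [hl, Real.cosh_log (by positivity), e2, ← hbB] at h3
  have h4 : z.im = b := by
    have : (b / a + (b / a)⁻¹) / 2 * (2 * a * z.im) * b = (b ^ 2 + a ^ 2) * z.im := by
      field_simp
    rw [h3] at this
    have h5 : (a ^ 2 + b ^ 2) * (b - z.im) = 0 := by linear_combination this
    rcases mul_eq_zero.1 h5 with h | h
    · nlinarith
    · linarith
  have h5 : z.re ^ 2 + z.im ^ 2 = b ^ 2 := hbB.symm
  rw [h4] at h5
  nlinarith

lemma ax_of_re_zero (z : ℍ) (h : z.re = 0) : ∃ t, z = ax t := by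
  refine ⟨log z.im, ?_⟩
  apply UpperHalfPlane.ext; apply Complex.ext
  · exact h
  · show z.im = exp (log z.im)
    rw [Real.exp_log z.im_pos]

lemma smul_I_eqs (z : ℍ) : ∃ g : G2, g • z = I := by
  refine ⟨(z.toSL2R)⁻¹, ?_⟩
  rw [inv_smul_eq_iff]; simp

/-- rotation matrix -/
def rot (θ : ℝ) : G2 := ⟨!![cos θ, sin θ; -sin θ, cos θ], by
  rw [Matrix.det_fin_two]; simp; nlinarith [sin_sq_add_cos_sq θ]⟩

@[simp] lemma rot00 (θ : ℝ) : rot θ 0 0 = cos θ := rfl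
@[simp] lemma rot01 (θ : ℝ) : rot θ 0 1 = sin θ := rfl
@[simp] lemma rot10 (θ : ℝ) : rot θ 1 0 = -sin θ := rfl
@[simp] lemma rot11 (θ : ℝ) : rot θ 1 1 = cos θ := rfl

lemma rot_I (θ : ℝ) : rot θ • I = I := by
  have hq : qden (rot θ) I = 1 := by
    simp [qden, nsq]
  have h1 := smul_re_q (rot θ) I
  have h2 := smul_im_q (rot θ) I
  rw [hq] at h1 h2
  apply UpperHalfPlane.ext_re_im
  · simp [nsq] at h1 ⊢; linarith
  · simpa using h2

lemma exists_rot (w : ℍ) : ∃ θ, ∃ t, 0 ≤ t ∧ rot θ • w = ax t := by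
  set N := nsq w
  set ζ : ℂ := ⟨(N - 1) / 2, w.re⟩
  set θ := Complex.arg ζ / 2
  have hc := Complex.norm_mul_cos_arg ζ
  have hs := Complex.norm_mul_sin_arg ζ
  have e : Complex.arg ζ = 2 * θ := by simp [θ]; ring
  have hc' : ‖ζ‖ * cos (2 * θ) = (N - 1) / 2 := by rw [← e]; exact hc
  have hs' : ‖ζ‖ * sin (2 * θ) = w.re := by rw [← e]; exact hs
  have hre : (rot θ • w).re = 0 := by
    have h := smul_re_q (rot θ) w
    simp only [rot00, rot01, rot10, rot11] at h
    have h0 : (rot θ • w).re * qden (rot θ) w = 0 := by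
      rw [h]
      have h2 : cos θ * -sin θ * nsq w + (cos θ * cos θ + sin θ * -sin θ) * w.re + sin θ * cos θ
        = cos (2 * θ) * w.re - sin (2 * θ) * ((N - 1) / 2) := by
        rw [Real.cos_two_mul', Real.sin_two_mul]; ring
      rw [h2, ← hc']; nth_rw 1 [← hs']; ring
    exact (mul_eq_zero.1 h0).resolve_right (qden_pos _ _).ne'
  obtain ⟨t, ht⟩ := ax_of_re_zero _ hre
  refine ⟨θ, t, ?_, ht⟩
  have h := smul_nsq_q (rot θ) w
  rw [ht, ax_nsq] at h
  have hq := qden_pos (rot θ) w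
  have hge : qden (rot θ) w ≤ exp (2 * t) * qden (rot θ) w := by
    rw [h]; unfold qden
    simp only [rot00, rot01, rot10, rot11]
    have h2 : cos θ ^ 2 * nsq w + 2 * cos θ * sin θ * w.re + sin θ ^ 2 -
      ((-sin θ) ^ 2 * nsq w + 2 * -sin θ * cos θ * w.re + cos θ ^ 2) =
      2 * (cos (2 * θ) * ((N - 1) / 2) + sin (2 * θ) * w.re) := by
        rw [Real.cos_two_mul', Real.sin_two_mul]; ring
    have h3 : 0 ≤ 2 * (cos (2 * θ) * ((N - 1) / 2) + sin (2 * θ) * w.re) := by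
      rw [← hc', ← hs']
      have : 0 ≤ ‖ζ‖ := norm_nonneg _
      have : 2 * (cos (2 * θ) * (‖ζ‖ * cos (2 * θ)) + sin (2 * θ) * (‖ζ‖ * sin (2 * θ))) =
        2 * ‖ζ‖ * (cos (2 * θ) ^ 2 + sin (2 * θ) ^ 2) := by ring
      rw [this]; positivity
    linarith
  by_contra! hneg
  have : exp (2 * t) < 1 := by rw [Real.exp_lt_one_iff]; linarith
  nlinarith

/-- two-point normal form -/
lemma exists_normal (z w : ℍ) : ∃ g : G2, g • z = ax 0 ∧ g • w = ax (dist z w) := by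
  obtain ⟨g, hg⟩ := smul_I_eqs z
  obtain ⟨θ, t, ht, h⟩ := exists_rot (g • w)
  have h1 : (rot θ * g) • z = ax 0 := by rw [mul_smul, hg, rot_I, ax_zero]
  have h2 : (rot θ * g) • w = ax t := by rw [mul_smul, h]
  have : dist z w = t := by
    rw [← dist_smul (rot θ * g) z w, h1, h2, dist_ax]; simp [abs_of_nonneg ht]
  exact ⟨rot θ * g, h1, by rw [this]; exact h2⟩

lemma exists_map_pair {z w z' w' : ℍ} (h : dist z w = dist z' w') :
    ∃ g : G2, g • z = z' ∧ g • w = w' := by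
  obtain ⟨g, h1, h2⟩ := exists_normal z w
  obtain ⟨g', h1', h2'⟩ := exists_normal z' w'
  refine ⟨g'⁻¹ * g, ?_, ?_⟩
  · rw [mul_smul, h1, ← h1', inv_smul_smul]
  · rw [mul_smul, h2, h, ← h2', inv_smul_smul]

/-- a half turn of the axis -/
def hturn (t : ℝ) : G2 := ⟨!![0, -exp (t / 2); exp (-(t / 2)), 0], by
  rw [Matrix.det_fin_two]; simp [← Real.exp_add]⟩

lemma hturn_sq (t : ℝ) : hturn t * hturn t = -1 := by
  ext i j
  fin_cases i <;> fin_cases j <;> (rw [Matrix.SpecialLinearGroup.coe_mul]; simp [hturn, Matrix.mul_apply, ← Real.exp_add])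

lemma hturn_ax (t s : ℝ) : hturn t • ax s = ax (t - s) := by
  have hq : qden (hturn t) (ax s) = exp (2 * s - t) := by
    simp [qden, ax_nsq, hturn, ← Real.exp_nat_mul, ← Real.exp_add]; ring
  have h1 := smul_re_q (hturn t) (ax s)
  have h2 := smul_im_q (hturn t) (ax s)
  rw [hq] at h1 h2
  apply UpperHalfPlane.ext_re_im
  · have : (hturn t • ax s).re * exp (2 * s - t) = 0 := by rw [h1]; simp [hturn]
    exact (mul_eq_zero.1 this).resolve_right (exp_pos _).ne'
  · rw [ax_im] at *
    have : exp (t - s) * exp (2 * s - t) = exp s := by rw [← Real.exp_add]; ring_nf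
    exact mul_right_cancel₀ (exp_pos _).ne' (h2.trans this.symm)

lemma exists_half_turn (z w : ℍ) : ∃ h : G2, h • z = w ∧ h • w = z ∧ h * h = -1 := by
  obtain ⟨g, h1, h2⟩ := exists_normal z w
  refine ⟨g⁻¹ * hturn (dist z w) * g, ?_, ?_, ?_⟩
  · rw [mul_smul, mul_smul, h1, hturn_ax, inv_smul_eq_iff, h2]; simp
  · rw [mul_smul, mul_smul, h2, hturn_ax, inv_smul_eq_iff, h1]; simp
  · have : g⁻¹ * hturn (dist z w) * g * (g⁻¹ * hturn (dist z w) * g) =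
      g⁻¹ * (hturn (dist z w) * hturn (dist z w)) * g := by group
    rw [this, hturn_sq]; simp

lemma hseg_iff (z w p : ℍ) : dist z p + dist p w = dist z w ↔
    kap p ∈ segment ℝ (kap z) (kap w) := by
  obtain ⟨g, h1, h2⟩ := exists_normal z w
  rw [← seg_smul g, ← dist_smul g z p, ← dist_smul g p w, ← dist_smul g z w]
  generalize hd : dist z w = d at *
  have hd0 : 0 ≤ d := hd ▸ dist_nonneg
  rw [h1, h2]
  generalize g • p = p
  have hdd : dist (ax 0) (ax d) = d := by rw [dist_ax]; simp [abs_of_nonneg hd0]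
  rw [hdd]
  constructor
  · intro h
    have e1 := log_nsq_le (ax 0) p
    have e2 := log_nsq_le p (ax d)
    rw [ax_nsq, Real.log_exp] at e1 e2
    have e3 : |log (nsq p) / 2 - 0| = dist (ax 0) p := by
      have e4 : dist (ax 0) p = log (nsq p) / 2 := by linarith
      rw [sub_zero, ← e4, abs_of_nonneg dist_nonneg]
    obtain ⟨t, rfl⟩ := ax_of_re_zero _ (dist_ax_point 0 p e3)
    rw [dist_ax, dist_ax] at h
    have ht0 : 0 ≤ t := by
      have := abs_nonneg (t - d)
      by_contra! hneg
      rw [abs_of_nonneg (by linarith : (0 : ℝ) ≤ 0 - t), abs_of_neg (by linarith)] at h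
      linarith
    have htd : t ≤ d := by
      by_contra! hneg
      rw [abs_of_nonpos (by linarith : (0 : ℝ) - t ≤ 0), abs_of_pos (by linarith)] at h
      linarith
    have key : exp (2 * t) ∈ segment ℝ (exp (2 * 0)) (exp (2 * d)) := by
      rw [segment_eq_Icc (Real.exp_le_exp.2 (by linarith))]
      exact ⟨Real.exp_le_exp.2 (by linarith), Real.exp_le_exp.2 (by linarith)⟩
    obtain ⟨a, b, ha, hb, hab, hh⟩ := key
    rw [mem_seg_iff]
    refine ⟨a, b, ha, hb, hab, by simp, ?_⟩
    simp only [kap_im, ax_nsq]; rw [← hh]; simp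
  · intro h
    rw [mem_seg_iff] at h
    obtain ⟨a, b, ha, hb, hab, h1, h2⟩ := h
    simp at h1
    obtain ⟨t, rfl⟩ := ax_of_re_zero _ h1
    simp only [kap_im, ax_nsq] at h2
    have hed : exp (2 * 0) ≤ exp (2 * d) := Real.exp_le_exp.2 (by linarith)
    obtain rfl : a = 1 - b := by linarith
    have h3 : exp (2 * 0) ≤ exp (2 * t) := by
      rw [h2]; nlinarith [mul_nonneg hb (sub_nonneg.2 hed)]
    have h4 : exp (2 * t) ≤ exp (2 * d) := by
      rw [h2]; nlinarith [mul_nonneg ha (sub_nonneg.2 hed)]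
    rw [Real.exp_le_exp] at h3 h4
    rw [dist_ax, dist_ax, abs_of_nonpos (by linarith), abs_of_nonpos (by linarith)]
    ring

lemma hypConvex_iff (K : Set ℍ) : HypConvex K ↔ Convex ℝ (kap '' K) := by
  rw [convex_iff_segment_subset]
  constructor
  · rintro h _ ⟨x, hx, rfl⟩ _ ⟨y, hy, rfl⟩ p hp
    obtain ⟨z, rfl⟩ := exists_kap (kdom_convex.segment_subset (kap_mem x) (kap_mem y) hp)
    exact ⟨z, h x hx y hy z ((hseg_iff x y z).2 hp), rfl⟩
  · intro h x hx y hy z hz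
    have := h (Set.mem_image_of_mem _ hx) (Set.mem_image_of_mem _ hy) ((hseg_iff x y z).1 hz)
    obtain ⟨z', hz', e⟩ := this
    rwa [← kap_inj e]

end

noncomputable section

instance instBorelG2 : BorelSpace G2 := by
  constructor
  have h : (MeasurableSpace.pi : MeasurableSpace (Fin 2 → Fin 2 → ℝ)) =
    borel (Fin 2 → Fin 2 → ℝ) := BorelSpace.measurable_eq
  have h2 := borel_comap (f := fun g : G2 => (g : Matrix (Fin 2) (Fin 2) ℝ))
    (t := (Pi.topologicalSpace : TopologicalSpace (Fin 2 → Fin 2 → ℝ)))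
  refine Eq.trans ?_ h2.symm
  exact congrArg (MeasurableSpace.comap (fun g : G2 => (g : Matrix (Fin 2) (Fin 2) ℝ))) h

instance : LocallyCompactSpace (Matrix (Fin 2) (Fin 2) ℝ) :=
  inferInstanceAs (LocallyCompactSpace (Fin 2 → Fin 2 → ℝ))
instance : SecondCountableTopology (Matrix (Fin 2) (Fin 2) ℝ) :=
  inferInstanceAs (SecondCountableTopology (Fin 2 → Fin 2 → ℝ))

instance : LocallyCompactSpace G2 :=
  Matrix.SpecialLinearGroup.isClosedEmbedding_val.locallyCompactSpace
instance : SecondCountableTopology G2 :=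
  Matrix.SpecialLinearGroup.isClosedEmbedding_val.isEmbedding.secondCountableTopology
instance : T2Space G2 :=
  Matrix.SpecialLinearGroup.isClosedEmbedding_val.isEmbedding.t2Space

lemma cont_orb (z : ℍ) : Continuous (fun g : G2 => g • z) := by fun_prop
lemma meas_orb (z : ℍ) : Measurable (fun g : G2 => g • z) := (cont_orb z).measurable

lemma coe_emb : MeasurableEmbedding (fun z : ℍ => (z : ℂ)) := 
  (UpperHalfPlane.isOpenEmbedding_coe).measurableEmbedding

lemma area_eq (K : Set ℍ) (hK : MeasurableSet K) : hypAreaMeasure K =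
    ∫⁻ p in (fun z : ℍ => (z : ℂ)) '' K, ENNReal.ofReal ((p.im ^ 2)⁻¹) := by
  rw [hypAreaMeasure, withDensity_apply _ hK]
  have e : (Measure.comap (fun z : ℍ => (z : ℂ)) volume).restrict K =
     Measure.comap (fun z : ℍ => (z : ℂ)) (volume.restrict ((fun z : ℍ => (z : ℂ)) '' K)) := by
    rw [coe_emb.comap_restrict, Set.preimage_image_eq _ coe_emb.injective]
  rw [e]
  have h2 := coe_emb.lintegral_map (μ := Measure.comap (fun z : ℍ => (z : ℂ)) (volume.restrict ((fun z : ℍ => (z : ℂ)) '' K)))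
    (fun p : ℂ => ENNReal.ofReal ((p.im ^ 2)⁻¹))
  rw [coe_emb.map_comap, Measure.restrict_restrict coe_emb.measurableSet_range, Set.inter_eq_right.2 (Set.image_subset_range _ _)] at h2
  rw [h2]; rfl

lemma area_lt_top {K : Set ℍ} (hK : IsCompact K) : hypAreaMeasure K < ⊤ := by
  rw [area_eq K hK.measurableSet]
  have hc : IsCompact ((fun z : ℍ => (z : ℂ)) '' K) := hK.image continuous_coe
  have hcont : ContinuousOn (fun p : ℂ => (p.im ^ 2)⁻¹) ((fun z : ℍ => (z : ℂ)) '' K) := by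
    apply ContinuousOn.inv₀ (by fun_prop)
    rintro _ ⟨z, _, rfl⟩
    exact pow_ne_zero _ z.im_pos.ne'
  exact (hcont.integrableOn_compact hc).lintegral_lt_top

instance : IsFiniteMeasureOnCompacts hypAreaMeasure := ⟨fun _ hK => area_lt_top hK⟩

lemma area_pos_of_isOpen {U : Set ℍ} (hU : IsOpen U) (hne : U.Nonempty) : 0 < hypAreaMeasure U := by
  rw [area_eq U hU.measurableSet]
  have ho : IsOpen ((fun z : ℍ => (z : ℂ)) '' U) := isOpenEmbedding_coe.isOpenMap _ hU
  rw [setLIntegral_pos_iff (by fun_prop)]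
  refine lt_of_lt_of_le (ho.measure_pos volume (hne.image _)) (measure_mono ?_)
  intro p hp
  refine ⟨?_, hp⟩
  obtain ⟨z, _, rfl⟩ := hp
  have : 0 < z.im := z.im_pos
  simp; positivity

instance : hypAreaMeasure.IsOpenPosMeasure := ⟨fun _ h1 h2 => (area_pos_of_isOpen h1 h2).ne'⟩

/-- The normalised measures of the theorem. -/
structure Good (μ : Measure G2) : Prop where
  inv : μ.IsMulLeftInvariant
  push : μ.map (fun g => g • UpperHalfPlane.I) = hypAreaMeasure

namespace Good
variable {μ : Measure G2}

lemma preim (hμ : Good μ) {B : Set ℍ} (hB : MeasurableSet B) : μ {g | g • I ∈ B} = hypAreaMeasure B := by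
  rw [← hμ.push, Measure.map_apply (meas_orb I) hB]; rfl

lemma finC (hμ : Good μ) : IsFiniteMeasureOnCompacts μ := by
  constructor
  intro C hC
  have hC' : IsCompact ((fun g : G2 => g • I) '' C) := hC.image (cont_orb I)
  refine lt_of_le_of_lt (measure_mono ?_) ((hμ.preim hC'.measurableSet).trans_lt (area_lt_top hC'))
  intro g hg
  exact ⟨g, hg, rfl⟩

lemma haar (hμ : Good μ) : μ.IsHaarMeasure := by
  have := hμ.finC
  have := hμ.inv
  have h := Measure.isMulLeftInvariant_eq_smul μ (Measure.haar : Measure G2)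
  set c := Measure.haarScalarFactor μ (Measure.haar : Measure G2)
  have hc : c ≠ 0 := by
    intro h0
    rw [h0, zero_smul] at h
    have := hμ.preim (MeasurableSet.univ : MeasurableSet (Set.univ : Set ℍ))
    rw [h] at this
    have h2 := area_pos_of_isOpen isOpen_univ (Set.univ_nonempty : (Set.univ : Set ℍ).Nonempty)
    rw [← this] at h2; simp at h2
  rw [h]
  exact Measure.IsHaarMeasure.nnreal_smul _ hc

end Good
end

noncomputable section

lemma exists_smul_I (z : ℍ) : ∃ g : G2, g • I = z := by
  obtain ⟨g, hg⟩ := smul_I_eqs z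
  exact ⟨g⁻¹, by rw [inv_smul_eq_iff, hg]⟩

namespace Good
variable {μ : Measure G2}

lemma map_right (hμ : Good μ) (h : G2) :
    μ.map (· * h) = (Measure.modularCharacterFun h) • μ := by
  have := hμ.haar
  rw [Measure.modularCharacterFun_eq_haarScalarFactor μ h]
  exact Measure.isMulLeftInvariant_eq_smul _ μ

lemma ball_pos_fin (_hμ : Good μ) : 0 < hypAreaMeasure (closedBall I 1) ∧
    hypAreaMeasure (closedBall I 1) < ⊤ := by
  refine ⟨?_, area_lt_top (isCompact_closedBall _ _)⟩
  exact lt_of_lt_of_le (area_pos_of_isOpen isOpen_ball ⟨I, mem_ball_self one_pos⟩)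
    (measure_mono ball_subset_closedBall)

lemma modular_stab (hμ : Good μ) (k : G2) (hk : k • I = I) :
    Measure.modularCharacterFun k = 1 := by
  have h := hμ.map_right k
  have hB : MeasurableSet (closedBall I 1) := isClosed_closedBall.measurableSet
  have h1 := congrArg (fun m => m {g : G2 | g • I ∈ closedBall I 1}) h
  have hm : MeasurableSet {g : G2 | g • I ∈ closedBall I 1} := meas_orb I hB
  rw [Measure.map_apply (by fun_prop) hm] at h1
  have h2 : (· * k) ⁻¹' {g : G2 | g • I ∈ closedBall I 1} = {g : G2 | g • I ∈ closedBall I 1} := by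
    ext g; simp only [Set.mem_preimage, Set.mem_ofPred_eq, mul_smul, hk]
  rw [h2, Measure.smul_apply, hμ.preim hB] at h1
  obtain ⟨p, f⟩ := hμ.ball_pos_fin
  have h3 := (ENNReal.mul_left_inj (c := hypAreaMeasure (closedBall I 1)) (a := 1) (b := (Measure.modularCharacterFun k : ENNReal)) p.ne' f.ne).1 (by
    rw [one_mul]; exact h1)
  exact_mod_cast h3.symm

lemma modular_one (hμ : Good μ) (g : G2) : Measure.modularCharacterFun g = 1 := by
  obtain ⟨h, h1, h2, h3⟩ := exists_half_turn I (g • I)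
  have e : g = h * (h⁻¹ * g) := by group
  have hk : (h⁻¹ * g) • I = I := by rw [mul_smul, inv_smul_eq_iff, h1]
  rw [e, Measure.modularCharacterFun_map_mul, hμ.modular_stab _ hk, mul_one]
  have h4 : (h * h) * (h * h) = 1 := by rw [h3]; simp
  have h5 := congrArg Measure.modularCharacterFun h4
  simp only [Measure.modularCharacterFun_map_mul, Measure.modularCharacterFun_map_one] at h5
  set c := Measure.modularCharacterFun h
  have h6 : c ^ 4 = 1 := by rw [← h5]; ring
  exact (pow_eq_one_iff_of_nonneg zero_le (by norm_num)).1 h6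

lemma rinv (hμ : Good μ) : μ.IsMulRightInvariant :=
  ⟨fun h => by rw [hμ.map_right, hμ.modular_one, one_smul]⟩

lemma inv_symm (hμ : Good μ) : μ.inv = μ := by
  have := hμ.haar
  have := hμ.rinv
  have hf : IsFiniteMeasureOnCompacts μ.inv := ⟨fun C hC => by
    rw [Measure.inv_apply]; exact hC.inv.measure_lt_top⟩
  have h := Measure.isMulLeftInvariant_eq_smul μ.inv μ
  have hB : MeasurableSet (closedBall I 1) := isClosed_closedBall.measurableSet
  have h1 := congrArg (fun m => m {g : G2 | g • I ∈ closedBall I 1}) h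
  rw [Measure.inv_apply] at h1
  have h2 : {g : G2 | g • I ∈ closedBall I 1}⁻¹ = {g : G2 | g • I ∈ closedBall I 1} := by
    ext g
    simp only [Set.mem_inv, Set.mem_ofPred_eq, mem_closedBall]
    rw [← dist_smul g (g⁻¹ • I) I, smul_inv_smul, dist_comm]
  rw [h2, Measure.smul_apply, hμ.preim hB] at h1
  obtain ⟨p, f⟩ := hμ.ball_pos_fin
  set c := Measure.haarScalarFactor μ.inv μ
  have h3 := (ENNReal.mul_left_inj (c := hypAreaMeasure (closedBall I 1)) (a := 1) (b := (c : ENNReal)) p.ne' f.ne).1 (by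
    rw [one_mul]; exact h1)
  have h4 : c = 1 := by exact_mod_cast h3.symm
  rw [h, h4, one_smul]

lemma meas_inv (hμ : Good μ) (S : Set G2) : μ (S⁻¹) = μ S := by
  rw [← Measure.inv_apply, hμ.inv_symm]

lemma meas_right (hμ : Good μ) (h : G2) (S : Set G2) : μ {g | g * h ∈ S} = μ S := by
  have := hμ.rinv
  exact measure_preimage_mul_right μ h S

lemma meas_left (hμ : Good μ) (h : G2) (S : Set G2) : μ {g | h * g ∈ S} = μ S := by
  have := hμ.inv
  exact measure_preimage_mul μ h S

lemma preim' (hμ : Good μ) {B : Set ℍ} (hB : MeasurableSet B) (z : ℍ) :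
    μ {g | g • z ∈ B} = hypAreaMeasure B := by
  obtain ⟨h, rfl⟩ := exists_smul_I z
  rw [← hμ.preim hB, ← hμ.meas_right h {g | g • I ∈ B}]
  simp only [Set.mem_ofPred_eq, mul_smul]

lemma area_inv (hμ : Good μ) {B : Set ℍ} (hB : MeasurableSet B) (h : G2) :
    hypAreaMeasure {z | h • z ∈ B} = hypAreaMeasure B := by
  have : Measurable (fun z : ℍ => h • z) := (continuous_const_smul h).measurable
  have hB' : MeasurableSet {z : ℍ | h • z ∈ B} := this hB
  rw [← hμ.preim hB, ← hμ.preim hB', ← hμ.meas_left h {g | g • I ∈ B}]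
  simp only [Set.mem_ofPred_eq, mul_smul]

end Good

/-- the set of motions moving `L` to hit `K` -/
def hitSet (K L : Set ℍ) : Set G2 := {g | ∃ z ∈ L, g • z ∈ K}

lemma hitSet_closed {K L : Set ℍ} (hK : IsClosed K) (hL : IsCompact L) :
    IsClosed (hitSet K L) := by
  have : CompactSpace L := isCompact_iff_compactSpace.1 hL
  have h1 : IsClosed {p : G2 × L | p.1 • (p.2 : ℍ) ∈ K} := by
    apply hK.preimage; fun_prop
  have h2 := isClosedMap_fst_of_compactSpace _ h1
  convert h2 using 1
  ext g; constructor
  · rintro ⟨z, hz, h⟩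
    exact ⟨(g, ⟨z, hz⟩), h, rfl⟩
  · rintro ⟨⟨g, z⟩, h, rfl⟩
    exact ⟨z, z.2, h⟩

lemma hitSet_meas {K L : Set ℍ} (hK : IsCompact K) (hL : IsCompact L) :
    MeasurableSet (hitSet K L) := (hitSet_closed hK.isClosed hL).measurableSet

lemma hitSet_inv (K L : Set ℍ) : (hitSet K L)⁻¹ = hitSet L K := by
  ext g; constructor
  · rintro ⟨z, hz, h⟩
    exact ⟨g⁻¹ • z, h, by simpa using hz⟩
  · rintro ⟨z, hz, h⟩
    exact ⟨g • z, h, by simpa using hz⟩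

lemma hitSet_mono {K K' L L' : Set ℍ} (h1 : K ⊆ K') (h2 : L ⊆ L') : hitSet K L ⊆ hitSet K' L' := by
  rintro g ⟨z, hz, h⟩
  exact ⟨z, h2 hz, h1 h⟩

namespace Good
variable {μ : Measure G2}

lemma hit_lt_top (hμ : Good μ) {K L : Set ℍ} (hK : IsCompact K) (hL : IsCompact L) :
    μ (hitSet K L) < ⊤ := by
  obtain ⟨r, hr⟩ := hK.isBounded.subset_closedBall I
  obtain ⟨s, hs⟩ := hL.isBounded.subset_closedBall I
  have h := hμ.preim (isClosed_closedBall.measurableSet : MeasurableSet (closedBall I (s + r)))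
  refine lt_of_le_of_lt (measure_mono ?_) (h.trans_lt (area_lt_top (isCompact_closedBall _ _)))
  rintro g ⟨z, hz, hgz⟩
  have h1 := hr hgz
  have h2 := hs hz
  simp only [mem_closedBall, Set.mem_ofPred_eq] at *
  calc dist (g • I) I ≤ dist (g • I) (g • z) + dist (g • z) I := dist_triangle _ _ _
    _ ≤ s + r := by rw [dist_smul, dist_comm I z]; exact add_le_add h2 h1

lemma hit_ne_top (hμ : Good μ) {K L : Set ℍ} (hK : IsCompact K) (hL : IsCompact L) :
    μ (hitSet K L) ≠ ⊤ := (hμ.hit_lt_top hK hL).ne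

end Good

/-- the kinematic functional -/
def Ph (μ : Measure G2) (K L : Set ℍ) : ℝ := μ.real (hitSet K L)

/-- translate of a set -/
def tr (h : G2) (L : Set ℍ) : Set ℍ := (fun z => h • z) '' L

lemma tr_compact (h : G2) {L : Set ℍ} (hL : IsCompact L) : IsCompact (tr h L) :=
  hL.image (continuous_const_smul h)

lemma mem_tr {h : G2} {L : Set ℍ} {z : ℍ} : z ∈ tr h L ↔ h⁻¹ • z ∈ L := by
  constructor
  · rintro ⟨w, hw, rfl⟩; simpa using hw
  · intro hz; exact ⟨h⁻¹ • z, hz, by simp⟩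

lemma tr_eq_preim (h : G2) (L : Set ℍ) : tr h L = {z | h⁻¹ • z ∈ L} := Set.ext fun _ => mem_tr

namespace Good
variable {μ : Measure G2}

lemma Ph_symm (hμ : Good μ) (K L : Set ℍ) : Ph μ K L = Ph μ L K := by
  rw [Ph, Ph, ← hitSet_inv, measureReal_def, hμ.meas_inv]; rfl

lemma Ph_tr_right (hμ : Good μ) (K L : Set ℍ) (h : G2) : Ph μ K (tr h L) = Ph μ K L := by
  rw [Ph, Ph, measureReal_def, measureReal_def, ← hμ.meas_right h (hitSet K L)]
  congr 2
  ext g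
  simp only [hitSet, tr, Set.mem_ofPred_eq, Set.exists_mem_image, smul_smul]

lemma Ph_tr_left (hμ : Good μ) (K L : Set ℍ) (h : G2) : Ph μ (tr h K) L = Ph μ K L := by
  rw [hμ.Ph_symm, hμ.Ph_tr_right, hμ.Ph_symm]

lemma Ph_point (hμ : Good μ) {K : Set ℍ} (hK : IsCompact K) (z : ℍ) : Ph μ K {z} = hypArea K := by
  rw [Ph, measureReal_def, hypArea, ← hμ.preim' hK.measurableSet z]
  congr 2
  ext g; simp [hitSet]

lemma Ph_mono (hμ : Good μ) {K K' L L' : Set ℍ} (hK : IsCompact K') (hL : IsCompact L')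
    (h1 : K ⊆ K') (h2 : L ⊆ L') : Ph μ K L ≤ Ph μ K' L' :=
  measureReal_mono (hitSet_mono h1 h2) (hμ.hit_ne_top hK hL)

lemma hypArea_tr (hμ : Good μ) {K : Set ℍ} (hK : IsCompact K) (h : G2) :
    hypArea (tr h K) = hypArea K := by
  rw [hypArea, hypArea, tr_eq_preim, hμ.area_inv hK.measurableSet]

lemma hit_real_eq (K L : Set ℍ) (μ : Measure G2) : Ph μ K L = (μ (hitSet K L)).toReal := rfl

end Good

lemma hypArea_mono {K L : Set ℍ} (hL : IsCompact L) (h : K ⊆ L) : hypArea K ≤ hypArea L :=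
  ENNReal.toReal_mono (area_lt_top hL).ne (measure_mono h)

lemma hypArea_nonneg (K : Set ℍ) : 0 ≤ hypArea K := ENNReal.toReal_nonneg

end

noncomputable section

/-- affine group law on the half plane -/
def affm (z w : ℍ) : ℍ := UpperHalfPlane.mk ⟨z.re + z.im * w.re, z.im * w.im⟩ (mul_pos z.im_pos w.im_pos)

@[simp] lemma affm_re (z w : ℍ) : (affm z w).re = z.re + z.im * w.re := rfl
@[simp] lemma affm_im (z w : ℍ) : (affm z w).im = z.im * w.im := rfl

/-- affine inverse -/
def affi (z : ℍ) : ℍ := UpperHalfPlane.mk ⟨- z.re / z.im, 1 / z.im⟩ (one_div_pos.2 z.im_pos)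

@[simp] lemma affi_re (z : ℍ) : (affi z).re = - z.re / z.im := rfl
@[simp] lemma affi_im (z : ℍ) : (affi z).im = 1 / z.im := rfl

@[reducible] def affGroup : Group ℍ where
  mul := affm
  one := I
  inv := affi
  mul_assoc a b c := by
    show affm (affm a b) c = affm a (affm b c)
    apply UpperHalfPlane.ext_re_im <;> simp <;> ring
  one_mul a := by
    show affm I a = a
    apply UpperHalfPlane.ext_re_im <;> simp
  mul_one a := by
    show affm a I = a
    apply UpperHalfPlane.ext_re_im <;> simp
  inv_mul_cancel a := by
    show affm (affi a) a = I
    have := a.im_pos.ne'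
    apply UpperHalfPlane.ext_re_im
    · simp; field_simp; ring
    · simp; field_simp

lemma affm_cont : Continuous (fun p : ℍ × ℍ => affm p.1 p.2) := by
  apply UpperHalfPlane.isEmbedding_coe.continuous_iff.2
  show Continuous (fun p : ℍ × ℍ => (⟨p.1.re + p.1.im * p.2.re, p.1.im * p.2.im⟩ : ℂ))
  have : (fun p : ℍ × ℍ => (⟨p.1.re + p.1.im * p.2.re, p.1.im * p.2.im⟩ : ℂ)) =
    fun p : ℍ × ℍ => ((p.1.re + p.1.im * p.2.re : ℝ) : ℂ) + ((p.1.im * p.2.im : ℝ) : ℂ) * Complex.I := by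
    ext p; apply Complex.ext <;> simp
  rw [this]
  have h1 := UpperHalfPlane.continuous_re
  have h2 := UpperHalfPlane.continuous_im
  fun_prop

lemma affi_cont : Continuous affi := by
  apply UpperHalfPlane.isEmbedding_coe.continuous_iff.2
  show Continuous (fun p : ℍ => (⟨- p.re / p.im, 1 / p.im⟩ : ℂ))
  have : (fun p : ℍ => (⟨- p.re / p.im, 1 / p.im⟩ : ℂ)) =
    fun p : ℍ => ((- p.re / p.im : ℝ) : ℂ) + ((1 / p.im : ℝ) : ℂ) * Complex.I := by
    ext p; apply Complex.ext <;> simp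
  rw [this]
  have h1 := UpperHalfPlane.continuous_re
  have h2 := UpperHalfPlane.continuous_im
  have h3 : ∀ p : ℍ, p.im ≠ 0 := fun p => p.im_pos.ne'
  fun_prop (disch := assumption)

/-- the affine element as a matrix -/
def amat (z : ℍ) : G2 := ⟨!![√z.im, z.re / √z.im; 0, 1 / √z.im], by
  have := Real.sqrt_pos.2 z.im_pos
  rw [Matrix.det_fin_two]; simp; field_simp⟩

lemma amat_smul (z w : ℍ) : amat z • w = affm z w := by
  have hz := z.im_pos
  have hs := Real.sqrt_pos.2 hz
  have hss := Real.sq_sqrt hz.le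
  have hq : qden (amat z) w = 1 / z.im := by
    simp [qden, amat, hss]
  have h1 := smul_re_q (amat z) w
  have h2 := smul_im_q (amat z) w
  rw [hq] at h1 h2
  apply UpperHalfPlane.ext_re_im
  · rw [mul_one_div, div_eq_iff hz.ne'] at h1
    rw [h1]; simp [amat]; field_simp; rw [hss]; ring
  · rw [mul_one_div, div_eq_iff hz.ne'] at h2
    rw [h2]; simp; ring

lemma aff_unique {μ : Measure G2} (hμ : Good μ) (ν : Measure ℍ) (hν : ν ≤ hypAreaMeasure)
    (hinv : ∀ z : ℍ, ∀ B, MeasurableSet B → ν {w | amat z • w ∈ B} = ν B) :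
    ∃ c : ℝ, 0 ≤ c ∧ ∀ B, (ν B).toReal = c * (hypAreaMeasure B).toReal := by
  letI := affGroup
  have hm : ∀ z w : ℍ, z * w = amat z • w := fun z w => (amat_smul z w).symm
  have : IsTopologicalGroup ℍ := 
    { continuous_mul := affm_cont
      continuous_inv := affi_cont }
  have i1 : ν.IsMulLeftInvariant := by
    constructor
    intro z
    ext B hB
    rw [Measure.map_apply (by fun_prop) hB, ← hinv z B hB]
    simp only [← hm]; rfl
  have i2 : hypAreaMeasure.IsMulLeftInvariant := by
    constructor
    intro z
    ext B hB
    rw [Measure.map_apply (by fun_prop) hB, ← hμ.area_inv hB (amat z)]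
    simp only [← hm]; rfl
  have i3 : hypAreaMeasure.IsHaarMeasure := {}
  have i4 : IsFiniteMeasureOnCompacts ν := ⟨fun C hC => (hν C).trans_lt (area_lt_top hC)⟩
  have h := Measure.isMulLeftInvariant_eq_smul ν hypAreaMeasure
  set c := Measure.haarScalarFactor ν hypAreaMeasure
  refine ⟨c, c.2, fun B => ?_⟩
  rw [h, Measure.smul_apply, ENNReal.toReal_smul]; rfl

end

noncomputable section

/-- lexicographic positivity with a sign -/
def lpos (σ : ℝ) (v : ℂ) : Prop := 0 < σ * v.re ∨ (v.re = 0 ∧ 0 < σ * v.im)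

lemma lpos_add {σ : ℝ} {v w : ℂ} (h1 : lpos σ v) (h2 : lpos σ w) : lpos σ (v + w) := by
  unfold lpos at *
  simp only [Complex.add_re, Complex.add_im, mul_add]
  rcases h1 with h1 | ⟨h1, h1'⟩ <;> rcases h2 with h2 | ⟨h2, h2'⟩
  · left; linarith
  · left; rw [h2]; linarith
  · left; rw [h1]; linarith
  · right; constructor <;> linarith

lemma lpos_smul {σ : ℝ} {v : ℂ} {t : ℝ} (ht : 0 < t) (h1 : lpos σ v) : lpos σ (t • v) := by
  unfold lpos at *
  simp only [Complex.real_smul, Complex.mul_re, Complex.mul_im, Complex.ofReal_re, Complex.ofReal_im,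
    zero_mul, sub_zero, add_zero]
  rcases h1 with h1 | ⟨h1, h1'⟩
  · left; have := mul_pos ht h1; linarith
  · right; refine ⟨by simp [h1], ?_⟩
    have := mul_pos ht h1'; linarith

lemma lpos_zero {σ : ℝ} : ¬ lpos σ 0 := by simp [lpos]

lemma lpos_asymm {σ : ℝ} {v : ℂ} (h : lpos σ v) (h' : lpos σ (-v)) : False := by
  have := lpos_add h h'
  rw [add_neg_cancel] at this
  exact lpos_zero this

lemma lpos_total {σ : ℝ} (hσ : σ ≠ 0) (v : ℂ) : v = 0 ∨ lpos σ v ∨ lpos σ (-v) := by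
  unfold lpos
  simp only [Complex.neg_re, Complex.neg_im, mul_neg, neg_eq_zero, Left.neg_pos_iff]
  rcases lt_trichotomy (σ * v.re) 0 with h | h | h
  · tauto
  · have h0 : v.re = 0 := (mul_eq_zero.1 h).resolve_left hσ
    rcases lt_trichotomy (σ * v.im) 0 with h' | h' | h'
    · tauto
    · have h1 : v.im = 0 := (mul_eq_zero.1 h').resolve_left hσ
      left; exact Complex.ext h0 h1
    · tauto
  · tauto

/-- weak lexicographic order -/
def lle (σ : ℝ) (p q : ℂ) : Prop := p = q ∨ lpos σ (q - p)

lemma lle_trans {σ : ℝ} {p q r : ℂ} (h1 : lle σ p q) (h2 : lle σ q r) : lle σ p r := by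
  rcases h1 with rfl | h1
  · exact h2
  · rcases h2 with rfl | h2
    · exact Or.inr h1
    · right; have := lpos_add h1 h2; simpa using this

lemma lle_antisymm {σ : ℝ} {p q : ℂ} (h1 : lle σ p q) (h2 : lle σ q p) : p = q := by
  rcases h1 with rfl | h1
  · rfl
  · rcases h2 with rfl | h2
    · rfl
    · exact (lpos_asymm h1 (by simpa using h2)).elim

lemma lle_total {σ : ℝ} (hσ : σ ≠ 0) (p q : ℂ) : lle σ p q ∨ lle σ q p := by
  rcases lpos_total hσ (q - p) with h | h | h
  · left; left; exact (sub_eq_zero.1 h).symm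
  · left; right; exact h
  · right; right; simpa using h

lemma lle_smul {σ : ℝ} {p v : ℂ} {s t : ℝ} (hv : lpos σ v) (h : s ≤ t) :
    lle σ (p + s • v) (p + t • v) := by
  rcases eq_or_lt_of_le h with rfl | h
  · left; rfl
  · right
    have := lpos_smul (sub_pos.2 h) hv
    convert this using 1; module

lemma lle_smul_neg {σ : ℝ} {p v : ℂ} {t : ℝ} (hv : lle σ v 0) (h : 0 ≤ t) :
    lle σ (p + t • v) p := by
  rcases hv with rfl | hv
  · left; simp
  · rcases eq_or_lt_of_le h with rfl | h
    · left; simp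
    · right
      have := lpos_smul h hv
      convert this using 1; module

/-- lexicographic minimum of a set -/
def IsLmin (σ : ℝ) (K : Set ℂ) (p : ℂ) : Prop := p ∈ K ∧ ∀ q ∈ K, lle σ p q

lemma exists_lmin {σ : ℝ} (hσ : σ ≠ 0) {K : Set ℂ} (hK : IsCompact K) (hne : K.Nonempty) :
    ∃ p, IsLmin σ K p := by
  obtain ⟨p1, hp1, h1⟩ := hK.exists_isMinOn hne (f := fun p : ℂ => σ * p.re) (by fun_prop)
  have hc : IsCompact (K ∩ {p | p.re = p1.re}) :=
    hK.inter_right (isClosed_eq (by fun_prop) (by fun_prop))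
  obtain ⟨p2, hp2, h2⟩ := hc.exists_isMinOn ⟨p1, hp1, rfl⟩ (f := fun p : ℂ => σ * p.im) (by fun_prop)
  refine ⟨p2, hp2.1, fun q hq => ?_⟩
  have e : p2.re = p1.re := hp2.2
  have h1q : σ * p1.re ≤ σ * q.re := h1 hq
  rcases eq_or_lt_of_le h1q with h | h
  · have hre : p1.re = q.re := mul_left_cancel₀ hσ h
    have h2q : σ * p2.im ≤ σ * q.im := h2 (⟨hq, hre.symm⟩ : q ∈ K ∩ {p | p.re = p1.re})
    rcases eq_or_lt_of_le h2q with h' | h'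
    · left; exact Complex.ext (e.trans hre) (mul_left_cancel₀ hσ h')
    · right; right; simp only [Complex.sub_re, Complex.sub_im]; constructor
      · linarith
      · linarith
  · right; left; simp only [Complex.sub_re]; rw [e]; linarith

lemma lmin_not_interior {σ : ℝ} {K : Set ℂ} {p : ℂ} (h : IsLmin σ K p) (v : ℂ) (hv : lpos σ (-v)) 
    : p ∉ interior K := by
  intro hp
  have hc : Filter.Tendsto (fun t : ℝ => p + t • v) (nhdsWithin 0 (Set.Ioi 0)) (nhds p) := by
    have : Continuous (fun t : ℝ => p + t • v) := by fun_prop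
    have h2 := this.tendsto 0
    simp only [zero_smul, add_zero] at h2
    exact h2.mono_left nhdsWithin_le_nhds
  have h1 := (hc.eventually (isOpen_interior.mem_nhds hp)).and self_mem_nhdsWithin
  obtain ⟨t, ht, ht0⟩ := h1.exists
  rcases h.2 _ (interior_subset ht) with he | he
  · have ht0 : (0 : ℝ) < t := ht0
    have : t • v = 0 := by simpa using he.symm
    rcases smul_eq_zero.1 this with h | h
    · linarith
    · rw [h] at hv; simp at hv; exact lpos_zero hv
  · have := lpos_smul ht0 hv
    exact lpos_asymm he (by convert this using 1; module)

lemma lpos_nonempty {σ : ℝ} (hσ : σ ≠ 0) : ∃ v, lpos σ (-v) :=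
  ⟨-(σ : ℂ), by left; simp; positivity⟩

/-- oriented area -/
def DD (w w' z : ℂ) : ℝ := (w'.re - w.re) * (z.im - w.im) - (w'.im - w.im) * (z.re - w.re)

lemma DD_comb (w w' x y : ℂ) {a b : ℝ} (hab : a + b = 1) :
    DD w w' (a • x + b • y) = a * DD w w' x + b * DD w w' y := by
  obtain rfl : a = 1 - b := by linarith
  simp [DD]; ring

lemma DD_line (w w' x y : ℂ) (t : ℝ) :
    DD w w' (x + t • (y - x)) = (1 - t) * DD w w' x + t * DD w w' y := by
  simp [DD]; ring

lemma DD_left (w w' : ℂ) : DD w w' w = 0 := by simp [DD]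
lemma DD_right (w w' : ℂ) : DD w w' w' = 0 := by simp [DD]; ring

lemma DD_swap (w w' z : ℂ) : DD w' w z = - DD w w' z := by simp [DD]; ring

lemma cl_re (w v : ℂ) (s : ℝ) : (w + s • v).re = w.re + s * v.re := by simp
lemma cl_im (w v : ℂ) (s : ℝ) : (w + s • v).im = w.im + s * v.im := by simp

/-- point on a line -/
lemma DD_zero {w w' z : ℂ} (h : w ≠ w') (h0 : DD w w' z = 0) : ∃ s : ℝ, z = w + s • (w' - w) := by
  by_cases hr : w'.re - w.re = 0
  · have hi : w'.im - w.im ≠ 0 := by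
      intro hi; apply h; apply Complex.ext <;> linarith
    refine ⟨(z.im - w.im) / (w'.im - w.im), ?_⟩
    unfold DD at h0
    rw [hr, zero_mul, zero_sub, neg_eq_zero, mul_eq_zero] at h0
    have h1 := h0.resolve_left hi
    apply Complex.ext
    · rw [cl_re, Complex.sub_re, hr]; linarith
    · rw [cl_im, Complex.sub_im, div_mul_cancel₀ _ hi]; ring
  · refine ⟨(z.re - w.re) / (w'.re - w.re), ?_⟩
    unfold DD at h0
    apply Complex.ext
    · rw [cl_re, Complex.sub_re, div_mul_cancel₀ _ hr]; ring
    · rw [cl_im, Complex.sub_im]; field_simp; linarith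

/-- edges of an indexed point configuration -/
def IsEdge {ι : Type*} (f : ι → ℂ) (i j : ι) : Prop :=
  i ≠ j ∧ ∀ k, 0 ≤ DD (f i) (f j) (f k) ∧ (DD (f i) (f j) (f k) = 0 → f k ∈ segment ℝ (f i) (f j))

section edges
variable {ι : Type*} {f : ι → ℂ}

lemma edge_halfplane {i j : ι} (h : IsEdge f i j) {z : ℂ}
    (hz : z ∈ convexHull ℝ (Set.range f)) : 0 ≤ DD (f i) (f j) z := by
  have hc : Convex ℝ {z | 0 ≤ DD (f i) (f j) z} := by
    intro x hx y hy a b ha hb hab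
    show 0 ≤ DD _ _ _
    rw [DD_comb _ _ _ _ hab]
    have hx : 0 ≤ DD (f i) (f j) x := hx
    have hy : 0 ≤ DD (f i) (f j) y := hy
    positivity
  exact convexHull_min (by rintro _ ⟨k, rfl⟩; exact (h.2 k).1) hc hz

lemma DD_zero_interior {w w' : ℂ} (hne : w ≠ w') {L : Set ℂ} (h : ∀ z ∈ L, DD w w' z = 0)  :
    ¬ (interior L).Nonempty := by
  rintro ⟨p, hp⟩
  have hv : ∀ v : ℂ, DD w w' (p + v) = 0 := by
    intro v
    have hc : Filter.Tendsto (fun t : ℝ => p + t • v) (nhdsWithin 0 (Set.Ioi 0)) (nhds p) := by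
      have : Continuous (fun t : ℝ => p + t • v) := by fun_prop
      have h2 := this.tendsto 0
      simp only [zero_smul, add_zero] at h2
      exact h2.mono_left nhdsWithin_le_nhds
    have h1 := (hc.eventually (isOpen_interior.mem_nhds hp)).and self_mem_nhdsWithin
    obtain ⟨t, ht, ht0⟩ := h1.exists
    have ht0 : (0 : ℝ) < t := ht0
    have e1 := h _ (interior_subset ht)
    have e2 := h _ (interior_subset hp)
    have e3 := DD_line w w' p (p + v) t
    rw [add_sub_cancel_left, e1, e2] at e3
    have : t * DD w w' (p + v) = 0 := by linarith
    exact (mul_eq_zero.1 this).resolve_left ht0.ne'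
  apply hne
  have e1 := hv 0
  have e2 := hv 1
  have e3 := hv Complex.I
  simp [DD] at e1 e2 e3
  apply Complex.ext <;> linarith

lemma edge_exists_pos {i j : ι} (hf : Function.Injective f) (h : IsEdge f i j)
    (hintr : (interior (convexHull ℝ (Set.range f))).Nonempty) : ∃ k, 0 < DD (f i) (f j) (f k) := by
  by_contra! hcon
  have hne : f i ≠ f j := fun e => h.1 (hf e)
  refine DD_zero_interior hne (fun z hz => ?_) hintr
  have hc : Convex ℝ {z | DD (f i) (f j) z = 0} := by
    intro x hx y hy a b ha hb hab
    show DD _ _ _ = 0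
    have hx : DD (f i) (f j) x = 0 := hx
    have hy : DD (f i) (f j) y = 0 := hy
    rw [DD_comb _ _ _ _ hab, hx, hy]; ring
  exact convexHull_min (by rintro _ ⟨k, rfl⟩; exact le_antisymm (hcon k) (h.2 k).1) hc hz

end edges
end

noncomputable section

lemma seg_param {x y p : ℂ} : p ∈ segment ℝ x y ↔ ∃ s : ℝ, 0 ≤ s ∧ s ≤ 1 ∧ p = x + s • (y - x) := by
  rw [segment_eq_image']
  constructor
  · rintro ⟨s, ⟨h1, h2⟩, rfl⟩; exact ⟨s, h1, h2, rfl⟩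
  · rintro ⟨s, h1, h2, rfl⟩; exact ⟨s, ⟨h1, h2⟩, rfl⟩

lemma oseg_param {x y p : ℂ} : p ∈ openSegment ℝ x y ↔ ∃ s : ℝ, 0 < s ∧ s < 1 ∧ p = x + s • (y - x) := by
  rw [openSegment_eq_image']
  constructor
  · rintro ⟨s, ⟨h1, h2⟩, rfl⟩; exact ⟨s, h1, h2, rfl⟩
  · rintro ⟨s, h1, h2, rfl⟩; exact ⟨s, ⟨h1, h2⟩, rfl⟩

section edges
variable {ι : Type*} {f : ι → ℂ}

lemma edge_cover [Fintype ι] 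
    (hintr : (interior (convexHull ℝ (Set.range f))).Nonempty) {p : ℂ}
    (hp : p ∈ convexHull ℝ (Set.range f)) (hpi : p ∉ interior (convexHull ℝ (Set.range f)))
    (hpf : ∀ i, p ≠ f i) : ∃ i j, IsEdge f i j ∧ p ∈ openSegment ℝ (f i) (f j) := by
  classical
  set L := convexHull ℝ (Set.range f) with hL
  have hconv : Convex ℝ L := convex_convexHull ℝ _
  obtain ⟨φ, hφ⟩ := geometric_hahn_banach_open_point hconv.interior isOpen_interior hpi
  have hφle : ∀ a ∈ L, φ a ≤ φ p := by
    intro a ha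
    have : a ∈ closure (interior L) := by
      rw [hconv.closure_interior_eq_closure_of_nonempty_interior hintr]; exact subset_closure ha
    exact closure_minimal (s := interior L) (t := {a | φ a ≤ φ p}) (fun b hb => (hφ b hb).le)
      (isClosed_le φ.continuous continuous_const) this
  set α := φ 1
  set β := φ Complex.I
  have hform : ∀ z : ℂ, φ z = z.re * α + z.im * β := by
    intro z
    have : z = z.re • (1 : ℂ) + z.im • Complex.I := by apply Complex.ext <;> simp
    conv_lhs => rw [this]
    rw [map_add, map_smul, map_smul]; simp [α, β]
  have hab : 0 < α ^ 2 + β ^ 2 := by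
    obtain ⟨a, ha⟩ := hintr
    have h1 := hφ a ha
    rw [hform, hform] at h1
    by_contra! hcon
    have h2 : α = 0 := by nlinarith [sq_nonneg α, sq_nonneg β]
    have h3 : β = 0 := by nlinarith [sq_nonneg α, sq_nonneg β]
    rw [h2, h3] at h1; simp at h1
  -- tangential coordinate
  let ψ : ℂ → ℝ := fun z => -β * z.re + α * z.im
  have hext : ∀ x y : ℂ, φ x = φ y → ψ x = ψ y → x = y := by
    intro x y h1 h2
    simp only [hform, ψ] at h1 h2
    apply Complex.ext
    · have : (α ^ 2 + β ^ 2) * (x.re - y.re) = 0 := by linear_combination α * h1 - β * h2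
      linarith [(mul_eq_zero.1 this).resolve_left hab.ne']
    · have : (α ^ 2 + β ^ 2) * (x.im - y.im) = 0 := by linear_combination β * h1 + α * h2
      linarith [(mul_eq_zero.1 this).resolve_left hab.ne']
  have hψ : ∀ (x v : ℂ) (s : ℝ), ψ (x + s • v) = ψ x + s * ψ v := by
    intro x v s; simp [ψ]; ring
  have hψs : ∀ x y : ℂ, ψ (x - y) = ψ x - ψ y := by
    intro x y; simp [ψ]; ring
  -- weights
  have hw : ∃ w : ι → ℝ, (∀ i, 0 ≤ w i) ∧ ∑ i, w i = 1 ∧ ∑ i, w i • f i = p := by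
    rw [hL, convexHull_range_eq_exists_affineCombination] at hp
    obtain ⟨s, w, hw0, hw1, hw2⟩ := hp
    refine ⟨fun i => if i ∈ s then w i else 0, ?_, ?_, ?_⟩
    · intro i; dsimp only; split_ifs with h
      · exact hw0 i h
      · exact le_rfl
    · simpa [Finset.sum_ite_mem] using hw1
    · rw [Finset.affineCombination_eq_linear_combination _ _ _ hw1] at hw2
      rw [← hw2]
      simp [ite_smul, Finset.sum_ite_mem]
  obtain ⟨w, hw0, hw1, hw2⟩ := hw
  have hfL : ∀ i, f i ∈ L := fun i => subset_convexHull ℝ _ ⟨i, rfl⟩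
  have hφp : ∑ i, w i * (φ p - φ (f i)) = 0 := by
    simp only [mul_sub, Finset.sum_sub_distrib, ← Finset.sum_mul, hw1, one_mul]
    have : φ p = ∑ i, w i * φ (f i) := by
      rw [← hw2, map_sum]; simp only [map_smul, smul_eq_mul]
    linarith
  have hz : ∀ i, w i * (φ p - φ (f i)) = 0 := by
    intro i
    exact (Finset.sum_eq_zero_iff_of_nonneg (fun i _ => mul_nonneg (hw0 i) (sub_nonneg.2 (hφle _ (hfL i))))).1 hφp i (Finset.mem_univ i)
  set F : Finset ι := Finset.univ.filter (fun i => φ (f i) = φ p) with hF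
  have hwF : ∀ i, i ∉ F → w i = 0 := by
    intro i hi
    rcases mul_eq_zero.1 (hz i) with h | h
    · exact h
    · exfalso; apply hi; simp [hF]; linarith
  have hFne : F.Nonempty := by
    by_contra hcon
    rw [Finset.not_nonempty_iff_eq_empty] at hcon
    have : ∑ i, w i = 0 := Finset.sum_eq_zero (fun i _ => hwF i (by simp [hcon]))
    linarith
  obtain ⟨i, hiF, hi⟩ := F.exists_min_image (fun k => ψ (f k)) hFne
  obtain ⟨j, hjF, hj⟩ := F.exists_max_image (fun k => ψ (f k)) hFne
  have hiφ : φ (f i) = φ p := by simpa [hF] using hiF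
  have hjφ : φ (f j) = φ p := by simpa [hF] using hjF
  have hψp : ψ p = ∑ k, w k * ψ (f k) := by
    rw [← hw2]; simp only [ψ, Complex.re_sum, Complex.im_sum, Finset.mul_sum, ← Finset.sum_add_distrib]
    apply Finset.sum_congr rfl; intro k _; simp; ring
  have hge : ψ (f i) ≤ ψ p := by
    have : ψ (f i) = ∑ k, w k * ψ (f i) := by rw [← Finset.sum_mul, hw1, one_mul]
    rw [this, hψp]
    apply Finset.sum_le_sum; intro k _
    by_cases hk : k ∈ F
    · exact mul_le_mul_of_nonneg_left (hi k hk) (hw0 k)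
    · simp [hwF k hk]
  have hle : ψ p ≤ ψ (f j) := by
    have : ψ (f j) = ∑ k, w k * ψ (f j) := by rw [← Finset.sum_mul, hw1, one_mul]
    rw [this, hψp]
    apply Finset.sum_le_sum; intro k _
    by_cases hk : k ∈ F
    · exact mul_le_mul_of_nonneg_left (hj k hk) (hw0 k)
    · simp [hwF k hk]
  have hgt : ψ (f i) < ψ p := lt_of_le_of_ne hge (fun e => hpf i (hext _ _ hiφ.symm e.symm))
  have hlt : ψ p < ψ (f j) := lt_of_le_of_ne hle (fun e => hpf j (hext _ _ hjφ.symm e))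
  have hpos : 0 < ψ (f j) - ψ (f i) := by linarith
  have hφl : ∀ (x y : ℂ) (s : ℝ), φ x = φ p → φ y = φ p → φ (x + s • (y - x)) = φ p := by
    intro x y s h1 h2; rw [map_add, map_smul, map_sub, h1, h2]; simp
  have hsegm : ∀ q, φ q = φ p → q = f i + ((ψ q - ψ (f i)) / (ψ (f j) - ψ (f i))) • (f j - f i) := by
    intro q hq
    apply hext
    · rw [hφl _ _ _ hiφ hjφ, hq]
    · rw [hψ, hψs, div_mul_cancel₀ _ hpos.ne']; ring
  -- the determinant
  have hD : ∀ z, (α ^ 2 + β ^ 2) * DD (f i) (f j) z = (ψ (f j) - ψ (f i)) * (φ p - φ z) := by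
    intro z
    have e1 : φ (f j) - φ (f i) = 0 := by rw [hiφ, hjφ, sub_self]
    rw [← hiφ]
    rw [hform, hform] at e1
    simp only [hform, ψ, DD]
    linear_combination (β * (z.re - (f i).re) * (-1) + α * (z.im - (f i).im)) * e1
  refine ⟨i, j, ⟨?_, ?_⟩, ?_⟩
  · rintro rfl; linarith
  · intro k
    constructor
    · have h1 := hD (f k)
      have h2 := mul_nonneg hpos.le (sub_nonneg.2 (hφle _ (hfL k)))
      rw [← h1] at h2
      exact nonneg_of_mul_nonneg_right h2 hab
    · intro h0
      have h1 := hD (f k)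
      rw [h0, mul_zero] at h1
      have h2 : φ (f k) = φ p := by
        linarith [(mul_eq_zero.1 h1.symm).resolve_left hpos.ne']
      have hkF : k ∈ F := by simp [hF, h2]
      rw [seg_param]
      refine ⟨_, ?_, ?_, hsegm _ h2⟩
      · exact div_nonneg (sub_nonneg.2 (hi k hkF)) hpos.le
      · rw [div_le_one hpos]; linarith [hj k hkF]
  · rw [oseg_param]
    refine ⟨_, ?_, ?_, hsegm _ rfl⟩
    · exact div_pos (by linarith) hpos
    · rw [div_lt_one hpos]; linarith

lemma edge_unique (hf : Function.Injective f) 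
    (hintr : (interior (convexHull ℝ (Set.range f))).Nonempty) {i j i' j' : ι}
    (h : IsEdge f i j) (h' : IsEdge f i' j') {p : ℂ} (hp : p ∈ openSegment ℝ (f i) (f j))
    (hp' : p ∈ openSegment ℝ (f i') (f j')) : i = i' ∧ j = j' := by
  have key : ∀ {i j i' j' : ι} (h : IsEdge f i j) (h' : IsEdge f i' j')
    (hp : p ∈ openSegment ℝ (f i) (f j)) (hp' : p ∈ openSegment ℝ (f i') (f j')),
    f i ∈ segment ℝ (f i') (f j') ∧ f j ∈ segment ℝ (f i') (f j') := by
    intro i j i' j' h h' hp hp'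
    obtain ⟨s, s0, s1, rfl⟩ := oseg_param.1 hp
    obtain ⟨t, t0, t1, ht⟩ := oseg_param.1 hp'
    have e1 : DD (f i') (f j') (f i + s • (f j - f i)) = 0 := by
      rw [ht, DD_line, DD_left, DD_right]; ring
    rw [DD_line] at e1
    have a1 := (h'.2 i).1
    have a2 := (h'.2 j).1
    have b1 := mul_nonneg (by linarith : 0 ≤ 1 - s) a1
    have b2 := mul_nonneg s0.le a2
    refine ⟨(h'.2 i).2 ?_, (h'.2 j).2 ?_⟩
    · have : (1 - s) * DD (f i') (f j') (f i) = 0 := by linarith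
      exact (mul_eq_zero.1 this).resolve_left (by linarith)
    · have : s * DD (f i') (f j') (f j) = 0 := by linarith
      exact (mul_eq_zero.1 this).resolve_left (by linarith)
  obtain ⟨k1, k2⟩ := key h h' hp hp'
  obtain ⟨k3, k4⟩ := key h' h hp' hp
  obtain ⟨u, u0, u1, hu⟩ := seg_param.1 k1
  obtain ⟨u', u0', u1', hu'⟩ := seg_param.1 k2
  obtain ⟨s, s0, s1, hs⟩ := seg_param.1 k3
  obtain ⟨s', s0', s1', hs'⟩ := seg_param.1 k4
  have hne : f j - f i ≠ 0 := fun e => h.1 (hf (sub_eq_zero.1 e).symm)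
  have q1 : s + u * (s' - s) = 0 := by
    have : (s + u * (s' - s)) • (f j - f i) = 0 := by
      have e : f i + (s + u * (s' - s)) • (f j - f i) = f i := by
        conv_rhs => rw [hu, hs, hs']
        module
      simpa using e
    exact (smul_eq_zero.1 this).resolve_right hne
  have q2 : s + u' * (s' - s) = 1 := by
    have : (s + u' * (s' - s) - 1) • (f j - f i) = 0 := by
      have e : f i + (s + u' * (s' - s)) • (f j - f i) = f i + (1 : ℝ) • (f j - f i) := by
        have : f i + (1 : ℝ) • (f j - f i) = f j := by simp
        rw [this]
        conv_rhs => rw [hu', hs, hs']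
        module
      rw [sub_smul, sub_eq_zero]
      exact add_left_cancel e
    linarith [(smul_eq_zero.1 this).resolve_right hne]
  rcases le_total s s' with hss | hss
  · have hs0 : s = 0 := by nlinarith [mul_nonneg u0 (sub_nonneg.2 hss)]
    have hs1 : s' = 1 := by
      rw [hs0] at q2; nlinarith
    rw [hs0] at hs; rw [hs1] at hs'
    simp at hs hs'
    exact ⟨(hf hs).symm, (hf hs').symm⟩
  · exfalso
    have hs1 : s = 1 := by nlinarith [mul_nonneg u0' (sub_nonneg.2 hss)]
    have hs0 : s' = 0 := by
      rw [hs1] at q1; nlinarith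
    rw [hs1] at hs; rw [hs0] at hs'
    simp at hs hs'
    obtain ⟨k, hk⟩ := edge_exists_pos hf h hintr
    have := (h'.2 k).1
    rw [hs, hs', DD_swap] at this
    linarith

lemma edge_local (hf : Function.Injective f) 
    (hintr : (interior (convexHull ℝ (Set.range f))).Nonempty) {i j : ι}
    (h : IsEdge f i j) {p q : ℂ} (hp : p ∈ openSegment ℝ (f i) (f j))
    (hq : 0 ≤ DD (f i) (f j) q) : 
    ∃ t : ℝ, 0 < t ∧ t ≤ 1 ∧ p + t • (q - p) ∈ convexHull ℝ (Set.range f) := by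
  obtain ⟨k, hk⟩ := edge_exists_pos hf h hintr
  obtain ⟨s, s0, s1, rfl⟩ := oseg_param.1 hp
  have hne : f i ≠ f j := fun e => h.1 (hf e)
  set b := DD (f i) (f j) q / DD (f i) (f j) (f k)
  have hb : 0 ≤ b := div_nonneg hq hk.le
  set p := f i + s • (f j - f i) with hpdef
  have hdp : DD (f i) (f j) p = 0 := by rw [hpdef, DD_line, DD_left, DD_right]; ring
  -- residual on the line
  have hres : DD (f i) (f j) (f i + (q - p - b • (f k - p))) = 0 := by
    have e1 : b * DD (f i) (f j) (f k) = DD (f i) (f j) q := div_mul_cancel₀ _ hk.ne'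
    have : DD (f i) (f j) (f i + (q - p - b • (f k - p))) = DD (f i) (f j) q - DD (f i) (f j) p
      - b * (DD (f i) (f j) (f k) - DD (f i) (f j) p) := by simp [DD]; ring
    rw [this, hdp]; linarith
  obtain ⟨a, ha⟩ := DD_zero hne hres
  have ha' : q - p = a • (f j - f i) + b • (f k - p) := by
    have := add_left_cancel ha
    rw [← this]; abel
  set M := 1 + b + |a|
  have hM : 0 < M := by positivity
  set m := min s (1 - s)
  have hm : 0 < m := lt_min s0 (by linarith)
  have hm1 : m ≤ s := min_le_left _ _
  have hm2 : m ≤ 1 - s := min_le_right _ _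
  have ht : 0 < m / M := by positivity
  have hM1 : 1 ≤ M := by have := abs_nonneg a; simp only [M]; linarith
  have htM : m / M * M = m := div_mul_cancel₀ _ hM.ne'
  set t := m / M
  have htb : t * b + t * |a| ≤ m := by
    rw [← htM]; simp only [M]; nlinarith
  have h1 := abs_le.1 (le_refl |a|)
  have hta1 : t * a ≤ t * |a| := mul_le_mul_of_nonneg_left h1.2 ht.le
  have hta2 : -(t * |a|) ≤ t * a := by have := mul_le_mul_of_nonneg_left h1.1 ht.le; linarith
  have htb0 : 0 ≤ t * b := by positivity
  have htle : t ≤ 1 := by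
    have : m / M ≤ m := div_le_self hm.le hM1
    show m / M ≤ 1
    linarith
  refine ⟨t, ht, htle, ?_⟩
  have hconv : Convex ℝ (convexHull ℝ (Set.range f)) := convex_convexHull ℝ _
  have mem : ∀ i, f i ∈ convexHull ℝ (Set.range f) := fun i => subset_convexHull ℝ _ ⟨i, rfl⟩
  have hta0 : 0 ≤ t * |a| := by positivity
  have htb1 : t * b ≤ m := by linarith
  -- barycentric
  have c1 : 0 ≤ (1 - t * b) * (1 - s) - t * a := by nlinarith
  have c2 : 0 ≤ (1 - t * b) * s + t * a := by nlinarith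
  have hsum := hconv.sum_mem (t := (Finset.univ : Finset (Fin 3)))
    (w := ![(1 - t * b) * (1 - s) - t * a, (1 - t * b) * s + t * a, t * b])
    (z := ![f i, f j, f k]) (by intro l _; fin_cases l <;> simp <;> first | exact htb0 | linarith)
    (by simp [Fin.sum_univ_three]; ring) (by intro l _; fin_cases l <;> simp [mem])
  convert hsum using 1
  rw [ha']
  clear_value t b
  simp [Fin.sum_univ_three, hpdef]
  ring

end edges
end

noncomputable section
open Classical in
/-- lower endpoint -/
def low (σ : ℝ) (a b : ℂ) : ℂ := if lpos σ (b - a) then a else b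

lemma low_spec {σ : ℝ} (hσ : σ ≠ 0) {a b : ℂ} (h : a ≠ b) : ∃ u, lpos σ (u - low σ a b) ∧
    segment ℝ (low σ a b) u = segment ℝ a b ∧ openSegment ℝ (low σ a b) u = openSegment ℝ a b ∧ 
    ((low σ a b = a ∧ u = b) ∨ (low σ a b = b ∧ u = a)) := by
  by_cases hl : lpos σ (b - a)
  · refine ⟨b, ?_⟩
    rw [low, if_pos hl]; exact ⟨hl, rfl, rfl, Or.inl ⟨rfl, rfl⟩⟩
  · refine ⟨a, ?_⟩
    rw [low, if_neg hl]; refine ⟨?_, segment_symm ℝ _ _, openSegment_symm ℝ _ _, Or.inr ⟨rfl, rfl⟩⟩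
    rcases lpos_total hσ (a - b) with h' | h' | h'
    · exact absurd (sub_eq_zero.1 h') h
    · exact h'
    · exact absurd (by simpa using h') hl

section
variable {ι : Type*} 

/-- qualifying edge -/
def QQ (σ : ℝ) (K : Set ℂ) (f : ι → ℂ) (p0 : ℂ) (i j : ι) : Prop :=
  IsEdge f i j ∧ (K ∩ segment ℝ (f i) (f j)).Nonempty ∧ low σ (f i) (f j) ∉ K ∧
    DD (f i) (f j) p0 < 0

lemma qq_aux {σ : ℝ} (hσ : σ ≠ 0) {K : Set ℂ} (hK : Convex ℝ K) {f : ι → ℂ}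
    (hf : Function.Injective f) {p0 q : ℂ} {i j : ι} (h : QQ σ K f p0 i j) (hp0 : p0 ∈ K)
    (hq : q ∈ K) (hle : lle σ p0 q) (hD : 0 ≤ DD (f i) (f j) q) :
    ∃ (y u z : ℂ) (s r : ℝ), y ∈ K ∧ lle σ y q ∧ lpos σ (u - low σ (f i) (f j)) ∧
      segment ℝ (low σ (f i) (f j)) u = segment ℝ (f i) (f j) ∧ 
      y = low σ (f i) (f j) + s • (u - low σ (f i) (f j)) ∧ 0 < s ∧
      z = low σ (f i) (f j) + r • (u - low σ (f i) (f j)) ∧ 0 ≤ r ∧ r ≤ 1 ∧ z ∈ K := by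
  obtain ⟨he, ⟨z, hzK, hz⟩, hl, hD0⟩ := h
  have hne : f i ≠ f j := fun e => he.1 (hf e)
  obtain ⟨u, hu, hseg, -, hcase⟩ := low_spec hσ hne
  rw [← hseg] at hz
  obtain ⟨r, r0, r1, hr⟩ := seg_param.1 hz
  set l := low σ (f i) (f j)
  set a := DD (f i) (f j) q
  set b := DD (f i) (f j) p0
  have hab : 0 < a - b := by linarith
  set t := a / (a - b)
  have ht0 : 0 ≤ t := div_nonneg hD hab.le
  have ht1 : t ≤ 1 := by rw [div_le_one hab]; linarith
  have hyK : q + t • (p0 - q) ∈ K :=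
    hK.segment_subset hq hp0 (seg_param.2 ⟨t, ht0, ht1, rfl⟩)
  have hyle : lle σ (q + t • (p0 - q)) q := by
    apply lle_smul_neg _ ht0
    rcases hle with rfl | hle
    · left; simp
    · right; simpa using hle
  have hyD : DD (f i) (f j) (q + t • (p0 - q)) = 0 := by
    rw [DD_line]; show (1 - t) * a + t * b = 0
    have : t * (a - b) = a := div_mul_cancel₀ _ hab.ne'
    linarith
  generalize q + t • (p0 - q) = y at *
  have hyD' : DD l u y = 0 := by
    rcases hcase with ⟨e1, e2⟩ | ⟨e1, e2⟩
    · rw [e1, e2]; exact hyD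
    · rw [e1, e2, DD_swap, hyD, neg_zero]
  have hlu : l ≠ u := by rintro e; rw [e, sub_self] at hu; exact lpos_zero hu
  obtain ⟨s, hs⟩ := DD_zero hlu hyD'
  refine ⟨y, u, z, s, r, hyK, hyle, hu, hseg, hs, ?_, hr, r0, r1, hzK⟩
  by_contra! hs0
  apply hl
  refine hK.segment_subset hyK hzK ?_
  rw [seg_param]
  rcases eq_or_lt_of_le r0 with r0 | r0
  · refine ⟨1, zero_le_one, le_rfl, ?_⟩
    rw [hr, ← r0]; module
  · have hrs : 0 < r - s := by linarith
    refine ⟨(-s) / (r - s), div_nonneg (by linarith) hrs.le, by rw [div_le_one hrs]; linarith, ?_⟩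
    have e : z - y = (r - s) • (u - l) := by rw [hr, hs]; module
    rw [e, smul_smul, div_mul_cancel₀ _ hrs.ne', hs]; module

lemma lmin_hull {σ : ℝ} {f : ι → ℂ} {i : ι} (h : ∀ k, lle σ (f i) (f k)) {z : ℂ}
    (hz : z ∈ convexHull ℝ (Set.range f)) : lle σ (f i) z := by
  have hc : Convex ℝ {z | lle σ (f i) z} := by
    intro x hx y hy a b ha hb hab
    obtain rfl : a = 1 - b := by linarith
    rcases eq_or_lt_of_le hb with rfl | hb'
    · simpa using hx
    rcases eq_or_lt_of_le ha with ha' | ha'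
    · obtain rfl : b = 1 := by linarith
      simpa using hy
    have hx : lle σ (f i) x := hx
    have hy : lle σ (f i) y := hy
    have e : (1 - b) • x + b • y - f i = (1 - b) • (x - f i) + b • (y - f i) := by module
    show lle σ (f i) ((1 - b) • x + b • y)
    rcases hx with hx | hx <;> rcases hy with hy | hy
    · left; rw [← hx, ← hy]; module
    · right; rw [e, ← hx, sub_self, smul_zero, zero_add]; exact lpos_smul hb' hy
    · right; rw [e, ← hy, sub_self, smul_zero, add_zero]; exact lpos_smul ha' hx
    · right; rw [e]; exact lpos_add (lpos_smul ha' hx) (lpos_smul hb' hy)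
  exact convexHull_min (by rintro _ ⟨k, rfl⟩; exact h k) hc hz

open Classical in
theorem count_lemma [Fintype ι] {σ : ℝ} (hσ : σ ≠ 0) {f : ι → ℂ} (hf : Function.Injective f)
    (hintr : (interior (convexHull ℝ (Set.range f))).Nonempty) {K : Set ℂ} (hKc : IsCompact K)
    (hK : Convex ℝ K) {p0 : ℂ} (hp0 : IsLmin σ K p0) (hfr : ∀ i, f i ∉ frontier K) :
    (if (K ∩ convexHull ℝ (Set.range f)).Nonempty then (1 : ℝ) else 0) =
      (if p0 ∈ convexHull ℝ (Set.range f) then 1 else 0) +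
      ∑ i, (if f i ∈ K ∧ ∀ k, lle σ (f i) (f k) then 1 else 0) +
      ∑ e : ι × ι, (if QQ σ K f p0 e.1 e.2 then 1 else 0) := by
  set L := convexHull ℝ (Set.range f) with hLdef
  have hLc : IsCompact L := (Set.finite_range f).isCompact_convexHull ℝ
  have hfL : ∀ i, f i ∈ L := fun i => subset_convexHull ℝ _ ⟨i, rfl⟩
  have hLconv : Convex ℝ L := convex_convexHull ℝ _
  obtain ⟨v0, hv0⟩ := lpos_nonempty hσ
  by_cases h1 : p0 ∈ L
  · rw [if_pos h1, if_pos ⟨p0, hp0.1, h1⟩, Finset.sum_eq_zero, Finset.sum_eq_zero]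
    · ring
    · rintro ⟨i, j⟩ _
      rw [if_neg]
      rintro ⟨he, -, -, hD⟩
      linarith [edge_halfplane he h1]
    · intro i _
      rw [if_neg]
      rintro ⟨hi, hmin⟩
      have e : f i = p0 := lle_antisymm (lmin_hull hmin h1) (hp0.2 _ hi)
      apply hfr i
      refine ⟨subset_closure hi, ?_⟩
      rw [e]; exact lmin_not_interior hp0 v0 hv0
  rw [if_neg h1, zero_add]
  by_cases h2 : ∃ i, f i ∈ K ∧ ∀ k, lle σ (f i) (f k)
  · obtain ⟨i, hi, hmin⟩ := h2
    rw [if_pos ⟨f i, hi, hfL i⟩, Finset.sum_eq_single i, if_pos ⟨hi, hmin⟩, Finset.sum_eq_zero]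
    · ring
    · rintro ⟨i', j'⟩ _
      rw [if_neg]
      intro hQ
      obtain ⟨y, u, z, s, r, hyK, hyle, hu, hseg, hy, hs0, -, -, -, -⟩ := qq_aux hσ hK hf hQ hp0.1 hi (hp0.2 _ hi) (hQ.1.2 i).1
      have hl : lle σ (f i) (low σ (f i') (f j')) := by
        rw [low]; split_ifs
        · exact hmin _
        · exact hmin _
      have h3 : lle σ y (low σ (f i') (f j')) := lle_trans hyle hl
      have h4 := lle_smul (p := low σ (f i') (f j')) hu hs0.le
      rw [zero_smul, add_zero, ← hy] at h4
      have h5 := lle_antisymm h3 h4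
      exact hQ.2.2.1 (h5 ▸ hyK)
    · intro i' _ hne
      rw [if_neg]
      rintro ⟨_, hmin'⟩
      exact hne (hf (lle_antisymm (hmin' i) (hmin i')))
    · intro h; exact absurd (Finset.mem_univ i) h
  have hsum0 : ∑ i, (if f i ∈ K ∧ ∀ k, lle σ (f i) (f k) then (1 : ℝ) else 0) = 0 := by
    apply Finset.sum_eq_zero
    intro i _
    rw [if_neg]
    intro h; exact h2 ⟨i, h⟩
  rw [hsum0, zero_add]
  by_cases h3 : (K ∩ L).Nonempty
  swap
  · rw [if_neg h3, Finset.sum_eq_zero]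
    rintro ⟨i, j⟩ _
    rw [if_neg]
    rintro ⟨-, ⟨z, hz, hz'⟩, -⟩
    exact h3 ⟨z, hz, hLconv.segment_subset (hfL i) (hfL j) hz'⟩
  rw [if_pos h3]
  obtain ⟨p, ⟨hpK, hpL⟩, hpmin⟩ := exists_lmin hσ (hKc.inter hLc) h3
  have small : ∀ {q : ℂ} {t : ℝ}, 0 < t → lle σ q p → q ≠ p → p + t • (q - p) ∈ K ∩ L → False := by
    intro q t ht hq hne hm
    have h5 : lle σ (p + t • (q - p)) p := by
      apply lle_smul_neg _ ht.le
      rcases hq with rfl | hq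
      · left; simp
      · right; simpa using hq
    have h6 := lle_antisymm h5 (hpmin _ hm)
    have : t • (q - p) = 0 := by simpa using h6
    rcases smul_eq_zero.1 this with h | h
    · linarith
    · exact hne (sub_eq_zero.1 h)
  have near : ∀ {q : ℂ} {A : Set ℂ}, p ∈ interior A → ∃ t : ℝ, 0 < t ∧ t ≤ 1 ∧ p + t • (q - p) ∈ A := by
    intro q A hp
    have hc : Filter.Tendsto (fun t : ℝ => p + t • (q - p)) (nhdsWithin 0 (Set.Ioi 0)) (nhds p) := by
      have : Continuous (fun t : ℝ => p + t • (q - p)) := by fun_prop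
      have h2 := this.tendsto 0
      simp only [zero_smul, add_zero] at h2
      exact h2.mono_left nhdsWithin_le_nhds
    have h4 := (hc.eventually (isOpen_interior.mem_nhds hp)).and (Ioc_mem_nhdsGT (zero_lt_one' ℝ))
    obtain ⟨t, ht, ht0⟩ := h4.exists
    exact ⟨t, ht0.1, ht0.2, interior_subset ht⟩
  have hp0p : lle σ p0 p := hp0.2 _ hpK
  have hp0ne : p0 ≠ p := by rintro rfl; exact h1 hpL
  have hpiL : p ∉ interior L := by
    intro hp
    obtain ⟨t, t0, t1, ht⟩ := near (q := p0) hp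
    exact small t0 hp0p hp0ne ⟨hK.segment_subset hpK hp0.1 (seg_param.2 ⟨t, t0.le, t1, rfl⟩), ht⟩
  -- minimal vertex
  have hne : (Set.range f).Nonempty := by
    by_contra h
    rw [Set.not_nonempty_iff_eq_empty] at h
    rw [hLdef, h, convexHull_empty] at h3; simp at h3
  obtain ⟨w, ⟨i0, rfl⟩, hw⟩ := exists_lmin hσ (Set.finite_range f).isCompact hne
  have hmin0 : ∀ k, lle σ (f i0) (f k) := fun k => hw _ ⟨k, rfl⟩
  have hi0 : f i0 ∉ K := fun h => h2 ⟨i0, h, hmin0⟩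
  have hpiK : p ∉ interior K := by
    intro hp
    obtain ⟨t, t0, t1, ht⟩ := near (q := f i0) hp
    exact small t0 (lmin_hull hmin0 hpL) (by rintro e; exact hi0 (e ▸ hpK))
      ⟨ht, hLconv.segment_subset hpL (hfL i0) (seg_param.2 ⟨t, t0.le, t1, rfl⟩)⟩
  have hpf : ∀ i, p ≠ f i := by
    rintro i rfl
    exact hfr i ⟨subset_closure hpK, hpiK⟩
  obtain ⟨i, j, he, hpe⟩ := edge_cover hintr hpL hpiL hpf
  have hfij : f i ≠ f j := fun e => he.1 (hf e)
  have hQ : QQ σ K f p0 i j := by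
    refine ⟨he, ⟨p, hpK, openSegment_subset_segment ℝ _ _ hpe⟩, ?_, ?_⟩
    · obtain ⟨u, hu, hseg, hoseg, hc⟩ := low_spec hσ hfij
      intro hl
      rw [← hoseg] at hpe
      obtain ⟨s, s0, s1, hs⟩ := oseg_param.1 hpe
      have hlL : low σ (f i) (f j) ∈ L := by rw [low]; split_ifs <;> exact hfL _
      have h4 := lle_smul (p := low σ (f i) (f j)) hu s0.le
      rw [zero_smul, add_zero, ← hs] at h4
      have h5 := lle_antisymm h4 (hpmin _ ⟨hl, hlL⟩)
      rw [low] at h5; split_ifs at h5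
      · exact hpf _ h5.symm
      · exact hpf _ h5.symm
    · by_contra! hD
      obtain ⟨t, t0, t1, ht⟩ := edge_local hf hintr he hpe hD
      exact small t0 hp0p hp0ne ⟨hK.segment_subset hpK hp0.1 (seg_param.2 ⟨t, t0.le, t1, rfl⟩), ht⟩
  rw [Finset.sum_eq_single (i, j), if_pos hQ]
  · rintro ⟨i', j'⟩ _ hne'
    rw [if_neg]
    intro hQ'
    obtain ⟨y, u, z, s, r, hyK, hyle, hu, hseg, hy, hs0, hz, hr0, hr1, hzK⟩ :=
      qq_aux hσ hK hf hQ' hp0.1 hpK hp0p (edge_halfplane hQ'.1 hpL)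
    have hsegL : segment ℝ (f i') (f j') ⊆ L := hLconv.segment_subset (hfL _) (hfL _)
    have hzs : z ∈ segment ℝ (f i') (f j') := by
      rw [← hseg, seg_param]; exact ⟨r, hr0, hr1, hz⟩
    rcases le_or_gt s 1 with hs1 | hs1
    · have hys : y ∈ segment ℝ (f i') (f j') := by
        rw [← hseg, seg_param]; exact ⟨s, hs0.le, hs1, hy⟩
      have e := lle_antisymm hyle (hpmin _ ⟨hyK, hsegL hys⟩)
      rw [e] at hys
      have hpo : p ∈ openSegment ℝ (f i') (f j') :=
        mem_openSegment_of_ne_left_right (hpf i').symm (hpf j').symm hys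
      obtain ⟨e1, e2⟩ := edge_unique hf hintr he hQ'.1 hpe hpo
      exact hne' (by rw [e1, e2])
    · have h4 := lpos_smul (t := s - r) (by linarith) hu
      have h5 : lpos σ (y - z) := by
        convert h4 using 1; rw [hy, hz]; module
      have h6 : lle σ y z := lle_trans hyle (hpmin _ ⟨hzK, hsegL hzs⟩)
      rcases h6 with e | h6
      · rw [e, sub_self] at h5; exact lpos_zero h5
      · exact lpos_asymm h5 (by simpa using h6)
  · intro h; exact absurd (Finset.mem_univ _) h

end
end

noncomputable section

lemma kap_cont : Continuous kap := by
  have : kap = fun z : ℍ => ((z.re : ℝ) : ℂ) + ((z.re ^ 2 + z.im ^ 2 : ℝ) : ℂ) * Complex.I := by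
    ext z; apply Complex.ext <;> simp [kap, nsq, pow_two]
  rw [this]
  have h1 := UpperHalfPlane.continuous_re
  have h2 := UpperHalfPlane.continuous_im
  fun_prop

/-- inverse of `kap`, with values in the complex plane -/
def kinv (p : ℂ) : ℂ := (p.re : ℂ) + ((√(p.im - p.re ^ 2) : ℝ) : ℂ) * Complex.I

lemma kinv_cont : Continuous kinv := by unfold kinv; fun_prop

lemma kinv_kap (z : ℍ) : kinv (kap z) = z := by
  have := z.im_pos
  apply Complex.ext
  · simp [kinv]
  · simp only [kinv, kap_re, kap_im, nsq]
    rw [show z.re ^ 2 + z.im ^ 2 - z.re ^ 2 = z.im ^ 2 by ring, Real.sqrt_sq this.le]; simp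

lemma kinv_diff : DifferentiableOn ℝ kinv kdom := by
  intro p hp
  have h : p.im - p.re ^ 2 ≠ 0 := by
    have : p.re ^ 2 < p.im := hp
    linarith
  have h1 : DifferentiableAt ℝ (fun p : ℂ => p.re) p := Complex.reCLM.differentiableAt
  have h2 : DifferentiableAt ℝ (fun p : ℂ => p.im) p := Complex.imCLM.differentiableAt
  have h3 : DifferentiableAt ℝ (fun p : ℂ => √(p.im - p.re ^ 2)) p :=
    (h2.sub (h1.pow 2)).sqrt h
  have h4 : ∀ {u : ℂ → ℝ}, DifferentiableAt ℝ u p → DifferentiableAt ℝ (fun p => (u p : ℂ)) p :=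
    fun hu => (Complex.ofRealCLM.differentiableAt).comp p hu
  exact ((h4 h1).add ((h4 h3).mul_const _)).differentiableWithinAt

lemma kdom_open : IsOpen kdom := isOpen_lt (by fun_prop) (by fun_prop)

lemma kap_open : IsOpenMap kap := by
  intro U hU
  have : kap '' U = kdom ∩ kinv ⁻¹' ((fun z : ℍ => (z : ℂ)) '' U) := by
    ext p; constructor
    · rintro ⟨z, hz, rfl⟩
      exact ⟨kap_mem z, z, hz, (kinv_kap z).symm⟩
    · rintro ⟨hp, z, hz, h⟩
      obtain ⟨w, rfl⟩ := exists_kap hp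
      rw [kinv_kap] at h
      obtain rfl := UpperHalfPlane.ext h
      exact ⟨_, hz, rfl⟩
  rw [this]
  exact kdom_open.inter ((isOpenEmbedding_coe.isOpenMap U hU).preimage kinv_cont)

lemma kap_emb : Topology.IsOpenEmbedding kap :=
  .of_continuous_injective_isOpenMap kap_cont kap_inj kap_open

lemma kap_interior (K : Set ℍ) : kap '' interior K = interior (kap '' K) := by
  have h := kap_open.preimage_interior_eq_interior_preimage kap_cont (kap '' K)
  rw [Set.preimage_image_eq _ kap_inj] at h
  rw [← h, Set.image_preimage_eq_iff]
  exact interior_subset.trans (Set.image_subset_range _ _)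

lemma kap_frontier_iff (K : Set ℍ) (z : ℍ) : kap z ∈ frontier (kap '' K) ↔ z ∈ frontier K := by
  have h := kap_open.preimage_frontier_eq_frontier_preimage kap_cont (kap '' K)
  rw [Set.preimage_image_eq _ kap_inj] at h
  rw [← h]; rfl

lemma kap_image_mem {K : Set ℍ} {z : ℍ} : kap z ∈ kap '' K ↔ z ∈ K := kap_inj.mem_set_image

/-- null sets in the Klein chart are null -/
lemma null_of_kap {B : Set ℍ} (hB : MeasurableSet B) (h : volume (kap '' B) = 0) :
    hypAreaMeasure B = 0 := by
  rw [area_eq B hB]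
  have e : (fun z : ℍ => (z : ℂ)) '' B = kinv '' (kap '' B) := by
    rw [Set.image_image]; apply Set.image_congr; intro z _; rw [kinv_kap]
  have h0 : volume ((fun z : ℍ => (z : ℂ)) '' B) = 0 := by
    rw [e]
    apply addHaar_image_eq_zero_of_differentiableOn_of_addHaar_eq_zero _ _ h
    apply kinv_diff.mono
    rintro _ ⟨z, _, rfl⟩
    exact kap_mem z
  rw [setLIntegral_measure_zero _ _ h0]

lemma frontier_null {K : Set ℍ} (hK : HypConvex K) : hypAreaMeasure (frontier K) = 0 := by
  apply null_of_kap isClosed_frontier.measurableSet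
  refine measure_mono_null ?_ (((hypConvex_iff K).1 hK).addHaar_frontier volume)
  rintro _ ⟨z, hz, rfl⟩
  exact (kap_frontier_iff K z).2 hz

lemma DD_cont {a b : ℂ} : Continuous (DD a b) := by unfold DD; fun_prop

lemma line_null {a b : ℂ} (h : a ≠ b) : hypAreaMeasure {z | DD a b (kap z) = 0} = 0 := by
  have hc : IsClosed {p : ℂ | DD a b p = 0} := isClosed_eq DD_cont continuous_const
  have hcx : Convex ℝ {p : ℂ | DD a b p = 0} := by
    intro x hx y hy s t hs ht hst
    have hx : DD a b x = 0 := hx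
    have hy : DD a b y = 0 := hy
    show DD a b _ = 0
    rw [DD_comb _ _ _ _ hst, hx, hy]; simp
  have h0 := hcx.addHaar_frontier volume
  have hi : interior {p : ℂ | DD a b p = 0} = ∅ :=
    Set.not_nonempty_iff_eq_empty.1 (DD_zero_interior h (fun z hz => hz))
  rw [hc.frontier_eq, hi, Set.sdiff_empty] at h0
  apply null_of_kap (hc.preimage kap_cont).measurableSet
  refine measure_mono_null ?_ h0
  rintro _ ⟨z, hz, rfl⟩
  exact hz

lemma DD_inv (g : G2) (z1 z2 z3 : ℍ) :
    DD (kap (g • z1)) (kap (g • z2)) (kap (g • z3)) * (qden g z1 * qden g z2 * qden g z3) =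
      DD (kap z1) (kap z2) (kap z3) := by
  have h1 := qden_pos g z1
  have h2 := qden_pos g z2
  have h3 := qden_pos g z3
  have hd := g2_det g
  have a1 := eq_div_of_mul_eq h1.ne' (smul_re_q g z1)
  have a2 := eq_div_of_mul_eq h2.ne' (smul_re_q g z2)
  have a3 := eq_div_of_mul_eq h3.ne' (smul_re_q g z3)
  have b1 := eq_div_of_mul_eq h1.ne' (smul_nsq_q g z1)
  have b2 := eq_div_of_mul_eq h2.ne' (smul_nsq_q g z2)
  have b3 := eq_div_of_mul_eq h3.ne' (smul_nsq_q g z3)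
  simp only [DD, kap_re, kap_im]
  rw [a1, a2, a3, b1, b2, b3]
  have : ∀ x1 x2 x3 y1 y2 y3 : ℝ, ∀ a b c d q1 q2 q3 : ℝ, q1 ≠ 0 → q2 ≠ 0 → q3 ≠ 0 → a * d - b * c = 1 →
    q1 = c ^ 2 * y1 + 2 * c * d * x1 + d ^ 2 → q2 = c ^ 2 * y2 + 2 * c * d * x2 + d ^ 2 →
    q3 = c ^ 2 * y3 + 2 * c * d * x3 + d ^ 2 → 
    (((a * c * y2 + (a * d + b * c) * x2 + b * d) / q2 - (a * c * y1 + (a * d + b * c) * x1 + b * d) / q1) *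
     ((a ^ 2 * y3 + 2 * a * b * x3 + b ^ 2) / q3 - (a ^ 2 * y1 + 2 * a * b * x1 + b ^ 2) / q1) - 
     ((a ^ 2 * y2 + 2 * a * b * x2 + b ^ 2) / q2 - (a ^ 2 * y1 + 2 * a * b * x1 + b ^ 2) / q1) * 
     ((a * c * y3 + (a * d + b * c) * x3 + b * d) / q3 - (a * c * y1 + (a * d + b * c) * x1 + b * d) / q1)) * 
     (q1 * q2 * q3) = (x2 - x1) * (y3 - y1) - (y2 - y1) * (x3 - x1) := by
    intro x1 x2 x3 y1 y2 y3 a b c d q1 q2 q3 h1 h2 h3 hd e1 e2 e3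
    have key : ((x2 - x1) * (y3 - y1) - (y2 - y1) * (x3 - x1)) = 
      (a * d - b * c) ^ 3 * ((x2 - x1) * (y3 - y1) - (y2 - y1) * (x3 - x1)) := by rw [hd]; ring
    rw [key]
    have : ∀ X1 X2 X3 Y1 Y2 Y3 : ℝ, ((X2 / q2 - X1 / q1) * (Y3 / q3 - Y1 / q1) - 
      (Y2 / q2 - Y1 / q1) * (X3 / q3 - X1 / q1)) * (q1 * q2 * q3) =
      q1 * (X2 * Y3 - Y2 * X3) - q2 * (X1 * Y3 - Y1 * X3) + q3 * (X1 * Y2 - Y1 * X2) := by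
      intros; field_simp; ring
    rw [this, e1, e2, e3]
    ring
  exact this _ _ _ _ _ _ _ _ _ _ _ _ _ h1.ne' h2.ne' h3.ne' hd rfl rfl rfl

lemma DD_inv_neg (g : G2) (z1 z2 z3 : ℍ) :
    DD (kap (g • z1)) (kap (g • z2)) (kap (g • z3)) < 0 ↔ DD (kap z1) (kap z2) (kap z3) < 0 := by
  rw [← DD_inv g z1 z2 z3]
  have h1 := qden_pos g z1
  have h2 := qden_pos g z2
  have h3 := qden_pos g z3
  have : 0 < qden g z1 * qden g z2 * qden g z3 := by positivity
  constructor <;> intro h <;> nlinarith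

lemma DD_inv_zero (g : G2) (z1 z2 z3 : ℍ) :
    DD (kap (g • z1)) (kap (g • z2)) (kap (g • z3)) = 0 ↔ DD (kap z1) (kap z2) (kap z3) = 0 := by
  rw [← DD_inv g z1 z2 z3]
  have h1 := qden_pos g z1
  have h2 := qden_pos g z2
  have h3 := qden_pos g z3
  simp [h1.ne', h2.ne', h3.ne']

lemma kseg_smul (g : G2) (z w p : ℍ) : kap (g • p) ∈ segment ℝ (kap (g • z)) (kap (g • w)) ↔
    kap p ∈ segment ℝ (kap z) (kap w) := by
  rw [← hseg_iff, ← hseg_iff, dist_smul, dist_smul, dist_smul]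

lemma edge_smul {ι : Type*} (g : G2) (s : ι → ℍ) (i j : ι) :
    IsEdge (fun k => kap (g • s k)) i j ↔ IsEdge (fun k => kap (s k)) i j := by
  unfold IsEdge
  simp only [DD_inv_zero, kseg_smul]
  simp only [← not_lt, DD_inv_neg]

/-- hyperbolic convex hull -/
def hull (S : Set ℍ) : Set ℍ := kap ⁻¹' convexHull ℝ (kap '' S)

lemma kap_hull (S : Set ℍ) : kap '' hull S = convexHull ℝ (kap '' S) := by
  rw [hull, Set.image_preimage_eq_iff, range_kap]
  apply convexHull_min _ kdom_convex
  rintro _ ⟨z, _, rfl⟩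
  exact kap_mem z

lemma hull_convex (S : Set ℍ) : HypConvex (hull S) := by
  rw [hypConvex_iff, kap_hull]; exact convex_convexHull _ _

lemma subset_hull (S : Set ℍ) : S ⊆ hull S := fun z hz =>
  subset_convexHull ℝ _ (Set.mem_image_of_mem _ hz)

lemma hull_min {S K : Set ℍ} (h : S ⊆ K) (hK : HypConvex K) : hull S ⊆ K := by
  intro z hz
  have : convexHull ℝ (kap '' S) ⊆ kap '' K :=
    convexHull_min (Set.image_mono h) ((hypConvex_iff K).1 hK)
  exact kap_image_mem.1 (this hz)

lemma tr_convex (g : G2) {K : Set ℍ} (hK : HypConvex K) : HypConvex (tr g K) := by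
  intro x hx y hy z hz
  rw [mem_tr] at *
  exact hK _ hx _ hy _ (by simpa [dist_smul] using hz)

lemma hull_tr (g : G2) (S : Set ℍ) : hull (tr g S) = tr g (hull S) := by
  have key : ∀ (g : G2) (S : Set ℍ), hull (tr g S) ⊆ tr g (hull S) := fun g S =>
    hull_min (Set.image_mono (subset_hull S)) (tr_convex g (hull_convex S))
  apply (key g S).antisymm
  intro z hz
  have h1 : tr g⁻¹ (tr g S) = S := by
    ext w; simp [mem_tr]
  have h2 := key g⁻¹ (tr g S)
  rw [h1] at h2
  rw [mem_tr] at hz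
  have := h2 hz
  rw [mem_tr] at this
  simpa using this

lemma compact_iff_kap {K : Set ℍ} : IsCompact K ↔ IsCompact (kap '' K) :=
  kap_emb.isInducing.isCompact_iff

lemma hull_compact {S : Set ℍ} (hS : S.Finite) : IsCompact (hull S) := by
  rw [compact_iff_kap, kap_hull]
  exact (hS.image kap).isCompact_convexHull ℝ

/-- geodesic segment -/
def hseg (z w : ℍ) : Set ℍ := {p | kap p ∈ segment ℝ (kap z) (kap w)}

lemma hseg_eq_hull (z w : ℍ) : hseg z w = hull {z, w} := by
  unfold hseg hull; rw [Set.image_pair, convexHull_pair]; rfl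

lemma hseg_compact (z w : ℍ) : IsCompact (hseg z w) := by
  rw [hseg_eq_hull]; exact hull_compact (by simp)

lemma hseg_convex (z w : ℍ) : HypConvex (hseg z w) := by
  rw [hseg_eq_hull]; exact hull_convex _

lemma mem_hseg {z w p : ℍ} : p ∈ hseg z w ↔ dist z p + dist p w = dist z w := (hseg_iff ..).symm

lemma left_mem_hseg (z w : ℍ) : z ∈ hseg z w := left_mem_segment ..
lemma right_mem_hseg (z w : ℍ) : w ∈ hseg z w := right_mem_segment ..

lemma hseg_symm (z w : ℍ) : hseg z w = hseg w z := by unfold hseg; rw [segment_symm]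

lemma kap_hseg (z w : ℍ) : kap '' hseg z w = segment ℝ (kap z) (kap w) := by
  rw [hseg_eq_hull, kap_hull, Set.image_pair, convexHull_pair]

lemma tr_hseg (g : G2) (z w : ℍ) : tr g (hseg z w) = hseg (g • z) (g • w) := by
  rw [hseg_eq_hull, hseg_eq_hull, ← hull_tr, tr, Set.image_pair]

lemma hseg_subset {K : Set ℍ} (hK : HypConvex K) {z w : ℍ} (hz : z ∈ K) (hw : w ∈ K) :
    hseg z w ⊆ K := by
  rw [hseg_eq_hull]; exact hull_min (by simp [Set.insert_subset_iff, hz, hw]) hK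

lemma lle_amat (σ : ℝ) (a z w : ℍ) : lle σ (kap (amat a • z)) (kap (amat a • w)) ↔ lle σ (kap z) (kap w) := by
  have ha := a.im_pos
  unfold lle
  apply or_congr
  · rw [kap_inj.eq_iff, kap_inj.eq_iff, smul_left_cancel_iff]
  · unfold lpos
    simp only [Complex.sub_re, Complex.sub_im, kap_re, kap_im, amat_smul, nsq, affm_re, affm_im]
    have e1 : σ * (a.re + a.im * w.re - (a.re + a.im * z.re)) = a.im * (σ * (w.re - z.re)) := by ring
    have e2 : a.re + a.im * w.re - (a.re + a.im * z.re) = a.im * (w.re - z.re) := by ring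
    apply or_congr
    · rw [e1]; exact mul_pos_iff_of_pos_left ha
    · rw [e2, mul_eq_zero, or_iff_right ha.ne']
      apply and_congr_right
      intro h
      have h : w.re = z.re := by linarith
      rw [h]
      have e3 : σ * ((a.re + a.im * z.re) ^ 2 + (a.im * w.im) ^ 2 - ((a.re + a.im * z.re) ^ 2 +
        (a.im * z.im) ^ 2)) = a.im ^ 2 * (σ * (z.re ^ 2 + w.im ^ 2 - (z.re ^ 2 + z.im ^ 2))) := by ring
      rw [e3]; exact mul_pos_iff_of_pos_left (pow_pos ha 2)

end

noncomputable section

lemma meas_lpos (σ : ℝ) {u : G2 → ℂ} (hu : Measurable u) : MeasurableSet {g | lpos σ (u g)} := by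
  have : MeasurableSet {v : ℂ | lpos σ v} := by
    apply MeasurableSet.union
    · exact measurableSet_lt measurable_const (Complex.measurable_re.const_mul σ)
    · exact (measurableSet_eq_fun Complex.measurable_re measurable_const).inter
        (measurableSet_lt measurable_const (Complex.measurable_im.const_mul σ))
  exact hu this

lemma meas_ko (z : ℍ) : Measurable (fun g : G2 => kap (g • z)) :=
  kap_cont.measurable.comp (meas_orb z)

lemma meas_lle (σ : ℝ) (z w : ℍ) : MeasurableSet {g : G2 | lle σ (kap (g • z)) (kap (g • w))} :=
  (measurableSet_eq_fun (meas_ko z) (meas_ko w)).union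
    (meas_lpos σ ((meas_ko w).sub (meas_ko z)))

/-- the bottom vertex -/
def Fs {ι : Type*} (σ : ℝ) (s : ι → ℍ) (i : ι) : Set G2 :=
  {g | ∀ k, lle σ (kap (g • s i)) (kap (g • s k))}

lemma Fs_meas {ι : Type*} [Fintype ι] (σ : ℝ) (s : ι → ℍ) (i : ι) : MeasurableSet (Fs σ s i) := by
  have : Fs σ s i = ⋂ k, {g : G2 | lle σ (kap (g • s i)) (kap (g • s k))} := by
    ext g; simp [Fs]
  rw [this]
  exact MeasurableSet.iInter fun k => meas_lle σ _ _

/-- vertex event -/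
def Vs {ι : Type*} (σ : ℝ) (K : Set ℍ) (s : ι → ℍ) (i : ι) : Set G2 :=
  {g | g • s i ∈ K} ∩ Fs σ s i

/-- the lower endpoint is in `K` -/
def Ms (σ : ℝ) (K : Set ℍ) (a b : ℍ) : Set G2 := {g | low σ (kap (g • a)) (kap (g • b)) ∈ kap '' K}

lemma Ms_meas (σ : ℝ) {K : Set ℍ} (hK : IsCompact K) (a b : ℍ) : MeasurableSet (Ms σ K a b) := by
  have hl := meas_lpos σ ((meas_ko b).sub (meas_ko a))
  have h : ∀ z, MeasurableSet {g : G2 | g • z ∈ K} := fun z => meas_orb z hK.measurableSet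
  convert hl.ite (h a) (h b) using 1
  ext g
  simp only [Ms, low, Set.ite, Set.mem_union, Set.mem_inter_iff, Set.mem_sdiff]
  by_cases hg : lpos σ (kap (g • b) - kap (g • a))
  · simp only [Set.mem_ofPred_eq, hg, if_true, kap_image_mem, Pi.sub_apply]; tauto
  · simp only [Set.mem_ofPred_eq, hg, if_false, kap_image_mem, Pi.sub_apply]; tauto

/-- edge event without side condition -/
def As (σ : ℝ) (K : Set ℍ) (a b : ℍ) : Set G2 := hitSet K (hseg a b) \ Ms σ K a b

/-- edge event -/
def Es (σ : ℝ) (K : Set ℍ) (P : ℍ) (a b : ℍ) : Set G2 :=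
  As σ K a b ∩ {g | DD (kap (g • a)) (kap (g • b)) (kap P) < 0}

lemma DDorb_meas (a b P : ℍ) : Measurable (fun g : G2 => DD (kap (g • a)) (kap (g • b)) (kap P)) := by
  have h1 := Complex.measurable_re.comp (meas_ko a)
  have h2 := Complex.measurable_im.comp (meas_ko a)
  have h3 := Complex.measurable_re.comp (meas_ko b)
  have h4 := Complex.measurable_im.comp (meas_ko b)
  exact ((h3.sub h1).mul (measurable_const.sub h2)).sub ((h4.sub h2).mul (measurable_const.sub h1))

lemma As_meas (σ : ℝ) {K : Set ℍ} (hK : IsCompact K) (a b : ℍ) : MeasurableSet (As σ K a b) :=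
  (hitSet_meas hK (hseg_compact a b)).diff (Ms_meas σ hK a b)

lemma Es_meas (σ : ℝ) {K : Set ℍ} (hK : IsCompact K) (P a b : ℍ) : MeasurableSet (Es σ K P a b) :=
  (As_meas σ hK a b).inter (measurableSet_lt (DDorb_meas a b P) measurable_const)

lemma low_symm {σ : ℝ} (hσ : σ ≠ 0) (a b : ℂ) : low σ a b = low σ b a := by
  unfold low
  rcases lpos_total hσ (b - a) with h | h | h
  · rw [sub_eq_zero] at h; rw [h]
  · have h' : ¬ lpos σ (a - b) := fun h' => lpos_asymm h (by simpa using h')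
    simp [h, h']
  · rw [neg_sub] at h
    have h' : ¬ lpos σ (b - a) := fun h' => lpos_asymm h (by simpa using h')
    simp [h, h']

lemma low_neg {σ : ℝ} (hσ : σ ≠ 0) (a b : ℂ) :
    (low σ a b = a ∧ low (-σ) a b = b) ∨ (low σ a b = b ∧ low (-σ) a b = a) := by
  have e : lpos (-σ) (b - a) ↔ lpos σ (-(b - a)) := by
    unfold lpos; simp only [Complex.neg_re, Complex.neg_im, neg_eq_zero, neg_mul, mul_neg]
  unfold low
  rcases lpos_total hσ (b - a) with h | h | h
  · rw [sub_eq_zero] at h; rw [h]; simp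
  · have h' : ¬ lpos (-σ) (b - a) := fun h' => lpos_asymm h (e.1 h')
    simp [h, h']
  · have h' : ¬ lpos σ (b - a) := fun h' => lpos_asymm h (by simpa using h')
    simp [e.2 h, h']

lemma Ms_hit {σ : ℝ} (hσ : σ ≠ 0) (K : Set ℍ) (a b : ℍ) : Ms σ K a b ⊆ hitSet K (hseg a b) := by
  intro g hg
  have hg : low σ (kap (g • a)) (kap (g • b)) ∈ kap '' K := hg
  rcases low_neg hσ (kap (g • a)) (kap (g • b)) with h | h
  · rw [h.1, kap_image_mem] at hg; exact ⟨a, left_mem_hseg a b, hg⟩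
  · rw [h.1, kap_image_mem] at hg; exact ⟨b, right_mem_hseg a b, hg⟩

namespace Good
variable {μ : Measure G2}

lemma ptset_real (hμ : Good μ) {K : Set ℍ} (hK : IsCompact K) (z : ℍ) :
    μ.real {g | g • z ∈ K} = hypArea K := by
  rw [measureReal_def, hμ.preim' hK.measurableSet]; rfl

lemma As_sum (hμ : Good μ) {K : Set ℍ} (hK : IsCompact K) {σ : ℝ} (hσ : σ ≠ 0) (a b : ℍ) :
    μ.real (As σ K a b) + μ.real (As (-σ) K a b) = 2 * (Ph μ K (hseg a b) - hypArea K) := by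
  have hσ' : -σ ≠ 0 := neg_ne_zero.2 hσ
  have hf := hμ.hit_ne_top hK (hseg_compact a b)
  have h1 : ∀ τ : ℝ, τ ≠ 0 → μ.real (As τ K a b) = Ph μ K (hseg a b) - μ.real (Ms τ K a b) := by
    intro τ hτ
    exact measureReal_sdiff (Ms_hit hτ K a b) (Ms_meas τ hK a b) hf
  have hfM : ∀ τ : ℝ, τ ≠ 0 → μ (Ms τ K a b) ≠ ⊤ := fun τ hτ =>
    measure_ne_top_of_subset (Ms_hit hτ K a b) hf
  have hfp : ∀ z : ℍ, μ {g | g • z ∈ K} ≠ ⊤ := fun z => by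
    rw [hμ.preim' hK.measurableSet]; exact (area_lt_top hK).ne
  have h2 := measureReal_union_add_inter (μ := μ) (s := Ms σ K a b) (Ms_meas (-σ) hK a b) (hfM σ hσ) (hfM _ hσ')
  have h3 := measureReal_union_add_inter (μ := μ) (s := {g | g • a ∈ K}) (t := {g | g • b ∈ K})
    (meas_orb b hK.measurableSet) (hfp a) (hfp b)
  have e1 : Ms σ K a b ∪ Ms (-σ) K a b = {g | g • a ∈ K} ∪ {g | g • b ∈ K} := by
    ext g
    simp only [Ms, Set.mem_union, Set.mem_ofPred_eq]
    rcases low_neg hσ (kap (g • a)) (kap (g • b)) with h | h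
    · rw [h.1, h.2, kap_image_mem, kap_image_mem]
    · rw [h.1, h.2, kap_image_mem, kap_image_mem, or_comm]
  have e2 : Ms σ K a b ∩ Ms (-σ) K a b = {g | g • a ∈ K} ∩ {g | g • b ∈ K} := by
    ext g
    simp only [Ms, Set.mem_inter_iff, Set.mem_ofPred_eq]
    rcases low_neg hσ (kap (g • a)) (kap (g • b)) with h | h
    · rw [h.1, h.2, kap_image_mem, kap_image_mem]
    · rw [h.1, h.2, kap_image_mem, kap_image_mem, and_comm]
  rw [e1, e2, h3, hμ.ptset_real hK, hμ.ptset_real hK] at h2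
  rw [h1 σ hσ, h1 _ hσ']
  linarith

lemma Es_half (hμ : Good μ) {K : Set ℍ} (hK : IsCompact K) {σ : ℝ} (hσ : σ ≠ 0) (P : ℍ) {a b : ℍ}
    (hab : a ≠ b) : 2 * μ.real (Es σ K P a b) = μ.real (As σ K a b) := by
  obtain ⟨h, h1, h2, -⟩ := exists_half_turn a b
  have hfA : μ (As σ K a b) ≠ ⊤ :=
    measure_ne_top_of_subset Set.sdiff_subset (hμ.hit_ne_top hK (hseg_compact a b))
  have hh : tr h (hseg a b) = hseg a b := by rw [tr_hseg, h1, h2, hseg_symm]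
  have hA : ∀ g, g * h ∈ As σ K a b ↔ g ∈ As σ K a b := by
    intro g
    have e1 : g * h ∈ hitSet K (hseg a b) ↔ g ∈ hitSet K (hseg a b) := by
      constructor
      · rintro ⟨z, hz, hzK⟩
        refine ⟨h • z, ?_, by rwa [mul_smul] at hzK⟩
        rw [← hh]; exact ⟨z, hz, rfl⟩
      · rintro ⟨z, hz, hzK⟩
        rw [← hh] at hz
        obtain ⟨w, hw, rfl⟩ := hz
        exact ⟨w, hw, by rwa [mul_smul]⟩
    have e2 : g * h ∈ Ms σ K a b ↔ g ∈ Ms σ K a b := by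
      show low σ (kap ((g * h) • a)) (kap ((g * h) • b)) ∈ kap '' K ↔ low σ (kap (g • a)) (kap (g • b)) ∈ kap '' K
      rw [mul_smul, mul_smul, h1, h2, low_symm hσ]
    simp only [As, Set.mem_sdiff, e1, e2]
  have hpos : μ (Es σ K P a b) = μ (As σ K a b ∩ {g | 0 < DD (kap (g • a)) (kap (g • b)) (kap P)}) := by
    rw [← hμ.meas_right h (Es σ K P a b)]
    congr 1
    ext g
    show (g * h ∈ As σ K a b ∧ DD (kap ((g * h) • a)) (kap ((g * h) • b)) (kap P) < 0) ↔ _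
    rw [hA, mul_smul, mul_smul, h1, h2, DD_swap]
    simp
  have hzero : μ {g : G2 | DD (kap (g • a)) (kap (g • b)) (kap P) = 0} = 0 := by
    have hm : MeasurableSet {z | DD (kap a) (kap b) (kap z) = 0} :=
      ((isClosed_eq DD_cont continuous_const).preimage kap_cont).measurableSet
    have hn := line_null (fun e => hab (kap_inj e) : kap a ≠ kap b)
    rw [← hμ.preim' hm P, ← hμ.meas_inv] at hn
    rw [← hn]; congr 1
    ext g
    show DD (kap (g • a)) (kap (g • b)) (kap P) = 0 ↔ DD (kap a) (kap b) (kap (g⁻¹ • P)) = 0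
    rw [← DD_inv_zero g a b (g⁻¹ • P), smul_inv_smul]
  have hmD := DDorb_meas a b P
  have hs : As σ K a b =ᵐ[μ] (Es σ K P a b ∪ (As σ K a b ∩ {g | 0 < DD (kap (g • a)) (kap (g • b)) (kap P)}) : Set G2) := by
    have : ∀ᵐ g ∂μ, DD (kap (g • a)) (kap (g • b)) (kap P) ≠ 0 := by
      rw [ae_iff]; simpa using hzero
    filter_upwards [this] with g hg
    apply propext
    show g ∈ As σ K a b ↔ (g ∈ As σ K a b ∧ DD _ _ _ < 0) ∨ (g ∈ As σ K a b ∧ 0 < DD _ _ _)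
    rcases lt_or_gt_of_ne hg with h | h
    · simp [h, h.le]
    · simp [h, h.le]
  have hd : Disjoint (Es σ K P a b) (As σ K a b ∩ {g | 0 < DD (kap (g • a)) (kap (g • b)) (kap P)}) := by
    rw [Set.disjoint_left]
    rintro g ⟨_, hg⟩ ⟨_, hg'⟩
    have hg : DD (kap (g • a)) (kap (g • b)) (kap P) < 0 := hg
    have hg' : 0 < DD (kap (g • a)) (kap (g • b)) (kap P) := hg'
    exact lt_asymm hg hg'
  rw [measureReal_congr hs, measureReal_union hd ((As_meas σ hK a b).inter (measurableSet_lt measurable_const hmD))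
    (measure_ne_top_of_subset Set.inter_subset_left hfA) (measure_ne_top_of_subset Set.inter_subset_left hfA)]
  rw [measureReal_def, measureReal_def, hpos]; ring

lemma Vs_const (hμ : Good μ) {ι : Type*} [Fintype ι] (σ : ℝ) (s : ι → ℍ) (i : ι) :
    ∃ c : ℝ, 0 ≤ c ∧ ∀ K : Set ℍ, IsCompact K → μ.real (Vs σ K s i) = c * hypArea K := by
  set ν := (μ.restrict (Fs σ s i)).map (fun g => g • s i) with hν
  have hνa : ∀ B, MeasurableSet B → ν B = μ ({g | g • s i ∈ B} ∩ Fs σ s i) := by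
    intro B hB
    rw [hν, Measure.map_apply (meas_orb _) hB, Measure.restrict_apply (meas_orb _ hB)]; rfl
  have hle : ν ≤ hypAreaMeasure := by
    rw [Measure.le_iff]
    intro B hB
    rw [hνa B hB, ← hμ.preim' hB (s i)]
    exact measure_mono Set.inter_subset_left
  obtain ⟨c, hc, h⟩ := aff_unique hμ ν hle (by
    intro z B hB
    have hB' : MeasurableSet {w : ℍ | amat z • w ∈ B} := (continuous_const_smul (amat z)).measurable hB
    rw [hνa B hB, hνa _ hB', ← hμ.meas_left (amat z) ({g | g • s i ∈ B} ∩ Fs σ s i)]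
    congr 1
    ext g
    show (amat z • g • s i ∈ B ∧ ∀ k, lle σ (kap (g • s i)) (kap (g • s k))) ↔ ((amat z * g) • s i ∈ B ∧ ∀ k, lle σ (kap ((amat z * g) • s i))
      (kap ((amat z * g) • s k)))
    simp only [mul_smul, lle_amat])
  refine ⟨c, hc, fun K hK => ?_⟩
  rw [measureReal_def, Vs, ← hνa K hK.measurableSet, h]; rfl

open Classical in
lemma count_int (hμ : Good μ) {ι : Type*} [Fintype ι] {σ : ℝ} (hσ : σ ≠ 0) {s : ι → ℍ} (hs : Function.Injective s)
    (hintr : (interior (hull (Set.range s))).Nonempty) {K : Set ℍ} (hK : IsCompact K) (hKc : HypConvex K)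
    (hne : K.Nonempty) : ∃ P : ℍ, Ph μ K (hull (Set.range s)) = hypArea (hull (Set.range s)) +
      ∑ i, μ.real (Vs σ K s i) +
      ∑ e : ι × ι, if IsEdge (fun k => kap (s k)) e.1 e.2 then μ.real (Es σ K P (s e.1) (s e.2)) else 0 := by
  obtain ⟨p0, hp0⟩ := exists_lmin hσ (compact_iff_kap.1 hK) (hne.image kap)
  obtain ⟨P, hPK, rfl⟩ := hp0.1
  refine ⟨P, ?_⟩
  set L := hull (Set.range s) with hL
  have hLc : IsCompact L := hull_compact (Set.finite_range s)
  have hfr : ∀ᵐ g ∂μ, ∀ i, g • s i ∉ frontier K := by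
    rw [ae_all_iff]
    intro i
    rw [ae_iff]
    simp only [not_not]
    rw [hμ.preim' isClosed_frontier.measurableSet, frontier_null hKc]
  have key : ∀ᵐ g ∂μ, (hitSet K L).indicator (fun _ => (1:ℝ)) g = (hitSet {P} L).indicator (fun _ => (1:ℝ)) g +
      ∑ i, (Vs σ K s i).indicator (fun _ => (1:ℝ)) g + ∑ e : ι × ι,
        (if IsEdge (fun k => kap (s k)) e.1 e.2 then Es σ K P (s e.1) (s e.2) else ∅).indicator (fun _ => (1:ℝ)) g := by
    filter_upwards [hfr] with g hg
    have hr : Set.range (fun k => kap (g • s k)) = kap '' tr g (Set.range s) := by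
      rw [tr, ← Set.range_comp, ← Set.range_comp]; rfl
    have hch : convexHull ℝ (Set.range (fun k => kap (g • s k))) = kap '' tr g L := by
      rw [hr, ← kap_hull, hull_tr]
    have hci : (interior (convexHull ℝ (Set.range (fun k => kap (g • s k))))).Nonempty := by
      rw [hch, ← kap_interior]
      have : interior (tr g L) = tr g (interior L) := by
        exact ((Homeomorph.smul g).image_interior L).symm
      rw [this]
      exact (hintr.image _).image _
    have hinj : Function.Injective (fun k => kap (g • s k)) := fun i j h =>
      hs (smul_left_cancel g (kap_inj h))
    have hc := count_lemma hσ hinj hci (compact_iff_kap.1 hK) ((hypConvex_iff K).1 hKc) hp0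
      (fun i => by rw [kap_frontier_iff]; exact hg i)
    rw [hch] at hc
    have c1 : (kap '' K ∩ kap '' tr g L).Nonempty ↔ g ∈ hitSet K L := by
      rw [← Set.image_inter kap_inj, Set.image_nonempty]
      constructor
      · rintro ⟨z, hz, w, hw, rfl⟩; exact ⟨w, hw, hz⟩
      · rintro ⟨w, hw, hz⟩; exact ⟨g • w, hz, w, hw, rfl⟩
    have c2 : kap P ∈ kap '' tr g L ↔ g ∈ hitSet {P} L := by
      rw [kap_image_mem]
      constructor
      · rintro ⟨w, hw, h⟩; exact ⟨w, hw, h⟩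
      · rintro ⟨w, hw, h⟩; exact ⟨w, hw, h⟩
    have c3 : ∀ i, (kap (g • s i) ∈ kap '' K ∧ ∀ k, lle σ (kap (g • s i)) (kap (g • s k))) ↔ g ∈ Vs σ K s i := by
      intro i; rw [kap_image_mem]; rfl
    have c4 : ∀ e : ι × ι, QQ σ (kap '' K) (fun k => kap (g • s k)) (kap P) e.1 e.2 ↔
      g ∈ (if IsEdge (fun k => kap (s k)) e.1 e.2 then Es σ K P (s e.1) (s e.2) else ∅) := by
      intro e
      unfold QQ
      rw [edge_smul]
      by_cases he : IsEdge (fun k => kap (s k)) e.1 e.2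
      · simp only [he, if_true, true_and]
        have : (kap '' K ∩ segment ℝ (kap (g • s e.1)) (kap (g • s e.2))).Nonempty ↔
          g ∈ hitSet K (hseg (s e.1) (s e.2)) := by
          rw [← kap_hseg, ← Set.image_inter kap_inj, Set.image_nonempty, ← tr_hseg]
          constructor
          · rintro ⟨z, hz, w, hw, rfl⟩; exact ⟨w, hw, hz⟩
          · rintro ⟨w, hw, hz⟩; exact ⟨g • w, hz, w, hw, rfl⟩
        rw [this, ← and_assoc]; rfl
      · simp [he]
    simp only [c1, c2, c3, c4] at hc
    simp only [Set.indicator_apply]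
    exact hc
  have hf := hμ.hit_ne_top hK hLc
  have mP : MeasurableSet (hitSet {P} L) := hitSet_meas isCompact_singleton hLc
  have sP : hitSet {P} L ⊆ hitSet K L := hitSet_mono (by simpa using hPK) subset_rfl
  have sV : ∀ i, Vs σ K s i ⊆ hitSet K L := fun i g hg => ⟨s i, subset_hull _ ⟨i, rfl⟩, hg.1⟩
  have sE : ∀ a b, Es σ K P (s a) (s b) ⊆ hitSet K L := fun a b g hg =>
    hitSet_mono subset_rfl (hseg_subset (hull_convex _) (subset_hull _ (Set.mem_range_self a)) (subset_hull _ (Set.mem_range_self b))) hg.1.1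
  have mV : ∀ i, MeasurableSet (Vs σ K s i) := fun i =>
    MeasurableSet.inter (meas_orb _ hK.measurableSet) (Fs_meas σ s i)
  set EE : ι × ι → Set G2 := fun e => 
    (if IsEdge (fun k => kap (s k)) e.1 e.2 then Es σ K P (s e.1) (s e.2) else ∅) with hEE
  have mE : ∀ e, MeasurableSet (EE e) := by
    intro e; simp only [hEE]; split_ifs
    · exact Es_meas σ hK _ _ _
    · exact MeasurableSet.empty
  have sE' : ∀ e, EE e ⊆ hitSet K L := by
    intro e; simp only [hEE]; split_ifs
    · exact sE _ _
    · exact Set.empty_subset _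
  have ii : ∀ S : Set G2, MeasurableSet S → S ⊆ hitSet K L → Integrable (S.indicator (fun _ => (1:ℝ))) μ := by
    intro S hS hsub
    exact (integrable_indicator_iff hS).2 (integrableOn_const (measure_ne_top_of_subset hsub hf))
  have iv : ∀ S : Set G2, MeasurableSet S → ∫ g, S.indicator (fun _ => (1:ℝ)) g ∂μ = μ.real S := by
    intro S hS
    rw [integral_indicator_const _ hS]; simp
  have hI := integral_congr_ae key
  have i1 := ii _ mP sP
  have i2 : Integrable (fun g => ∑ i, (Vs σ K s i).indicator (fun _ => (1:ℝ)) g) μ :=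
    integrable_finsetSum _ (fun i _ => ii _ (mV i) (sV i))
  have i3 : Integrable (fun g => ∑ e, (EE e).indicator (fun _ => (1:ℝ)) g) μ :=
    integrable_finsetSum _ (fun i _ => ii _ (mE i) (sE' i))
  have i12 : Integrable (fun g => (hitSet {P} L).indicator (fun _ => (1:ℝ)) g +
    ∑ i, (Vs σ K s i).indicator (fun _ => (1:ℝ)) g) μ := i1.add i2
  have e1 := integral_add i12 i3
  have e2 := integral_add i1 i2
  have e3 := integral_finsetSum (μ := μ) Finset.univ (fun i _ => ii _ (mV i) (sV i))
  have e4 := integral_finsetSum (μ := μ) Finset.univ (fun i _ => ii _ (mE i) (sE' i))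
  rw [iv _ (hitSet_meas hK hLc)] at hI
  replace hI := hI.trans e1
  rw [e2, e3, e4, iv _ mP] at hI
  simp only [iv _ (mV _), iv _ (mE _)] at hI
  have hP : μ.real (hitSet {P} L) = hypArea L := by
    rw [← hμ.Ph_point hLc P, hμ.Ph_symm]; rfl
  rw [hP] at hI
  show μ.real (hitSet K L) = _
  rw [hI]
  congr 1
  apply Finset.sum_congr rfl
  intro e _
  simp only [hEE]
  split_ifs <;> simp

open Classical in
lemma poly_formula (hμ : Good μ) {ι : Type*} [Fintype ι] {s : ι → ℍ} (hs : Function.Injective s)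
    (hintr : (interior (hull (Set.range s))).Nonempty) : ∃ c : ℝ, ∀ K : Set ℍ, IsCompact K → HypConvex K →
    K.Nonempty → 2 * Ph μ K (hull (Set.range s)) = 2 * hypArea (hull (Set.range s)) + c * hypArea K +
      ∑ e : ι × ι, if IsEdge (fun k => kap (s k)) e.1 e.2 then Ph μ K (hseg (s e.1) (s e.2)) - hypArea K else 0 := by
  choose c1 _ hc1 using fun i => hμ.Vs_const 1 s i
  choose c2 _ hc2 using fun i => hμ.Vs_const (-1) s i
  refine ⟨∑ i, (c1 i + c2 i), fun K hK hKc hne => ?_⟩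
  obtain ⟨P1, h1⟩ := hμ.count_int one_ne_zero hs hintr hK hKc hne
  obtain ⟨P2, h2⟩ := hμ.count_int (neg_ne_zero.2 one_ne_zero) hs hintr hK hKc hne
  simp only [hc1 _ K hK] at h1
  simp only [hc2 _ K hK] at h2
  have e : ∑ e : ι × ι, (if IsEdge (fun k => kap (s k)) e.1 e.2 then Ph μ K (hseg (s e.1) (s e.2)) - hypArea K else 0)
    = ∑ e : ι × ι, (if IsEdge (fun k => kap (s k)) e.1 e.2 then μ.real (Es 1 K P1 (s e.1) (s e.2)) else 0) +
     ∑ e : ι × ι, (if IsEdge (fun k => kap (s k)) e.1 e.2 then μ.real (Es (-1) K P2 (s e.1) (s e.2)) else 0) := by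
    rw [← Finset.sum_add_distrib]
    apply Finset.sum_congr rfl
    intro e _
    split_ifs with he
    · have hab : s e.1 ≠ s e.2 := fun h => he.1 (hs h)
      have a1 := hμ.Es_half hK one_ne_zero P1 hab
      have a2 := hμ.Es_half hK (neg_ne_zero.2 one_ne_zero) P2 hab
      have a3 := hμ.As_sum hK one_ne_zero (s e.1) (s e.2)
      linarith
    · simp
  rw [e, Finset.sum_add_distrib, add_mul, Finset.sum_mul, Finset.sum_mul]
  linarith

end Good

end

noncomputable section

lemma mem_hseg_ax {s t : ℝ} (h : s ≤ t) (z : ℍ) :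
    z ∈ hseg (ax s) (ax t) ↔ ∃ u ∈ Set.Icc s t, z = ax u := by
  constructor
  · intro hz
    have hre : z.re = 0 := by
      have hz' : kap z ∈ segment ℝ (kap (ax s)) (kap (ax t)) := hz
      rw [mem_seg_iff] at hz'
      obtain ⟨a, b, _, _, _, h1, _⟩ := hz'
      simpa using h1
    obtain ⟨u, rfl⟩ := ax_of_re_zero z hre
    refine ⟨u, ?_, rfl⟩
    rw [mem_hseg, dist_ax, dist_ax, dist_ax, abs_of_nonpos (sub_nonpos.2 h)] at hz
    constructor
    · linarith [le_abs_self (s - u), neg_abs_le (u - t), neg_abs_le (s-u), le_abs_self (u - t)]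
    · linarith [le_abs_self (s - u), neg_abs_le (u - t), neg_abs_le (s-u), le_abs_self (u - t)]
  · rintro ⟨u, ⟨h1, h2⟩, rfl⟩
    rw [mem_hseg, dist_ax, dist_ax, dist_ax, abs_of_nonpos (sub_nonpos.2 h), abs_of_nonpos (sub_nonpos.2 h1),
      abs_of_nonpos (sub_nonpos.2 h2)]
    ring

lemma linear_of_add {f : ℝ → ℝ} (h0 : ∀ x, 0 ≤ x → 0 ≤ f x)
    (hadd : ∀ x y, 0 ≤ x → 0 ≤ y → f (x + y) = f x + f y) {a : ℝ} (ha : 0 ≤ a) : f a = a * f 1 := by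
  have hz : f 0 = 0 := by have := hadd 0 0 le_rfl le_rfl; simp at this; exact this
  have hn : ∀ (n : ℕ) x, 0 ≤ x → f (n * x) = n * f x := by
    intro n x hx
    induction n with
    | zero => simp [hz]
    | succ n ih => push_cast; rw [add_mul, one_mul, hadd _ _ (by positivity) hx, ih]; ring
  have hmono : ∀ x y, 0 ≤ x → x ≤ y → f x ≤ f y := by
    intro x y hx hxy
    have := hadd x (y - x) hx (by linarith)
    rw [add_sub_cancel] at this
    linarith [h0 (y - x) (by linarith)]
  have h1 : 0 ≤ f 1 := h0 1 zero_le_one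
  have hb : ∀ n : ℕ, n * |f a - a * f 1| ≤ f 1 := by
    intro n
    have hna : 0 ≤ n * a := by positivity
    have l1 : (⌊n * a⌋₊ : ℝ) * f 1 ≤ n * f a := by
      rw [← hn _ _ ha, ← hn _ _ zero_le_one]
      apply hmono _ _ (by positivity)
      simpa using Nat.floor_le hna
    have l2 : n * f a ≤ (⌊n * a⌋₊ + 1 : ℝ) * f 1 := by
      have := hn (⌊n * a⌋₊ + 1) 1 zero_le_one
      push_cast at this
      rw [← hn _ _ ha, ← this]
      apply hmono _ _ hna
      simpa using (Nat.lt_floor_add_one (n * a)).le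
    have f1 := Nat.floor_le hna
    have f2 := (Nat.lt_floor_add_one (n * a)).le
    have hnn : (0:ℝ) ≤ n := by positivity
    have : |n * (f a - a * f 1)| ≤ f 1 := by
      rw [abs_le]; constructor <;> nlinarith
    rwa [abs_mul, abs_of_nonneg hnn] at this
  by_contra hne
  have hp : 0 < |f a - a * f 1| := abs_pos.2 (sub_ne_zero.2 hne)
  obtain ⟨n, hn⟩ := exists_nat_gt (f 1 / |f a - a * f 1|)
  rw [div_lt_iff₀ hp] at hn
  linarith [hb n]

/-- mean width functional -/
def rho (μ : Measure G2) (K : Set ℍ) : ℝ := Ph μ K (hseg I (ax 1)) - hypArea K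

lemma hitSet_union (K A B : Set ℍ) : hitSet K (A ∪ B) = hitSet K A ∪ hitSet K B := by
  ext g; constructor
  · rintro ⟨z, hz | hz, h⟩
    · exact Or.inl ⟨z, hz, h⟩
    · exact Or.inr ⟨z, hz, h⟩
  · rintro (⟨z, hz, h⟩ | ⟨z, hz, h⟩)
    · exact ⟨z, Or.inl hz, h⟩
    · exact ⟨z, Or.inr hz, h⟩

namespace Good
variable {μ : Measure G2}

lemma Ph_hseg_dist (hμ : Good μ) (K : Set ℍ) {z w z' w' : ℍ} (h : dist z w = dist z' w') :
    Ph μ K (hseg z w) = Ph μ K (hseg z' w') := by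
  obtain ⟨g, h1, h2⟩ := exists_map_pair h
  rw [← h1, ← h2, ← tr_hseg, hμ.Ph_tr_right]

lemma Ph_hseg_add (hμ : Good μ) {K : Set ℍ} (hK : IsCompact K) (hKc : HypConvex K) {a b : ℝ} (ha : 0 ≤ a)
    (hb : 0 ≤ b) : Ph μ K (hseg (ax 0) (ax (a + b))) - hypArea K =
      (Ph μ K (hseg (ax 0) (ax a)) - hypArea K) + (Ph μ K (hseg (ax 0) (ax b)) - hypArea K) := by
  have e0 : Ph μ K (hseg (ax 0) (ax b)) = Ph μ K (hseg (ax a) (ax (a + b))) :=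
    hμ.Ph_hseg_dist K (by rw [dist_ax, dist_ax]; simp)
  have hab : 0 ≤ a + b := by positivity
  have e1 : hseg (ax 0) (ax (a + b)) = hseg (ax 0) (ax a) ∪ hseg (ax a) (ax (a + b)) := by
    ext z
    rw [Set.mem_union, mem_hseg_ax hab, mem_hseg_ax ha, mem_hseg_ax (by linarith)]
    constructor
    · rintro ⟨u, ⟨h1, h2⟩, rfl⟩
      rcases le_total u a with h | h
      · exact Or.inl ⟨u, ⟨h1, h⟩, rfl⟩
      · exact Or.inr ⟨u, ⟨h, h2⟩, rfl⟩
    · rintro (⟨u, ⟨h1, h2⟩, rfl⟩ | ⟨u, ⟨h1, h2⟩, rfl⟩)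
      · exact ⟨u, ⟨h1, by linarith⟩, rfl⟩
      · exact ⟨u, ⟨by linarith, h2⟩, rfl⟩
  have e2 : hitSet K (hseg (ax 0) (ax a)) ∩ hitSet K (hseg (ax a) (ax (a + b))) = {g | g • ax a ∈ K} := by
    ext g; constructor
    · rintro ⟨⟨z, hz, hzK⟩, ⟨w, hw, hwK⟩⟩
      rw [mem_hseg_ax ha] at hz
      rw [mem_hseg_ax (by linarith)] at hw
      obtain ⟨u, ⟨h1, h2⟩, rfl⟩ := hz
      obtain ⟨v, ⟨h3, h4⟩, rfl⟩ := hw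
      refine hKc _ hzK _ hwK _ ?_
      rw [dist_smul, dist_smul, dist_smul, ← mem_hseg, mem_hseg_ax (by linarith)]
      exact ⟨a, ⟨h2, h3⟩, rfl⟩
    · intro h
      exact ⟨⟨_, right_mem_hseg _ _, h⟩, ⟨_, left_mem_hseg _ _, h⟩⟩
  have h := measureReal_union_add_inter (μ := μ) (s := hitSet K (hseg (ax 0) (ax a)))
    (hitSet_meas hK (hseg_compact (ax a) (ax (a + b)))) (hμ.hit_ne_top hK (hseg_compact _ _))
    (hμ.hit_ne_top hK (hseg_compact _ _))
  rw [e2, ← hitSet_union, ← e1, hμ.ptset_real hK] at h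
  rw [e0]
  unfold Ph; linarith

lemma Ph_hseg (hμ : Good μ) {K : Set ℍ} (hK : IsCompact K) (hKc : HypConvex K) (z w : ℍ) :
    Ph μ K (hseg z w) = hypArea K + rho μ K * dist z w := by
  have h := linear_of_add (f := fun a => Ph μ K (hseg (ax 0) (ax a)) - hypArea K) (fun x hx => by
    have : hypArea K ≤ Ph μ K (hseg (ax 0) (ax x)) := by
      rw [← hμ.Ph_point hK (ax 0)]
      exact hμ.Ph_mono hK (hseg_compact _ _) subset_rfl (by simpa using left_mem_hseg _ _)
    linarith) (fun x y hx hy => hμ.Ph_hseg_add hK hKc hx hy) (dist_nonneg (x := z) (y := w))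
  have e : Ph μ K (hseg z w) = Ph μ K (hseg (ax 0) (ax (dist z w))) :=
    hμ.Ph_hseg_dist K (by rw [dist_ax]; simp)
  rw [e, rho, ← ax_zero]
  linarith

end Good

lemma area_hseg {z w : ℍ} (h : z ≠ w) : hypArea (hseg z w) = 0 := by
  have h0 := line_null (fun e => h (kap_inj e) : kap z ≠ kap w)
  rw [hypArea, measure_mono_null _ h0]
  · rfl
  · intro p hp
    have hp : kap p ∈ segment ℝ (kap z) (kap w) := hp
    show DD _ _ _ = 0
    obtain ⟨a, b, _, _, hab, h⟩ := hp
    rw [← h, DD_comb _ _ _ _ hab, DD_left, DD_right]; simp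

open Classical in
/-- sum of edge lengths -/
def elen (S : Finset ℍ) : ℝ := ∑ e : S × S, if IsEdge (fun k : S => kap k) e.1 e.2 then dist (e.1 : ℍ) e.2 else 0

/-- nondegenerate polygon -/
def HPoly (S : Finset ℍ) : Prop := (interior (hull (S : Set ℍ))).Nonempty

/-- nonempty compact convex set -/
structure CC (K : Set ℍ) : Prop where
  comp : IsCompact K
  conv : HypConvex K
  ne : K.Nonempty

lemma HPoly.cc {S : Finset ℍ} (h : HPoly S) : CC (hull (S : Set ℍ)) :=
  ⟨hull_compact S.finite_toSet, hull_convex _, h.mono interior_subset⟩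

lemma hseg_cc (z w : ℍ) : CC (hseg z w) := ⟨hseg_compact z w, hseg_convex z w, ⟨z, left_mem_hseg z w⟩⟩

lemma area_pos {K : Set ℍ} (hK : IsCompact K) (h : (interior K).Nonempty) : 0 < hypArea K := by
  apply ENNReal.toReal_pos _ (area_lt_top hK).ne
  exact ((area_pos_of_isOpen isOpen_interior h).trans_le (measure_mono interior_subset)).ne'

lemma one_ne : I ≠ ax 1 := by
  intro h
  have := congrArg UpperHalfPlane.im h
  simp at this
  linarith [Real.add_one_lt_exp one_ne_zero]

namespace Good
variable {μ : Measure G2}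

lemma poly1 (hμ : Good μ) {S : Finset ℍ} (hS : HPoly S) : ∃ c : ℝ, ∀ K : Set ℍ, CC K →
    2 * Ph μ K (hull (S : Set ℍ)) = 2 * hypArea (hull (S : Set ℍ)) + c * hypArea K + rho μ K * elen S := by
  classical
  have hr : Set.range (fun k : S => (k : ℍ)) = (S : Set ℍ) := by ext; simp
  obtain ⟨c, hc⟩ := hμ.poly_formula (s := fun k : S => (k : ℍ)) Subtype.val_injective (by rw [hr]; exact hS)
  refine ⟨c, fun K hK => ?_⟩
  have := hc K hK.comp hK.conv hK.ne
  rw [hr] at this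
  rw [this, elen, Finset.mul_sum]
  congr 1
  apply Finset.sum_congr rfl
  intro e _
  split_ifs
  · rw [hμ.Ph_hseg hK.comp hK.conv]; ring
  · simp

lemma rho_poly (hμ : Good μ) {S : Finset ℍ} (hS : HPoly S) :
    rho μ (hull (S : Set ℍ)) = rho μ (hseg I (ax 1)) / 2 * elen S := by
  obtain ⟨c, hc⟩ := hμ.poly1 hS
  have h := hc _ (hseg_cc I (ax 1))
  rw [area_hseg one_ne, hμ.Ph_symm] at h
  rw [rho]; linarith

lemma poly_main (hμ : Good μ) : ∃ κ : ℝ, ∀ S, HPoly S → ∀ K, CC K → 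
    2 * Ph μ K (hull (S : Set ℍ)) = 2 * hypArea (hull (S : Set ℍ)) + 2 * hypArea K + κ * hypArea K *
      hypArea (hull (S : Set ℍ)) + rho μ K * elen S := by
  by_cases hex : ∃ S0, HPoly S0
  · obtain ⟨S0, h0⟩ := hex
    obtain ⟨c0, hc0⟩ := hμ.poly1 h0
    have a0 := area_pos h0.cc.comp h0
    refine ⟨(c0 - 2) / hypArea (hull (S0 : Set ℍ)), fun S hS K hK => ?_⟩
    obtain ⟨c, hc⟩ := hμ.poly1 hS
    have h1 := hc _ h0.cc
    have h2 := hc0 _ hS.cc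
    rw [hμ.rho_poly h0] at h1
    rw [hμ.rho_poly hS, hμ.Ph_symm] at h2
    have : c = 2 + (c0 - 2) / hypArea (hull (S0 : Set ℍ)) * hypArea (hull (S : Set ℍ)) := by
      field_simp; linarith
    rw [hc K hK, this]; ring
  · push Not at hex
    exact ⟨0, fun S hS => absurd hS (hex S)⟩

end Good

end

noncomputable section

instance noAtomsH1 : NullSingletonClass (μH[1] : Measure ℍ) := Measure.nullSingletonClass_hausdorff _ one_pos

lemma ax_isom : Isometry ax := by
  apply Isometry.of_dist_eq
  intro s t; rw [dist_ax, Real.dist_eq]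

lemma smul_isom (g : G2) : Isometry (fun z : ℍ => g • z) := by
  apply Isometry.of_dist_eq
  intro s t; rw [dist_smul]

lemma H1_tr (g : G2) (A : Set ℍ) : μH[1] (tr g A) = μH[1] A :=
  (smul_isom g).hausdorffMeasure_image (Or.inl zero_le_one) A

lemma H1_hseg (z w : ℍ) : μH[1] (hseg z w) = ENNReal.ofReal (dist z w) := by
  obtain ⟨g, h1, h2⟩ := exists_normal z w
  rw [← H1_tr g, tr_hseg, h1, h2]
  have : hseg (ax 0) (ax (dist z w)) = ax '' Set.Icc 0 (dist z w) := by
    ext p; rw [mem_hseg_ax dist_nonneg]; constructor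
    · rintro ⟨u, hu, rfl⟩; exact ⟨u, hu, rfl⟩
    · rintro ⟨u, hu, rfl⟩; exact ⟨u, hu, rfl⟩
  rw [this, ax_isom.hausdorffMeasure_image (Or.inl zero_le_one), hausdorffMeasure_real, Real.volume_Icc,
    sub_zero]

/-- open segment -/
def oseg (z w : ℍ) : Set ℍ := hseg z w \ {z, w}

lemma mem_oseg {z w p : ℍ} (h : z ≠ w) : p ∈ oseg z w ↔ kap p ∈ openSegment ℝ (kap z) (kap w) := by
  constructor
  · rintro ⟨h1, h2⟩
    simp only [Set.mem_insert_iff, Set.mem_singleton_iff, not_or] at h2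
    exact mem_openSegment_of_ne_left_right (fun e => h2.1 (kap_inj e).symm) (fun e => h2.2 (kap_inj e).symm) h1
  · intro hp
    refine ⟨openSegment_subset_segment _ _ _ hp, ?_⟩
    have hne : kap z ≠ kap w := fun e => h (kap_inj e)
    rintro (rfl | rfl)
    · exact hne (left_mem_openSegment_iff.1 hp)
    · exact hne (right_mem_openSegment_iff.1 hp)

lemma oseg_meas (z w : ℍ) : MeasurableSet (oseg z w) :=
  (hseg_compact z w).measurableSet.diff (by measurability)

lemma H1_oseg (z w : ℍ) : μH[1] (oseg z w) = ENNReal.ofReal (dist z w) := by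
  rw [← H1_hseg, oseg]
  exact measure_sdiff_null (Set.Finite.measure_zero (by simp) _)

lemma edge_not_interior {ι : Type*} {f : ι → ℂ} (hf : Function.Injective f)
    (hintr : (interior (convexHull ℝ (Set.range f))).Nonempty) {i j : ι}
    (h : IsEdge f i j) {p : ℂ} (hp : DD (f i) (f j) p = 0) : p ∉ interior (convexHull ℝ (Set.range f)) := by
  intro hpi
  obtain ⟨k, hk⟩ := edge_exists_pos hf h hintr
  have hc : Filter.Tendsto (fun t : ℝ => p + t • (f k - p)) (nhdsWithin 0 (Set.Iio 0)) (nhds p) := by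
    have : Continuous (fun t : ℝ => p + t • (f k - p)) := by fun_prop
    have := (this.tendsto 0).mono_left (nhdsWithin_le_nhds (s := Set.Iio 0))
    simpa using this
  have h1 := hc.eventually (mem_interior_iff_mem_nhds.1 hpi)
  obtain ⟨t, ht, ht0⟩ := (h1.and self_mem_nhdsWithin).exists
  have h2 := edge_halfplane h ht
  rw [DD_line, hp] at h2
  have : t < 0 := ht0
  nlinarith

open Classical in
lemma perim_poly {S : Finset ℍ} (hS : HPoly S) :
    μH[1] (frontier (hull (S : Set ℍ))) = ENNReal.ofReal (elen S) := by
  set f : S → ℂ := fun k => kap k with hfd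
  have hf : Function.Injective f := fun a b h => Subtype.val_injective (kap_inj h)
  have hr : kap '' (S : Set ℍ) = Set.range f := by ext; simp [hfd]
  have hk : kap '' hull (S : Set ℍ) = convexHull ℝ (Set.range f) := by rw [kap_hull, hr]
  have hintr : (interior (convexHull ℝ (Set.range f))).Nonempty := by
    rw [← hk, ← kap_interior]; exact hS.image _
  have hcl : IsClosed (hull (S : Set ℍ)) := hS.cc.comp.isClosed
  set O : S × S → Set ℍ := fun e => if IsEdge f e.1 e.2 then oseg e.1 e.2 else ∅ with hO
  have hmi : ∀ z : ℍ, kap z ∈ interior (convexHull ℝ (Set.range f)) ↔ z ∈ interior (hull (S : Set ℍ)) := by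
    intro z; rw [← hk, ← kap_interior, kap_image_mem]
  have hsub : (⋃ e, O e) ⊆ frontier (hull (S : Set ℍ)) := by
    apply Set.iUnion_subset
    intro e z hz
    simp only [hO] at hz
    split_ifs at hz with he
    · have hne : (e.1 : ℍ) ≠ e.2 := fun h => he.1 (Subtype.val_injective h)
      rw [hcl.frontier_eq]
      refine ⟨hseg_subset (hull_convex _) (subset_hull _ e.1.2) (subset_hull _ e.2.2) hz.1, ?_⟩
      rw [← hmi]
      refine edge_not_interior hf hintr he ?_
      obtain ⟨a, b, _, _, hab, h⟩ := (hz.1 : kap z ∈ segment ℝ (kap e.1) (kap e.2))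
      rw [← h, DD_comb _ _ _ _ hab, DD_left, DD_right]; simp
    · exact absurd hz (Set.notMem_empty z)
  have hsub2 : frontier (hull (S : Set ℍ)) ⊆ (⋃ e, O e) ∪ S := by
    intro z hz
    by_cases hzS : z ∈ S
    · exact Or.inr hzS
    left
    rw [hcl.frontier_eq] at hz
    obtain ⟨i, j, he, hp⟩ := edge_cover hintr (p := kap z) (by rw [← hk, kap_image_mem]; exact hz.1)
      (by rw [hmi]; exact hz.2) (fun i h => hzS (by rw [kap_inj h]; exact i.2))
    have hne : (i : ℍ) ≠ j := fun h => he.1 (Subtype.val_injective h)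
    refine Set.mem_iUnion.2 ⟨(i, j), ?_⟩
    simp only [hO, he, if_true]
    exact (mem_oseg hne).2 hp
  have hdis : Pairwise (Function.onFun Disjoint O) := by
    intro e e' hne
    rw [Function.onFun, Set.disjoint_left]
    intro z hz hz'
    simp only [hO] at hz hz'
    split_ifs at hz with he
    · split_ifs at hz' with he'
      · have n1 : (e.1 : ℍ) ≠ e.2 := fun h => he.1 (Subtype.val_injective h)
        have n2 : (e'.1 : ℍ) ≠ e'.2 := fun h => he'.1 (Subtype.val_injective h)
        have := edge_unique hf hintr he he' ((mem_oseg n1).1 hz) ((mem_oseg n2).1 hz')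
        exact hne (Prod.ext this.1 this.2)
      · exact hz'
    · exact hz
  have e1 : μH[1] (frontier (hull (S : Set ℍ))) = μH[1] (⋃ e, O e) := by
    apply le_antisymm _ (measure_mono hsub)
    refine (measure_mono hsub2).trans ((measure_union_le _ _).trans ?_)
    rw [Set.Finite.measure_zero S.finite_toSet, add_zero]
  rw [e1, measure_iUnion hdis (fun e => by
    simp only [hO]; split_ifs
    · exact oseg_meas _ _
    · exact MeasurableSet.empty), tsum_fintype, elen, ENNReal.ofReal_sum_of_nonneg]
  · apply Finset.sum_congr rfl
    intro e _
    simp only [hO]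
    split_ifs
    · exact H1_oseg _ _
    · simp
  · intro e _; split_ifs
    · exact dist_nonneg
    · exact le_rfl

lemma elen_nonneg (S : Finset ℍ) : 0 ≤ elen S := by
  classical
  unfold elen
  apply Finset.sum_nonneg; intro e _; split_ifs
  · exact dist_nonneg
  · exact le_rfl

end

noncomputable section

lemma cosh_ax (x : ℍ) (t : ℝ) : cosh (dist x (ax t)) * (2 * x.im * exp t) = nsq x + exp t ^ 2 := by
  have := cosh_dist_nsq x (ax t)
  rw [ax_nsq, ax_re, ax_im] at this
  rw [this, ← Real.exp_nat_mul]; simp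

/-- `p` is a nearest point of `K` to `x` -/
def IsNear (K : Set ℍ) (x p : ℍ) : Prop := p ∈ K ∧ ∀ q ∈ K, dist x p ≤ dist x q

lemma cosh_exp (d : ℝ) : cosh d * (2 * exp d) = exp d ^ 2 + 1 := by
  rw [Real.cosh_eq, Real.exp_neg]
  have := exp_pos d
  field_simp

lemma near_obtuse {K : Set ℍ} (hK : HypConvex K) {x p q : ℍ} (h : IsNear K x p) (hq : q ∈ K) :
    cosh (dist p q) * cosh (dist x p) ≤ cosh (dist x q) := by
  obtain ⟨g, h1, h2⟩ := exists_normal p q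
  have d0 : 0 ≤ dist p q := dist_nonneg
  rw [← dist_smul g x p, ← dist_smul g x q]
  have hx : ∀ u ∈ Set.Icc 0 (dist p q), dist (g • x) (ax 0) ≤ dist (g • x) (ax u) := by
    intro u hu
    have hm : g⁻¹ • ax u ∈ hseg p q := by
      have : ax u ∈ tr g (hseg p q) := by
        rw [tr_hseg, h1, h2, mem_hseg_ax d0]; exact ⟨u, hu, rfl⟩
      rwa [mem_tr] at this
    have := h.2 _ (hseg_subset hK h.1 hq hm)
    rwa [← dist_smul g x p, ← dist_smul g x (g⁻¹ • ax u), smul_inv_smul, h1] at this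
  rw [h1, h2]
  generalize g • x = x at *
  generalize dist p q = d at *
  have hi := x.im_pos
  have hN := nsq_pos x
  have c0 := cosh_ax x 0
  have cd := cosh_ax x d
  have ce := cosh_exp d
  simp only [exp_zero] at c0
  have hE : 1 ≤ exp d := Real.one_le_exp d0
  rcases eq_or_lt_of_le d0 with rfl | hd
  · simp
  have hE' : 1 < exp d := Real.one_lt_exp_iff.2 hd
  have hle : nsq x ≤ 1 := by
    by_contra! hN1
    have ha : ∃ a, 1 < a ∧ a < nsq x ∧ a ≤ exp d := by
      refine ⟨min ((1 + nsq x) / 2) (exp d), lt_min (by linarith) hE', ?_, min_le_right _ _⟩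
      exact lt_of_le_of_lt (min_le_left _ _) (by linarith)
    obtain ⟨a, a1, a2, a3⟩ := ha
    have ha0 : 0 < a := by linarith
    have hh := hx (log a) ⟨Real.log_nonneg a1.le, by rw [Real.log_le_iff_le_exp ha0]; exact a3⟩
    have ca := cosh_ax x (log a)
    rw [Real.exp_log ha0] at ca
    have hc : cosh (dist x (ax 0)) ≤ cosh (dist x (ax (log a))) := by
      rw [Real.cosh_le_cosh, abs_of_nonneg dist_nonneg, abs_of_nonneg dist_nonneg]; exact hh
    have hpp : 0 < 2 * x.im * a := by positivity
    have := mul_le_mul_of_nonneg_right hc hpp.le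
    rw [ca] at this
    nlinarith
  have hp : 0 < (2 * x.im * exp d) * (2 * exp d) := by positivity
  refine le_of_mul_le_mul_right ?_ hp
  have e1 : cosh d * cosh (dist x (ax 0)) * ((2 * x.im * exp d) * (2 * exp d)) =
    (cosh d * (2 * exp d)) * (cosh (dist x (ax 0)) * (2 * x.im * 1)) * exp d := by ring
  have e2 : cosh (dist x (ax d)) * ((2 * x.im * exp d) * (2 * exp d)) =
    (cosh (dist x (ax d)) * (2 * x.im * exp d)) * (2 * exp d) := by ring
  rw [e1, e2, c0, cd, ce]
  nlinarith [mul_nonneg (sub_nonneg.2 hle) (mul_nonneg (exp_pos d).le (by nlinarith : 0 ≤ exp d ^ 2 - 1))]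

lemma obt1 {x : ℍ} {d : ℝ} (hd : 0 < d) (h : cosh d * cosh (dist x (ax 0)) ≤ cosh (dist x (ax d))) :
    nsq x ≤ 1 := by
  have hi := x.im_pos
  have c0 := cosh_ax x 0
  have cd := cosh_ax x d
  have ce := cosh_exp d
  simp only [exp_zero] at c0
  have hE' : 1 < exp d := Real.one_lt_exp_iff.2 hd
  have hp : 0 < (2 * x.im * exp d) * (2 * exp d) := by positivity
  have h := mul_le_mul_of_nonneg_right h hp.le
  have e1 : cosh d * cosh (dist x (ax 0)) * ((2 * x.im * exp d) * (2 * exp d)) =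
    (cosh d * (2 * exp d)) * (cosh (dist x (ax 0)) * (2 * x.im * 1)) * exp d := by ring
  have e2 : cosh (dist x (ax d)) * ((2 * x.im * exp d) * (2 * exp d)) =
    (cosh (dist x (ax d)) * (2 * x.im * exp d)) * (2 * exp d) := by ring
  rw [e1, e2, c0, cd, ce] at h
  by_contra! hN
  have : 0 < (nsq x - 1) * (exp d * (exp d ^ 2 - 1)) :=
    mul_pos (by linarith) (mul_pos (exp_pos d) (by nlinarith))
  nlinarith

lemma obt2 {x : ℍ} {d : ℝ} (hd : 0 < d) (h : cosh d * cosh (dist x (ax d)) ≤ cosh (dist x (ax 0))) :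
    exp d ^ 2 ≤ nsq x := by
  have hi := x.im_pos
  have c0 := cosh_ax x 0
  have cd := cosh_ax x d
  have ce := cosh_exp d
  simp only [exp_zero] at c0
  have hE' : 1 < exp d := Real.one_lt_exp_iff.2 hd
  have hp : 0 < (2 * x.im * exp d) * (2 * exp d) := by positivity
  have h := mul_le_mul_of_nonneg_right h hp.le
  have e1 : cosh d * cosh (dist x (ax d)) * ((2 * x.im * exp d) * (2 * exp d)) =
    (cosh d * (2 * exp d)) * (cosh (dist x (ax d)) * (2 * x.im * exp d)) := by ring
  have e2 : cosh (dist x (ax 0)) * ((2 * x.im * exp d) * (2 * exp d)) =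
    (cosh (dist x (ax 0)) * (2 * x.im * 1)) * (2 * exp d ^ 2) := by ring
  rw [e1, e2, c0, cd, ce] at h
  by_contra! hN
  have : 0 < (exp d ^ 2 - nsq x) * (exp d ^ 2 - 1) :=
    mul_pos (by linarith) (by nlinarith)
  nlinarith

lemma near_lip {K : Set ℍ} (hK : HypConvex K) {x p x' p' : ℍ} (h : IsNear K x p) (h' : IsNear K x' p') :
    dist p p' ≤ dist x x' := by
  rcases eq_or_lt_of_le (dist_nonneg (x := p) (y := p')) with h0 | hd
  · rw [← h0]; exact dist_nonneg
  have a1 := near_obtuse hK h h'.1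
  have a2 := near_obtuse hK h' h.1
  rw [dist_comm p' p] at a2
  obtain ⟨g, h1, h2⟩ := exists_normal p p'
  rw [← dist_smul g x p, ← dist_smul g x p', h1, h2] at a1
  rw [← dist_smul g x' p', ← dist_smul g x' p, h1, h2] at a2
  rw [← dist_smul g x x']
  have b1 := obt1 hd a1
  have b2 := obt2 hd a2
  have l := log_nsq_le (g • x) (g • x')
  have l1 := Real.log_nonpos (nsq_pos (g • x)).le b1
  have l2 := Real.log_le_log (by positivity) b2
  rw [Real.log_pow, Real.log_exp] at l2
  push_cast at l2
  linarith

lemma near_exists {K : Set ℍ} (hK : CC K) (x : ℍ) : ∃ p, IsNear K x p := by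
  obtain ⟨p, hp, h⟩ := hK.comp.exists_isMinOn hK.ne (f := fun q => dist x q) (by fun_prop)
  exact ⟨p, hp, fun q hq => h hq⟩

lemma near_ext {K : Set ℍ} (hK : HypConvex K) {x p : ℍ} (h : IsNear K x p) {y : ℍ} (hx : x ∉ K)
    (hy : x ∈ hseg p y) : IsNear K y p := by
  refine ⟨h.1, fun q hq => ?_⟩
  have hpx : p ≠ x := fun e => hx (e ▸ h.1)
  obtain ⟨g, h1, h2⟩ := exists_normal p y
  have hm : g • x ∈ hseg (ax 0) (ax (dist p y)) := by
    rw [← h1, ← h2, ← tr_hseg]; exact ⟨x, hy, rfl⟩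
  rw [mem_hseg_ax dist_nonneg] at hm
  obtain ⟨u, ⟨u0, u1⟩, hu⟩ := hm
  have hup : 0 < u := by
    rcases eq_or_lt_of_le u0 with rfl | h
    · exact absurd (smul_left_cancel g (h1.trans hu.symm)) hpx
    · exact h
  have ob := near_obtuse hK h hq
  rw [dist_comm x p, dist_comm x q, dist_comm p q, mul_comm, ← dist_smul g p x, ← dist_smul g q p, ← dist_smul g q x, h1, hu, dist_ax] at ob
  have e : |0 - u| = u := by rw [zero_sub, abs_neg, abs_of_pos hup]
  rw [e] at ob
  have b := obt1 hup ob
  have l := log_nsq_le (g • q) (g • y)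
  rw [h2, ax_nsq, Real.log_exp, ← h2, dist_smul] at l
  have l1 := Real.log_nonpos (nsq_pos (g • q)).le b
  rw [dist_comm y p, dist_comm y q]
  linarith

lemma ray_exit {K : Set ℍ} (hK : IsCompact K) {p x : ℍ} (hpx : p ≠ x) (hx : x ∈ K) :
    ∃ y ∈ frontier K, x ∈ hseg p y := by
  obtain ⟨g, h1, h2⟩ := exists_normal p x
  have hd : 0 < dist p x := dist_pos.2 hpx
  obtain ⟨R, hR⟩ := hK.isBounded.subset_closedBall p
  set T := (fun c => g⁻¹ • ax c) '' Set.Ici (dist p x) with hT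
  have hpc : IsPreconnected T := by
    apply isPreconnected_Ici.image
    apply Continuous.continuousOn
    exact (continuous_const_smul g⁻¹).comp ax_isom.continuous
  have hn : (T ∩ frontier K).Nonempty := by
    by_contra hcon
    rw [Set.not_nonempty_iff_eq_empty] at hcon
    have hcov : T ⊆ interior K ∪ Kᶜ := by
      intro z hz
      by_cases hzK : z ∈ K
      · left
        by_contra hzi
        have : z ∈ T ∩ frontier K := ⟨hz, by rw [hK.isClosed.frontier_eq]; exact ⟨hzK, hzi⟩⟩
        rw [hcon] at this
        exact this
      · right; exact hzK
    have hxT : x ∈ T := ⟨dist p x, Set.mem_Ici.2 le_rfl, by simp [← h2]⟩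
    have hfin : (T ∩ (interior K ∩ Kᶜ)).Nonempty := hpc (interior K) Kᶜ isOpen_interior hK.isClosed.isOpen_compl hcov
      ⟨x, hxT, (hcov hxT).resolve_right (fun h => h hx)⟩ (by
      refine ⟨g⁻¹ • ax (max (dist p x) (R + 1)), ⟨_, Set.mem_Ici.2 (le_max_left _ _), rfl⟩, fun hm => ?_⟩
      have := hR hm
      rw [mem_closedBall, ← dist_smul g, smul_inv_smul, h1, dist_ax, sub_zero] at this
      have := (le_abs_self _).trans this
      linarith [le_max_right (dist p x) (R + 1)])
    obtain ⟨z, hz, hz1, hz2⟩ := hfin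
    exact hz2 (interior_subset hz1)
  obtain ⟨_, ⟨c, hc, rfl⟩, hf⟩ := hn
  refine ⟨_, hf, ?_⟩
  have hc : dist p x ≤ c := hc
  have : g • x ∈ tr g (hseg p (g⁻¹ • ax c)) := by
    rw [tr_hseg, h1, h2, smul_inv_smul, mem_hseg_ax (by linarith)]
    exact ⟨_, ⟨hd.le, hc⟩, rfl⟩
  simpa [mem_tr] using this

theorem perim_mono {K K' : Set ℍ} (hK : CC K) (hK' : IsCompact K') (hsub : K ⊆ K') :
    μH[1] (frontier K) ≤ μH[1] (frontier K') := by
  choose pr hpr using near_exists hK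
  have hl : LipschitzWith 1 pr := LipschitzWith.of_dist_le_mul fun x y => by
    simpa using near_lip hK.conv (hpr x) (hpr y)
  have hfc : IsCompact (frontier K') := hK'.of_isClosed_subset isClosed_frontier hK'.isClosed.frontier_subset
  have huniq : ∀ x p, IsNear K x p → pr x = p := by
    intro x p h
    have := near_lip hK.conv (hpr x) h
    rw [dist_self] at this
    exact dist_le_zero.1 this
  have hcl : IsClosed (pr '' frontier K') := (hfc.image hl.continuous).isClosed
  have key : frontier K ⊆ pr '' frontier K' := by
    intro p hp
    have hpK : p ∈ K := hK.comp.isClosed.frontier_subset hp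
    have hself : ∀ q ∈ K, pr q = q := fun q hq => huniq q q ⟨hq, fun r _ => by rw [dist_self]; exact dist_nonneg⟩
    by_cases hpi : p ∈ interior K'
    · rw [← hcl.closure_eq, Metric.mem_closure_iff]
      intro ε hε
      have h1 : p ∈ closure Kᶜ := by
        rw [closure_compl]; exact hp.2
      rw [_root_.mem_closure_iff] at h1
      obtain ⟨y, ⟨hy1, hy2⟩, hy3⟩ := h1 (interior K' ∩ ball p ε) (isOpen_interior.inter isOpen_ball)
        ⟨hpi, mem_ball_self hε⟩
      have hne : pr y ≠ y := fun e => hy3 (e ▸ (hpr y).1)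
      obtain ⟨x, hx, hyx⟩ := ray_exit hK' hne (interior_subset hy1)
      have := huniq x _ (near_ext hK.conv (hpr y) hy3 hyx)
      refine ⟨pr y, ⟨x, hx, this⟩, ?_⟩
      have h2 := hl.dist_le_mul p y
      rw [hself p hpK] at h2
      rw [mem_ball, dist_comm] at hy2
      simp at h2
      linarith
    · refine ⟨p, ?_, hself p hpK⟩
      rw [hK'.isClosed.frontier_eq]
      exact ⟨hsub hpK, hpi⟩
  refine (measure_mono key).trans ?_
  have := hl.lipschitzOnWith.hausdorffMeasure_image_le (s := frontier K') (d := 1) zero_le_one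
  simpa using this

end

noncomputable section

lemma disc_convex (c : ℍ) (r : ℝ) : HypConvex (closedBall c r) := by
  intro x hx y hy z hz
  rw [mem_closedBall] at *
  obtain ⟨g, h1, h2⟩ := exists_normal x y
  have hm : g • z ∈ hseg (ax 0) (ax (dist x y)) := by
    rw [← h1, ← h2, ← tr_hseg]; exact ⟨z, mem_hseg.2 hz, rfl⟩
  rw [mem_hseg_ax dist_nonneg] at hm
  obtain ⟨u, ⟨u0, u1⟩, hu⟩ := hm
  have r0 : 0 ≤ r := dist_nonneg.trans hx
  rw [dist_comm, ← dist_smul g] at hx hy ⊢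
  rw [h1] at hx
  rw [h2] at hy
  rw [hu]
  generalize g • c = w at *
  generalize dist x y = d at *
  have c0 := cosh_ax w 0
  have cd := cosh_ax w d
  have cu := cosh_ax w u
  have k0 : cosh (dist w (ax 0)) ≤ cosh r := by rwa [Real.cosh_le_cosh, abs_of_nonneg dist_nonneg, abs_of_nonneg r0]
  have kd : cosh (dist w (ax d)) ≤ cosh r := by rwa [Real.cosh_le_cosh, abs_of_nonneg dist_nonneg, abs_of_nonneg r0]
  suffices ku : cosh (dist w (ax u)) ≤ cosh r by
    rwa [Real.cosh_le_cosh, abs_of_nonneg dist_nonneg, abs_of_nonneg r0] at ku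
  have e0 : exp 0 ≤ exp u := exp_le_exp.2 u0
  have e1 : exp u ≤ exp d := exp_le_exp.2 u1
  have p0 := exp_pos 0
  have pu := exp_pos u
  have pd := exp_pos d
  have him := w.im_pos
  generalize exp 0 = a at *
  generalize exp u = b at *
  generalize exp d = c at *
  have q0 : nsq w + a ^ 2 ≤ cosh r * (2 * w.im * a) := by rw [← c0]; gcongr
  have qd : nsq w + c ^ 2 ≤ cosh r * (2 * w.im * c) := by rw [← cd]; gcongr
  suffices q : nsq w + b ^ 2 ≤ cosh r * (2 * w.im * b) by
    rw [← cu] at q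
    exact le_of_mul_le_mul_right q (by positivity)
  set M := cosh r * (2 * w.im) with hM
  have q0' : nsq w + a ^ 2 ≤ M * a := by rw [hM]; linarith
  have qd' : nsq w + c ^ 2 ≤ M * c := by rw [hM]; linarith
  have : nsq w + b ^ 2 ≤ M * b := by
    rcases eq_or_lt_of_le (e0.trans e1) with h | h
    · have : b = a := le_antisymm (h ▸ e1) e0
      rw [this]; exact q0'
    · have : (c - a) * (nsq w + b ^ 2 - M * b) ≤ 0 := by
        nlinarith [mul_nonneg (sub_nonneg.2 e0) (sub_nonneg.2 qd'), mul_nonneg (sub_nonneg.2 e1) (sub_nonneg.2 q0'),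
          mul_nonneg (mul_nonneg (sub_nonneg.2 e0) (sub_nonneg.2 e1)) (sub_nonneg.2 h.le)]
      nlinarith
  rw [hM] at this; linarith

/-- closed disc around `I` -/
def Dk (r : ℝ) : Set ℍ := closedBall I r

lemma Dk_compact (r : ℝ) : IsCompact (Dk r) := isCompact_closedBall _ _

lemma Dk_int {r : ℝ} (hr : 0 < r) : (interior (Dk r)).Nonempty :=
  ⟨I, ball_subset_interior_closedBall (mem_ball_self hr)⟩

lemma Dk_cc {r : ℝ} (hr : 0 ≤ r) : CC (Dk r) :=
  ⟨Dk_compact r, disc_convex _ _, ⟨I, mem_closedBall_self hr⟩⟩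

lemma Dk_mono {r s : ℝ} (h : r ≤ s) : Dk r ⊆ Dk s := closedBall_subset_closedBall h

lemma Dk_area_bounds {r : ℝ} (hr : 0 ≤ r) :
    exp (-2 * r) * (π * sinh r ^ 2) ≤ hypArea (Dk r) ∧ hypArea (Dk r) ≤ exp (2 * r) * (π * sinh r ^ 2) := by
  have hs : 0 ≤ sinh r := Real.sinh_nonneg_iff.2 hr
  have him : ∀ p ∈ closedBall ((center I r : ℍ) : ℂ) (I.im * sinh r), exp (-r) ≤ p.im ∧ p.im ≤ exp r := by
    intro p hp
    rw [mem_closedBall, Complex.dist_eq] at hp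
    have h := (Complex.abs_im_le_norm _).trans hp
    rw [Complex.sub_im, coe_im, center_im, I_im, one_mul, one_mul, abs_le] at h
    rw [Real.cosh_eq, Real.sinh_eq] at h
    constructor <;> linarith [h.1, h.2]
  have e := area_eq (Dk r) (Dk_compact r).measurableSet
  have e2 : (fun z : ℍ => (z : ℂ)) '' Dk r = closedBall ((center I r : ℍ) : ℂ) (I.im * sinh r) :=
    image_coe_closedBall I r
  rw [e2] at e
  have v : volume (closedBall ((center I r : ℍ) : ℂ) (I.im * sinh r)) = ENNReal.ofReal (π * sinh r ^ 2) := by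
    rw [Complex.volume_closedBall, I_im, one_mul, ← ENNReal.ofReal_pow hs, mul_comm π, ENNReal.ofReal_mul (by positivity)]
    congr 1
    rw [ENNReal.ofReal, Real.toNNReal_of_nonneg pi_nonneg]; rfl
  have hm := isClosed_closedBall.measurableSet (s := closedBall ((center I r : ℍ) : ℂ) (I.im * sinh r))
  have hpi := pi_pos
  have hx : ∀ t : ℝ, exp t = (exp (-t))⁻¹ := fun t => by rw [exp_neg, inv_inv]
  have up : hypAreaMeasure (Dk r) ≤ ENNReal.ofReal (exp (2 * r) * (π * sinh r ^ 2)) := by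
    rw [e, ENNReal.ofReal_mul (exp_pos _).le, ← v, ← setLIntegral_const]
    apply setLIntegral_mono' hm
    intro p hp
    apply ENNReal.ofReal_le_ofReal
    have h := (him p hp).1
    rw [hx (2 * r)]
    apply inv_anti₀ (exp_pos _)
    calc exp (-(2 * r)) = exp (-r) ^ 2 := by rw [← Real.exp_nat_mul]; congr 1; push_cast; ring
      _ ≤ _ := by gcongr
  have lo : ENNReal.ofReal (exp (-2 * r) * (π * sinh r ^ 2)) ≤ hypAreaMeasure (Dk r) := by
    rw [e, ENNReal.ofReal_mul (exp_pos _).le, ← v, ← setLIntegral_const]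
    apply setLIntegral_mono' hm
    intro p hp
    apply ENNReal.ofReal_le_ofReal
    have h := him p hp
    rw [hx (-2 * r)]
    have h0 : 0 < p.im := (exp_pos _).trans_le h.1
    apply inv_anti₀ (by positivity)
    calc p.im ^ 2 ≤ exp r ^ 2 := by gcongr; exact h.2
      _ = exp (-(-2 * r)) := by rw [← Real.exp_nat_mul]; congr 1; push_cast; ring
  constructor
  · exact (ENNReal.ofReal_le_iff_le_toReal (area_lt_top (Dk_compact r)).ne).1 lo
  · exact ENNReal.toReal_le_of_le_ofReal (by positivity) up

open Filter Topology in
lemma sinh_div_tendsto : Tendsto (fun r => sinh r / r) (𝓝[>] 0) (𝓝 1) := by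
  have h := (Real.hasDerivAt_sinh 0).tendsto_slope_zero_right
  simp at h
  refine h.congr' ?_
  filter_upwards with r
  rw [div_eq_inv_mul]

open Filter Topology in
lemma Dk_area_tendsto : Tendsto (fun r => hypArea (Dk r) / r ^ 2) (𝓝[>] 0) (𝓝 π) := by
  have h1 : Tendsto (fun r : ℝ => exp (-2 * r) * (π * (sinh r / r) ^ 2)) (𝓝[>] 0) (𝓝 (1 * (π * 1 ^ 2))) := by
    apply Tendsto.mul
    · have : ContinuousAt (fun r : ℝ => exp (-2 * r)) 0 := by fun_prop
      have := this.tendsto.mono_left (nhdsWithin_le_nhds (s := Set.Ioi 0))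
      simpa using this
    · exact (sinh_div_tendsto.pow 2).const_mul _
  have h2 : Tendsto (fun r : ℝ => exp (2 * r) * (π * (sinh r / r) ^ 2)) (𝓝[>] 0) (𝓝 (1 * (π * 1 ^ 2))) := by
    apply Tendsto.mul
    · have : ContinuousAt (fun r : ℝ => exp (2 * r)) 0 := by fun_prop
      have := this.tendsto.mono_left (nhdsWithin_le_nhds (s := Set.Ioi 0))
      simpa using this
    · exact (sinh_div_tendsto.pow 2).const_mul _
  simp only [one_pow, mul_one, one_mul] at h1 h2
  refine tendsto_of_tendsto_of_tendsto_of_le_of_le' h1 h2 ?_ ?_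
  · filter_upwards [self_mem_nhdsWithin] with r hr
    have hr : 0 < r := hr
    have := (Dk_area_bounds hr.le).1
    rw [le_div_iff₀ (by positivity)]
    calc _ = exp (-2 * r) * (π * sinh r ^ 2) := by field_simp
      _ ≤ _ := this
  · filter_upwards [self_mem_nhdsWithin] with r hr
    have hr : 0 < r := hr
    have := (Dk_area_bounds hr.le).2
    rw [div_le_iff₀ (by positivity)]
    calc _ ≤ exp (2 * r) * (π * sinh r ^ 2) := this
      _ = _ := by field_simp

/-- distance along a circle -/
lemma cosh_rot (r θ : ℝ) : cosh (dist (rot θ • ax r) (ax r)) = 1 + 2 * (sinh r * sin θ) ^ 2 := by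
  have h := cosh_dist_nsq (rot θ • ax r) (ax r)
  have hn := smul_nsq_q (rot θ) (ax r)
  have hi := smul_im_q (rot θ) (ax r)
  have hq := qden_pos (rot θ) (ax r)
  simp only [ax_re, ax_im, rot00, rot01, mul_zero, sub_zero, add_zero] at h hn hi
  have hqd : qden (rot θ) (ax r) = sin θ ^ 2 * nsq (ax r) + cos θ ^ 2 := by
    simp [qden]
  set q := qden (rot θ) (ax r)
  have hE : nsq (ax r) = exp r ^ 2 := by rw [ax_nsq, ← Real.exp_nat_mul]; simp
  have hm : cosh (dist (rot θ • ax r) (ax r)) * (2 * exp r * exp r)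
      = cos θ ^ 2 * nsq (ax r) + sin θ ^ 2 + nsq (ax r) * q := by
    have := congrArg (fun x => x * q) h
    beta_reduce at this
    calc _ = cosh (dist (rot θ • ax r) (ax r)) * (2 * ((rot θ • ax r).im * q) * exp r) := by rw [hi]
      _ = _ := by rw [← hn]; linarith
  rw [hE] at hqd hm
  have hs : 2 * exp r * sinh r = exp r ^ 2 - 1 := by
    rw [Real.sinh_eq, exp_neg]; field_simp
  have hp := exp_pos r
  have : (2 * exp r * exp r) ≠ 0 := by positivity
  apply mul_right_cancel₀ this
  rw [hm, hqd]
  have hsc : cos θ ^ 2 = 1 - sin θ ^ 2 := by rw [← sin_sq_add_cos_sq θ]; ring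
  rw [hsc]
  have : (1 + 2 * (sinh r * sin θ) ^ 2) * (2 * exp r * exp r) = 2 * exp r ^ 2 + (2 * exp r * sinh r) ^ 2 * sin θ ^ 2 := by ring
  rw [this, hs]; ring

lemma dist_rot (r θ : ℝ) (hr : 0 ≤ r) : dist (rot θ • ax r) (ax r) = 2 * arsinh (sinh r * |sin θ|) := by
  have h := cosh_rot r θ
  set d := dist (rot θ • ax r) (ax r) with hd
  have hd0 : 0 ≤ d := dist_nonneg
  have hs : 0 ≤ sinh r := Real.sinh_nonneg_iff.2 hr
  have h2 : cosh d = 1 + 2 * sinh (d / 2) ^ 2 := by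
    have := Real.cosh_two_mul (d / 2)
    rw [mul_div_cancel₀ _ two_ne_zero, Real.cosh_sq] at this
    linarith
  have h3 : sinh (d / 2) ^ 2 = (sinh r * |sin θ|) ^ 2 := by
    rw [mul_pow, sq_abs, ← mul_pow]; linarith
  have h4 : sinh (d / 2) = sinh r * |sin θ| :=
    (sq_eq_sq₀ (Real.sinh_nonneg_iff.2 (by positivity)) (by positivity)).1 h3
  rw [← h4, Real.arsinh_sinh]; ring

lemma rot_add (a b : ℝ) : rot (a + b) = rot a * rot b := by
  apply Subtype.ext
  show (!![cos (a+b), sin (a+b); -sin (a+b), cos (a+b)] : Matrix (Fin 2) (Fin 2) ℝ)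
    = !![cos a, sin a; -sin a, cos a] * !![cos b, sin b; -sin b, cos b]
  rw [Matrix.mul_fin_two, cos_add, sin_add]
  congr 1
  ext i j; fin_cases i <;> fin_cases j <;> simp <;> ring

lemma rot_pi_smul (z : ℍ) : rot π • z = z := by
  have hq : qden (rot π) z = 1 := by simp [qden]
  have h1 := smul_re_q (rot π) z
  have h2 := smul_im_q (rot π) z
  rw [hq] at h1 h2
  apply UpperHalfPlane.ext_re_im
  · simpa using h1
  · simpa using h2

lemma rot_zero_smul (z : ℍ) : rot 0 • z = z := by
  have hq : qden (rot 0) z = 1 := by simp [qden]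
  have h1 := smul_re_q (rot 0) z
  have h2 := smul_im_q (rot 0) z
  rw [hq] at h1 h2
  apply UpperHalfPlane.ext_re_im
  · simpa using h1
  · simpa using h2

/-- parametrised circle -/
def circ (r θ : ℝ) : ℍ := rot θ • ax r

lemma circ_dist {r : ℝ} (hr : 0 ≤ r) (a b : ℝ) :
    dist (circ r a) (circ r b) = 2 * arsinh (sinh r * |sin (a - b)|) := by
  have : circ r a = rot b • circ r (a - b) := by
    rw [circ, circ, ← mul_smul, ← rot_add]; congr 2; ring
  rw [this]
  show dist (rot b • circ r (a - b)) (rot b • ax r) = _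
  rw [dist_smul, circ, dist_rot _ _ hr]

lemma circ_frontier {r : ℝ} (hr : 0 < r) (θ : ℝ) : circ r θ ∈ frontier (Dk r) := by
  have hd : ∀ s, 0 ≤ s → dist (circ s θ) I = s := by
    intro s hs
    rw [circ, ← rot_I θ, dist_smul, ← ax_zero, dist_ax, sub_zero, abs_of_nonneg hs]
  rw [(Dk_compact r).isClosed.frontier_eq]
  refine ⟨(hd r hr.le).le, fun hi => ?_⟩
  have hc : Continuous (fun s => circ s θ) := (continuous_const_smul (rot θ)).comp ax_isom.continuous
  have hn : (fun s => circ s θ) ⁻¹' (interior (Dk r)) ∈ nhds r := hc.continuousAt.preimage_mem_nhds (isOpen_interior.mem_nhds hi)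
  obtain ⟨ε, hε, hb⟩ := Metric.mem_nhds_iff.1 hn
  have h1 : circ (r + ε / 2) θ ∈ Dk r := interior_subset (hb (by
    rw [mem_ball, Real.dist_eq]; rw [abs_lt]; constructor <;> linarith))
  have : dist (circ (r + ε / 2) θ) I ≤ r := h1
  rw [hd _ (by linarith)] at this
  linarith

lemma circ_periodic (r : ℝ) : Function.Periodic (circ r) π := by
  intro θ
  rw [circ, circ, rot_add, mul_smul, rot_pi_smul]

lemma frontier_circ {r : ℝ} (hr : 0 < r) : frontier (Dk r) = circ r '' Set.Ico 0 π := by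
  apply subset_antisymm
  · intro w hw
    have hw : dist w I = r := frontier_closedBall_subset_sphere hw
    obtain ⟨θ, t, ht, h⟩ := exists_rot w
    have htr : t = r := by
      rw [← hw, ← dist_smul (rot θ), h, rot_I, ← ax_zero, dist_ax, sub_zero, abs_of_nonneg ht]
    subst htr
    have : w = circ t (-θ) := by
      rw [circ, ← h, ← mul_smul, ← rot_add, neg_add_cancel, rot_zero_smul]
    obtain ⟨y, hy, e⟩ := (circ_periodic t).exists_mem_Ico₀ pi_pos (-θ)
    exact ⟨y, hy, by rw [this, e]⟩
  · rintro _ ⟨θ, _, rfl⟩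
    exact circ_frontier hr θ

end

noncomputable section

lemma circ_lip {r : ℝ} (hr : 0 ≤ r) : LipschitzWith (2 * sinh r).toNNReal (circ r) := by
  have hs : 0 ≤ sinh r := Real.sinh_nonneg_iff.2 hr
  apply LipschitzWith.of_dist_le_mul
  intro a b
  rw [circ_dist hr, Real.coe_toNNReal _ (by positivity), Real.dist_eq, mul_assoc]
  have h1 : |sin (a - b)| ≤ |a - b| := Real.abs_sin_le_abs
  have h2 : arsinh (sinh r * |sin (a - b)|) ≤ sinh r * |sin (a - b)| := by
    have := Real.self_le_sinh_iff.2 (Real.arsinh_nonneg_iff.2 (show 0 ≤ sinh r * |sin (a - b)| by positivity))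
    rwa [Real.sinh_arsinh] at this
  have h3 : sinh r * |sin (a - b)| ≤ sinh r * |a - b| := by gcongr
  linarith

lemma circ_injOn {r : ℝ} (hr : 0 < r) : Set.InjOn (circ r) (Set.Ico 0 π) := by
  intro a ha b hb h
  have hs : 0 < sinh r := Real.sinh_pos_iff.2 hr
  have h1 := circ_dist hr.le a b
  rw [h, dist_self] at h1
  have h2 : arsinh (sinh r * |sin (a - b)|) = 0 := by linarith
  rw [Real.arsinh_eq_zero_iff, mul_eq_zero, abs_eq_zero] at h2
  have h3 := h2.resolve_left hs.ne'
  have := (Real.sin_eq_zero_iff_of_lt_of_lt (by linarith [ha.1, hb.2]) (by linarith [ha.2, hb.1])).1 h3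
  linarith

lemma arc_lower {r : ℝ} (hr : 0 < r) {b : ℝ} (h0 : 0 ≤ b) (h1 : b ≤ π) :
    ENNReal.ofReal (2 * arsinh (sinh r * sin b)) ≤ μH[1] (circ r '' Set.Ico 0 b) := by
  have hl : LipschitzWith 1 (fun z : ℍ => dist z (ax r)) := LipschitzWith.dist_left _
  have h := hl.lipschitzOnWith.hausdorffMeasure_image_le (s := circ r '' Set.Ico 0 b) (d := 1) zero_le_one
  simp only [ENNReal.coe_one, ENNReal.one_rpow, one_mul] at h
  refine le_trans ?_ h
  have hc : ContinuousOn (fun θ => dist (circ r θ) (ax r)) (Set.Icc 0 b) :=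
    ((circ_lip hr.le).continuous.dist continuous_const).continuousOn
  have hi := intermediate_value_Ico h0 hc
  have e0 : dist (circ r 0) (ax r) = 0 := by rw [circ, rot_zero_smul, dist_self]
  have eb : dist (circ r b) (ax r) = 2 * arsinh (sinh r * sin b) := by
    rw [circ, dist_rot _ _ hr.le, abs_of_nonneg (sin_nonneg_of_nonneg_of_le_pi h0 h1)]
  beta_reduce at hi
  rw [e0, eb] at hi
  calc _ = μH[1] (Set.Ico 0 (2 * arsinh (sinh r * sin b))) := by
        rw [hausdorffMeasure_real, Real.volume_Ico, sub_zero]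
    _ ≤ _ := by
        apply measure_mono
        rw [Set.image_image]
        exact hi

lemma circ_meas {r : ℝ} (hr : 0 < r) {a b : ℝ} (ha : 0 ≤ a) (hb : b ≤ π) :
    MeasurableSet (circ r '' Set.Ico a b) := by
  apply measurableSet_Ico.image_of_continuousOn_injOn
  · exact (circ_lip hr.le).continuous.continuousOn
  · exact (circ_injOn hr).mono (Set.Ico_subset_Ico ha hb)

lemma arc_shift (r a b : ℝ) : circ r '' Set.Ico a (a + b) = tr (rot a) (circ r '' Set.Ico 0 b) := by
  have : ∀ θ, rot a • circ r θ = circ r (a + θ) := fun θ => by rw [circ, circ, ← mul_smul, ← rot_add]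
  rw [tr, Set.image_image]
  simp only [this]
  have e : Set.Ico a (a + b) = (fun x => a + x) '' Set.Ico 0 b := by simp [add_comm]
  rw [e, Set.image_image]

lemma perim_lower {r : ℝ} (hr : 0 < r) (n : ℕ) (hn : 0 < n) :
    ENNReal.ofReal (n * (2 * arsinh (sinh r * sin (π / n)))) ≤ μH[1] (frontier (Dk r)) := by
  have hn' : (0 : ℝ) < n := by exact_mod_cast hn
  have hpi := pi_pos
  set b := π / n with hb
  have hb0 : 0 ≤ b := by positivity
  have hnb : n * b = π := by rw [hb]; field_simp
  have hb1 : b ≤ π := by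
    rw [hb]; apply div_le_self pi_pos.le; exact_mod_cast hn
  have hsub : ∀ k ∈ Finset.range n, 0 ≤ (k : ℝ) * b ∧ (k : ℝ) * b + b ≤ π := by
    intro k hk
    refine ⟨by positivity, ?_⟩
    have : (k : ℝ) + 1 ≤ n := by exact_mod_cast Finset.mem_range.1 hk
    nlinarith
  have hd : ((Finset.range n : Finset ℕ) : Set ℕ).PairwiseDisjoint (fun k : ℕ => circ r '' Set.Ico ((k : ℝ) * b) (k * b + b)) := by
    intro i hi j hj hij
    have key : ∀ i ∈ Finset.range n, ∀ j ∈ Finset.range n, i < j →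
        Disjoint (circ r '' Set.Ico ((i : ℝ) * b) (i * b + b)) (circ r '' Set.Ico ((j : ℝ) * b) (j * b + b)) := by
      intro i hi j hj hij
      rw [Set.disjoint_left]
      rintro _ ⟨x, hx, rfl⟩ ⟨y, hy, e⟩
      have h1 := hsub i hi
      have h2 := hsub j hj
      have := circ_injOn hr ⟨by linarith [hy.1], by linarith [hy.2]⟩ ⟨by linarith [hx.1], by linarith [hx.2]⟩ e
      have hij' : (i : ℝ) + 1 ≤ j := by exact_mod_cast hij
      have : (i : ℝ) * b + b ≤ j * b := by nlinarith
      linarith [hx.2, hy.1]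
    rcases lt_or_gt_of_ne hij with h | h
    · exact key i hi j hj h
    · exact (key j hj i hi h).symm
  have hm := measure_biUnion_finset (μ := (μH[1] : Measure ℍ)) hd (fun k hk => circ_meas hr (hsub k hk).1 (hsub k hk).2)
  have hle : (⋃ k ∈ Finset.range n, circ r '' Set.Ico ((k : ℝ) * b) (k * b + b)) ⊆ frontier (Dk r) := by
    intro z hz
    simp only [Set.mem_iUnion] at hz
    obtain ⟨k, _, θ, _, rfl⟩ := hz
    exact circ_frontier hr θ
  refine le_trans ?_ (measure_mono hle)
  rw [hm]
  simp only [arc_shift, H1_tr, Finset.sum_const, Finset.card_range, nsmul_eq_mul]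
  rw [ENNReal.ofReal_mul hn'.le, ENNReal.ofReal_natCast]
  gcongr
  exact arc_lower hr hb0 hb1

open Filter Topology in
lemma perim_disc {r : ℝ} (hr : 0 < r) : hypPerim (Dk r) = 2 * π * sinh r := by
  have hs : 0 < sinh r := Real.sinh_pos_iff.2 hr
  have hpi := pi_pos
  have up : μH[1] (frontier (Dk r)) ≤ ENNReal.ofReal (2 * π * sinh r) := by
    rw [frontier_circ hr]
    refine ((circ_lip hr.le).lipschitzOnWith.hausdorffMeasure_image_le (d := 1) zero_le_one).trans ?_
    rw [hausdorffMeasure_real, Real.volume_Ico, ENNReal.rpow_one, sub_zero]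
    change ENNReal.ofReal _ * _ ≤ _
    rw [← ENNReal.ofReal_mul (by positivity)]
    apply ENNReal.ofReal_le_ofReal
    linarith
  have hne : μH[1] (frontier (Dk r)) ≠ ⊤ := (up.trans_lt ENNReal.ofReal_lt_top).ne
  apply le_antisymm
  · exact ENNReal.toReal_le_of_le_ofReal (by positivity) up
  · have hd : HasDerivAt (fun x : ℝ => arsinh (sinh r * sin x)) (sinh r) 0 := by
      have h1 : HasDerivAt (fun x : ℝ => sinh r * sin x) (sinh r * cos 0) 0 := (Real.hasDerivAt_sin 0).const_mul _
      have h2 := h1.arsinh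
      simpa using h2
    have ht := hd.tendsto_slope_zero_right
    have hseq : Tendsto (fun n : ℕ => π / (n : ℝ)) atTop (𝓝[>] 0) := by
      apply tendsto_nhdsWithin_iff.2
      refine ⟨tendsto_const_div_atTop_nhds_zero_nat π, ?_⟩
      filter_upwards [eventually_gt_atTop 0] with n hn
      have : (0 : ℝ) < n := by exact_mod_cast hn
      show 0 < π / n
      positivity
    have h3 := (ht.comp hseq).const_mul (2 * π)
    refine le_of_tendsto h3 ?_
    filter_upwards [eventually_gt_atTop 0] with n hn
    have hn' : (0 : ℝ) < n := by exact_mod_cast hn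
    have := (ENNReal.ofReal_le_iff_le_toReal hne).1 (perim_lower hr n hn)
    refine le_trans (le_of_eq ?_) this
    simp
    field_simp

end

noncomputable section

lemma poly_between {C V : Set ℍ} (hC : CC C) (hV : IsOpen V) (hCV : C ⊆ V) :
    ∃ S : Finset ℍ, C ⊆ interior (hull (S : Set ℍ)) ∧ hull (S : Set ℍ) ⊆ V := by
  classical
  obtain ⟨u, h1, h2⟩ := ((hypConvex_iff C).1 hC.conv).exists_subset_interior_convexHull_finset_of_isCompact
    (compact_iff_kap.1 hC.comp) ((kap_open V hV).mem_nhdsSet.2 (Set.image_mono hCV))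
  have hu : ∀ p ∈ u, ∃ z, kap z = p := by
    intro p hp
    obtain ⟨z, _, rfl⟩ := h2 (subset_convexHull ℝ _ (Finset.mem_coe.2 hp))
    exact ⟨z, rfl⟩
  let S : Finset ℍ := u.preimage kap (kap_inj.injOn)
  have hS : kap '' (S : Set ℍ) = u := by
    ext p; constructor
    · rintro ⟨z, hz, rfl⟩
      simpa [S] using hz
    · intro hp
      obtain ⟨z, rfl⟩ := hu p hp
      exact ⟨z, by simpa [S] using hp, rfl⟩
  refine ⟨S, ?_, ?_⟩
  · intro z hz
    have := h1 (Set.mem_image_of_mem kap hz)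
    rw [← hS, ← kap_hull, ← kap_interior] at this
    exact kap_image_mem.1 this
  · intro z hz
    have := h2 (by rw [← hS, ← kap_hull]; exact Set.mem_image_of_mem kap hz)
    exact kap_image_mem.1 this

lemma subset_closure_interior {K : Set ℍ} (hK : HypConvex K) (hi : (interior K).Nonempty) :
    K ⊆ closure (interior K) := by
  intro z hz
  rw [kap_emb.isInducing.closure_eq_preimage_closure_image]
  rw [Set.mem_preimage]
  rw [kap_interior, Convex.closure_interior_eq_closure_of_nonempty_interior (𝕜 := ℝ) ((hypConvex_iff K).1 hK)
    (by rw [← kap_interior]; exact hi.image _)]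
  exact subset_closure (Set.mem_image_of_mem _ hz)

lemma interior_convex {K : Set ℍ} (hK : HypConvex K) : HypConvex (interior K) := by
  rw [hypConvex_iff, kap_interior]
  exact ((hypConvex_iff K).1 hK).interior

lemma inner_dense {K : Set ℍ} (hK : CC K) (hi : (interior K).Nonempty) {δ : ℝ} (hδ : 0 < δ) :
    ∃ S : Finset ℍ, HPoly S ∧ hull (S : Set ℍ) ⊆ K ∧ ∀ z ∈ K, ∃ w ∈ hull (S : Set ℍ), dist z w < δ := by
  obtain ⟨F, hF1, hF2, hF3⟩ := hK.comp.elim_finite_subcover_image (b := interior K) (c := fun x => ball x δ)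
    (fun _ _ => isOpen_ball) (by
      intro z hz
      have := subset_closure_interior hK.conv hi hz
      obtain ⟨w, hw, h⟩ := Metric.mem_closure_iff.1 this δ hδ
      simp only [Set.mem_iUnion]
      exact ⟨w, hw, h⟩)
  have hFne : F.Nonempty := by
    obtain ⟨z, hz⟩ := hK.ne
    have := hF3 hz
    simp only [Set.mem_iUnion] at this
    obtain ⟨w, hw, _⟩ := this
    exact ⟨w, hw⟩
  obtain ⟨S, h1, h2⟩ := poly_between (C := hull F) (V := interior K)
    ⟨hull_compact hF2, hull_convex _, hFne.mono (subset_hull _)⟩ isOpen_interior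
    (hull_min hF1 (interior_convex hK.conv))
  refine ⟨S, (hFne.mono (subset_hull _)).mono h1, h2.trans interior_subset, fun z hz => ?_⟩
  have := hF3 hz
  simp only [Set.mem_iUnion] at this
  obtain ⟨w, hw, h⟩ := this
  exact ⟨w, interior_subset (h1 (subset_hull _ hw)), h⟩

namespace Good
variable {μ : Measure G2}

lemma Ph_inner (hμ : Good μ) {K : Set ℍ} (hK : CC K) (hi : (interior K).Nonempty) {r' r : ℝ} (hr : r' < r) :
    ∃ S : Finset ℍ, HPoly S ∧ hull (S : Set ℍ) ⊆ K ∧ Ph μ (Dk r') K ≤ Ph μ (Dk r) (hull (S : Set ℍ)) := by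
  obtain ⟨S, h1, h2, h3⟩ := inner_dense hK hi (sub_pos.2 hr)
  refine ⟨S, h1, h2, measureReal_mono ?_ (hμ.hit_ne_top (Dk_compact r) h1.cc.comp)⟩
  rintro g ⟨z, hz, hg⟩
  obtain ⟨w, hw, hd⟩ := h3 z hz
  refine ⟨w, hw, ?_⟩
  have hg : dist (g • z) I ≤ r' := hg
  show dist (g • w) I ≤ r
  have := dist_triangle (g • w) (g • z) I
  rw [dist_smul, dist_comm w z] at this
  linarith

open Filter Topology in
lemma Ph_thick (hμ : Good μ) {K K' : Set ℍ} (hK : CC K) (hK' : IsCompact K') :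
    Tendsto (fun n : ℕ => Ph μ K' (cthickening (1 / ((n : ℝ) + 1)) K)) atTop (𝓝 (Ph μ K' K)) := by
  have hc : ∀ n : ℕ, IsCompact (cthickening (1 / ((n : ℝ) + 1)) K) := fun n => hK.comp.cthickening
  have hanti : Antitone (fun n : ℕ => hitSet K' (cthickening (1 / ((n : ℝ) + 1)) K)) := by
    intro m n hmn
    refine hitSet_mono subset_rfl (cthickening_mono ?_ _)
    apply one_div_le_one_div_of_le (by positivity)
    have : (m : ℝ) ≤ n := by exact_mod_cast hmn
    linarith
  have h := tendsto_measure_iInter_atTop (μ := μ) (s := fun n : ℕ => hitSet K' (cthickening (1 / ((n : ℝ) + 1)) K))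
    (fun n => (hitSet_meas hK' (hc n)).nullMeasurableSet) hanti ⟨0, hμ.hit_ne_top hK' (hc 0)⟩
  have e : (⋂ n : ℕ, hitSet K' (cthickening (1 / ((n : ℝ) + 1)) K)) = hitSet K' K := by
    apply subset_antisymm
    · intro g hg
      rw [Set.mem_iInter] at hg
      have hcomp := tr_compact g⁻¹ hK'
      have hne : (tr g⁻¹ K').Nonempty := by
        obtain ⟨z, hz, h⟩ := hg 0
        exact ⟨z, mem_tr.2 (by simpa using h)⟩
      obtain ⟨p, hp, hmin⟩ := hcomp.exists_isMinOn hne (continuous_infDist_pt K).continuousOn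
      have h0 : ∀ n : ℕ, infDist p K ≤ 1 / ((n : ℝ) + 1) := by
        intro n
        obtain ⟨z, hz, h⟩ := hg n
        have h1 : infDist p K ≤ infDist z K := hmin (mem_tr.2 (by simpa using h))
        refine h1.trans ?_
        rw [hK.comp.cthickening_eq_biUnion_closedBall (by positivity)] at hz
        simp only [Set.mem_iUnion] at hz
        obtain ⟨w, hw, hz⟩ := hz
        exact (infDist_le_dist_of_mem hw).trans hz
      have h1 : infDist p K ≤ 0 := ge_of_tendsto' tendsto_one_div_add_atTop_nhds_zero_nat h0
      have h2 : p ∈ K := by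
        rw [hK.comp.isClosed.mem_iff_infDist_zero hK.ne]
        exact le_antisymm h1 infDist_nonneg
      exact ⟨p, h2, by simpa using mem_tr.1 hp⟩
    · exact Set.subset_iInter fun n => hitSet_mono subset_rfl (self_subset_cthickening _)
  rw [e] at h
  exact (ENNReal.tendsto_toReal (hμ.hit_ne_top hK' hK.comp)).comp h

open Filter Topology in
lemma outer_seq (hμ : Good μ) {K : Set ℍ} (hK : CC K) :
    ∃ T : ℕ → Finset ℍ, (∀ n, HPoly (T n) ∧ K ⊆ hull (T n : Set ℍ)) ∧
      (∀ K', IsCompact K' → Tendsto (fun n => Ph μ K' (hull (T n : Set ℍ))) atTop (𝓝 (Ph μ K' K))) ∧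
      Tendsto (fun n => hypArea (hull (T n : Set ℍ))) atTop (𝓝 (hypArea K)) := by
  have hex : ∀ n : ℕ, ∃ S : Finset ℍ, K ⊆ interior (hull (S : Set ℍ)) ∧ hull (S : Set ℍ) ⊆ thickening (1 / ((n : ℝ) + 1)) K :=
    fun n => poly_between hK isOpen_thickening (self_subset_thickening (by positivity) _)
  choose T h1 h2 using hex
  have hP : ∀ n, HPoly (T n) := fun n => hK.ne.mono (h1 n)
  have key : ∀ K', IsCompact K' → Tendsto (fun n => Ph μ K' (hull (T n : Set ℍ))) atTop (𝓝 (Ph μ K' K)) := by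
    intro K' hK'
    refine tendsto_of_tendsto_of_tendsto_of_le_of_le tendsto_const_nhds (hμ.Ph_thick hK hK') ?_ ?_
    · intro n
      exact hμ.Ph_mono hK' (hP n).cc.comp subset_rfl ((h1 n).trans interior_subset)
    · intro n
      exact hμ.Ph_mono hK' hK.comp.cthickening subset_rfl ((h2 n).trans (thickening_subset_cthickening _ _))
  refine ⟨T, fun n => ⟨hP n, (h1 n).trans interior_subset⟩, key, ?_⟩
  have := key {I} isCompact_singleton
  rw [hμ.Ph_symm, hμ.Ph_point hK.comp] at this
  refine this.congr fun n => ?_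
  rw [hμ.Ph_symm, hμ.Ph_point (hP n).cc.comp]

lemma rho_disc_pos (hμ : Good μ) {r : ℝ} (hr : 0 < r) : 0 < rho μ (Dk r) := by
  have hA := area_pos (Dk_compact r) (Dk_int hr)
  have h := hμ.Ph_hseg (Dk_compact r) (Dk_cc hr.le).conv (ax 0) (ax (2 * r + 1))
  rw [dist_ax, zero_sub, abs_neg, abs_of_pos (by linarith)] at h
  have hge : 2 * hypArea (Dk r) ≤ Ph μ (Dk r) (hseg (ax 0) (ax (2 * r + 1))) := by
    have h1 := hμ.Ph_point (Dk_compact r) (ax 0)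
    have h2 := hμ.Ph_point (Dk_compact r) (ax (2 * r + 1))
    have hd : Disjoint (hitSet (Dk r) {ax 0}) (hitSet (Dk r) {ax (2 * r + 1)}) := by
      rw [Set.disjoint_left]
      rintro g ⟨z, rfl, hz⟩ ⟨w, rfl, hw⟩
      have hz : dist (g • ax 0) I ≤ r := hz
      have hw : dist (g • ax (2 * r + 1)) I ≤ r := hw
      have := dist_triangle_right (g • ax 0) (g • ax (2 * r + 1)) I
      rw [dist_smul, dist_ax, zero_sub, abs_neg, abs_of_pos (by linarith)] at this
      linarith
    have hu := measureReal_union (μ := μ) hd (hitSet_meas (Dk_compact r) isCompact_singleton)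
      (hμ.hit_ne_top (Dk_compact r) isCompact_singleton) (hμ.hit_ne_top (Dk_compact r) isCompact_singleton)
    have hm : μ.real (hitSet (Dk r) {ax 0} ∪ hitSet (Dk r) {ax (2 * r + 1)}) ≤ Ph μ (Dk r) (hseg (ax 0) (ax (2 * r + 1))) := by
      refine measureReal_mono (Set.union_subset ?_ ?_) (hμ.hit_ne_top (Dk_compact r) (hseg_compact _ _))
      · exact hitSet_mono subset_rfl (by simpa using left_mem_hseg _ _)
      · exact hitSet_mono subset_rfl (by simpa using right_mem_hseg _ _)
    rw [hu] at hm
    change Ph μ _ _ + Ph μ _ _ ≤ _ at hm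
    linarith
  by_contra hc
  push Not at hc
  nlinarith

end Good

open Filter Topology in
lemma Dk_area_zero : Tendsto (fun r => hypArea (Dk r)) (𝓝[>] 0) (𝓝 0) := by
  have h1 := Dk_area_tendsto
  have h2 : Tendsto (fun r : ℝ => r ^ 2) (𝓝[>] 0) (𝓝 0) := by
    have : ContinuousAt (fun r : ℝ => r ^ 2) 0 := by fun_prop
    have := this.tendsto.mono_left (nhdsWithin_le_nhds (s := Set.Ioi 0))
    simpa using this
  have h3 := h1.mul h2
  rw [mul_zero] at h3
  refine h3.congr' ?_
  filter_upwards [self_mem_nhdsWithin] with r hr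
  have hr : r ≠ 0 := ne_of_gt hr
  field_simp

end

noncomputable section

namespace Good
variable {μ : Measure G2}

open Filter Topology in
lemma body_main (hμ : Good μ) : ∃ κ : ℝ, ∀ K, CC K → (interior K).Nonempty → ∀ K', CC K' →
    2 * Ph μ K' K = 2 * hypArea K + 2 * hypArea K' + κ * hypArea K' * hypArea K + rho μ K' * hypPerim K := by
  obtain ⟨κ, hκ⟩ := hμ.poly_main
  refine ⟨κ, fun K hK hi => ?_⟩
  obtain ⟨T, hT1, hT2, hT3⟩ := hμ.outer_seq hK
  have hfin : μH[1] (frontier K) ≠ ⊤ := by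
    have := perim_mono hK (hT1 0).1.cc.comp (hT1 0).2
    rw [perim_poly (hT1 0).1] at this
    exact (this.trans_lt ENNReal.ofReal_lt_top).ne
  have hout : ∀ n, hypPerim K ≤ elen (T n) := by
    intro n
    have := perim_mono hK (hT1 n).1.cc.comp (hT1 n).2
    rw [perim_poly (hT1 n).1] at this
    exact ENNReal.toReal_le_of_le_ofReal (elen_nonneg _) this
  have hin : ∀ S : Finset ℍ, HPoly S → hull (S : Set ℍ) ⊆ K → elen S ≤ hypPerim K := by
    intro S hS hSK
    have := perim_mono hS.cc hK.comp hSK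
    rw [perim_poly hS] at this
    exact (ENNReal.ofReal_le_iff_le_toReal hfin).1 this
  have hmono : Monotone (fun r => Ph μ (Dk r) K) := fun r s h =>
    hμ.Ph_mono (Dk_compact s) hK.comp (Dk_mono h) subset_rfl
  obtain ⟨r, hr, hrκ, hcont⟩ : ∃ r : ℝ, 0 < r ∧ 0 < 2 + κ * hypArea (Dk r) ∧ ContinuousAt (fun r => Ph μ (Dk r) K) r := by
    have h1 : Tendsto (fun r => 2 + κ * hypArea (Dk r)) (𝓝[>] 0) (𝓝 (2 + κ * 0)) :=
      (Dk_area_zero.const_mul κ).const_add 2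
    have h2 : ∀ᶠ r in 𝓝[>] 0, 0 < 2 + κ * hypArea (Dk r) := h1.eventually_const_lt (by norm_num)
    obtain ⟨ε, hε, hsub⟩ := (mem_nhdsGT_iff_exists_Ioo_subset).1 h2
    have hd := hmono.countable_not_continuousAt.dense_compl ℝ
    obtain ⟨r, hr1, hr2⟩ := hd.exists_mem_open isOpen_Ioo (Set.nonempty_Ioo.2 hε)
    refine ⟨r, hr2.1, hsub hr2, ?_⟩
    by_contra hc
    exact hr1 hc
  have hρ := hμ.rho_disc_pos hr
  set F := 2 * Ph μ (Dk r) K - 2 * hypArea (Dk r) - hypArea K * (2 + κ * hypArea (Dk r)) with hF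
  have hlim : Tendsto (fun n => rho μ (Dk r) * elen (T n)) atTop (𝓝 F) := by
    have h1 := (((hT2 (Dk r) (Dk_compact r)).const_mul 2).sub_const (2 * hypArea (Dk r))).sub
      (hT3.mul_const (2 + κ * hypArea (Dk r)))
    refine h1.congr fun n => ?_
    have := hκ (T n) (hT1 n).1 (Dk r) (Dk_cc hr.le)
    linarith
  have up : rho μ (Dk r) * hypPerim K ≤ F := ge_of_tendsto' hlim fun n => by
    have := hout n
    gcongr
  have lo : F ≤ rho μ (Dk r) * hypPerim K := by
    have h1 : Tendsto (fun r' => 2 * Ph μ (Dk r') K - 2 * hypArea (Dk r) - hypArea K * (2 + κ * hypArea (Dk r)))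
        (𝓝[<] r) (𝓝 F) :=
      ((((hcont.tendsto.mono_left nhdsWithin_le_nhds).const_mul 2).sub_const _).sub_const _)
    refine le_of_tendsto h1 ?_
    filter_upwards [self_mem_nhdsWithin] with r' hr'
    obtain ⟨S, hS1, hS2, hS3⟩ := hμ.Ph_inner hK hi (show r' < r from hr')
    have h2 := hκ S hS1 (Dk r) (Dk_cc hr.le)
    have h3 := hypArea_mono hK.comp hS2
    have h4 : hypArea (hull (S : Set ℍ)) * (2 + κ * hypArea (Dk r)) ≤ hypArea K * (2 + κ * hypArea (Dk r)) := by gcongr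
    have h5 : rho μ (Dk r) * elen S ≤ rho μ (Dk r) * hypPerim K := by
      have := hin S hS1 hS2
      gcongr
    linarith
  have hFP : F = rho μ (Dk r) * hypPerim K := le_antisymm lo up
  have hel : Tendsto (fun n => elen (T n)) atTop (𝓝 (hypPerim K)) := by
    have := hlim.const_mul (rho μ (Dk r))⁻¹
    rw [hFP, inv_mul_cancel_left₀ hρ.ne'] at this
    refine this.congr fun n => ?_
    rw [inv_mul_cancel_left₀ hρ.ne']
  intro K' hK'
  have h1 := (hT2 K' hK'.comp).const_mul 2
  have h2 := (((hT3.const_mul 2).add_const (2 * hypArea K')).add (hT3.const_mul (κ * hypArea K'))).add (hel.const_mul (rho μ K'))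
  refine tendsto_nhds_unique h1 (h2.congr fun n => ?_)
  rw [hκ (T n) (hT1 n).1 K' hK']

lemma body_two (hμ : Good μ) : ∃ a b : ℝ, ∀ K, CC K → (interior K).Nonempty → ∀ L, CC L → (interior L).Nonempty →
    Ph μ K L = hypArea K + hypArea L + a * hypPerim K * hypPerim L + b * hypArea K * hypArea L := by
  obtain ⟨κ, hκ⟩ := hμ.body_main
  refine ⟨rho μ (hseg I (ax 1)) / 4, κ / 2, fun K hK hiK L hL hiL => ?_⟩
  have h1 := hκ L hL hiL K hK
  have h2 := hκ K hK hiK _ (hseg_cc I (ax 1))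
  rw [area_hseg one_ne, hμ.Ph_symm] at h2
  have h3 : rho μ K = rho μ (hseg I (ax 1)) / 2 * hypPerim K := by
    rw [rho]; linarith
  rw [h3] at h1
  linarith

lemma Ph_discs (hμ : Good μ) {r s : ℝ} (hr : 0 < r) (hs : 0 < s) : Ph μ (Dk r) (Dk s) = hypArea (Dk (r + s)) := by
  rw [← hμ.Ph_point (Dk_compact (r + s)) I, Ph, Ph]
  congr 1
  ext g
  constructor
  · rintro ⟨z, hz, hg⟩
    refine ⟨I, rfl, ?_⟩
    have hz : dist z I ≤ s := hz
    have hg : dist (g • z) I ≤ r := hg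
    show dist (g • I) I ≤ r + s
    have := dist_triangle_left (g • I) I (g • z)
    rw [dist_smul] at this
    linarith
  · rintro ⟨z, rfl, hg⟩
    have hg : dist (g • I) I ≤ r + s := hg
    obtain ⟨h, h1, h2⟩ := exists_normal (g • I) I
    set d := dist (g • I) I with hd
    have hd0 : 0 ≤ d := dist_nonneg
    -- point on the segment at distance min s d from the first endpoint
    refine ⟨g⁻¹ • h⁻¹ • ax (min s d), ?_, ?_⟩
    · show dist _ I ≤ s
      rw [← dist_smul g, smul_inv_smul, ← dist_smul h, smul_inv_smul, h1, dist_ax, sub_zero, abs_of_nonneg (by positivity)]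
      exact min_le_left _ _
    · show dist _ I ≤ r
      rw [smul_inv_smul, ← dist_smul h, smul_inv_smul, h2, dist_ax, abs_le]
      constructor
      · rcases min_choice s d with e | e <;> rw [e] <;> linarith
      · linarith [min_le_right s d]

open Filter Topology in
lemma constants (hμ : Good μ) : ∀ K, CC K → (interior K).Nonempty → ∀ L, CC L → (interior L).Nonempty →
    Ph μ K L = hypArea K + hypArea L + (1 / (2 * π)) * (hypPerim K * hypPerim L + hypArea K * hypArea L) := by
  obtain ⟨a, b, hab⟩ := hμ.body_two
  have hpi := pi_pos
  have hD : ∀ r s : ℝ, 0 < r → 0 < s → hypArea (Dk (r + s)) = hypArea (Dk r) + hypArea (Dk s)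
      + a * (4 * π ^ 2) * (sinh r * sinh s) + b * hypArea (Dk r) * hypArea (Dk s) := by
    intro r s hr hs
    rw [← hμ.Ph_discs hr hs, hab _ (Dk_cc hr.le) (Dk_int hr) _ (Dk_cc hs.le) (Dk_int hs), perim_disc hr, perim_disc hs]
    ring
  have ha : a = 1 / (2 * π) := by
    have h1 : Tendsto (fun r : ℝ => hypArea (Dk (2 * r)) / (2 * r) ^ 2) (𝓝[>] 0) (𝓝 π) := by
      refine Dk_area_tendsto.comp (tendsto_nhdsWithin_iff.2 ⟨?_, ?_⟩)
      · have : ContinuousAt (fun r : ℝ => 2 * r) 0 := by fun_prop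
        have := this.tendsto.mono_left (nhdsWithin_le_nhds (s := Set.Ioi 0))
        simpa using this
      · filter_upwards [self_mem_nhdsWithin] with r hr
        have hr : 0 < r := hr
        show 0 < 2 * r
        positivity
    have h2 := ((Dk_area_tendsto.const_mul 2).add ((sinh_div_tendsto.pow 2).const_mul (a * (4 * π ^ 2)))).add
      ((Dk_area_tendsto.const_mul b).mul Dk_area_zero)
    have h3 := h1.const_mul 4
    have h4 : 4 * π = 2 * π + a * (4 * π ^ 2) * 1 ^ 2 + b * π * 0 := by
      refine tendsto_nhds_unique h3 (h2.congr' ?_)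
      filter_upwards [self_mem_nhdsWithin] with r hr
      have hr : 0 < r := hr
      have h := hD r r hr hr
      rw [← two_mul] at h
      rw [h]
      field_simp
      ring
    field_simp
    have : π * (a * 2 * π - 1) = 0 := by linarith
    rcases mul_eq_zero.1 this with h | h
    · exact absurd h hpi.ne'
    · linarith
  have hne : a * (4 * π ^ 2) ≠ 0 := by rw [ha]; positivity
  have hassoc : ∀ r t : ℝ, 0 < r → 0 < t →
      sinh r * (1 + b * hypArea (Dk t) - cosh t) = sinh t * (1 + b * hypArea (Dk r) - cosh r) := by
    intro r t hr ht
    have e1 := hD (r + 1) t (by linarith) ht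
    have e2 := hD r (1 + t) hr (by linarith)
    have e3 := hD r 1 hr one_pos
    have e4 := hD 1 t one_pos ht
    rw [← add_assoc] at e2
    rw [e3] at e1
    rw [e4] at e2
    rw [e1, sinh_add, sinh_add] at e2
    have hs1 : 0 < sinh 1 := Real.sinh_pos_iff.2 one_pos
    have : a * (4 * π ^ 2) * (sinh 1 * (sinh r * (1 + b * hypArea (Dk t) - cosh t) - sinh t * (1 + b * hypArea (Dk r) - cosh r))) = 0 := by
      linear_combination e2
    have := (mul_eq_zero.1 ((mul_eq_zero.1 this).resolve_left hne)).resolve_left hs1.ne'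
    linarith
  have hzero : 1 + b * hypArea (Dk 1) - cosh 1 = 0 := by
    have h1 : ∀ r : ℝ, 0 < r → (sinh r / r) * (1 + b * hypArea (Dk 1) - cosh 1) = sinh 1 * (b * (hypArea (Dk r) / r ^ 2) * r - (cosh r - 1) / r) := by
      intro r hr
      have := hassoc r 1 hr one_pos
      field_simp
      linear_combination this
    have hcosh : Tendsto (fun r : ℝ => (cosh r - 1) / r) (𝓝[>] 0) (𝓝 0) := by
      have h := (Real.hasDerivAt_cosh 0).tendsto_slope_zero_right
      simp at h
      refine h.congr' ?_
      filter_upwards with r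
      rw [div_eq_inv_mul]
    have hid : Tendsto (fun r : ℝ => r) (𝓝[>] 0) (𝓝 0) := tendsto_id.mono_left nhdsWithin_le_nhds
    have h2 := ((((Dk_area_tendsto.const_mul b).mul hid).sub hcosh).const_mul (sinh 1))
    have h3 := sinh_div_tendsto.mul_const (1 + b * hypArea (Dk 1) - cosh 1)
    have h4 := tendsto_nhds_unique h3 (h2.congr' (by
      filter_upwards [self_mem_nhdsWithin] with r hr
      exact (h1 r hr).symm))
    simpa using h4
  have hb : b = 1 / (2 * π) := by
    have h1 : ∀ r : ℝ, 0 < r → b * hypArea (Dk r) = cosh r - 1 := by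
      intro r hr
      have h := hassoc r 1 hr one_pos
      rw [hzero, mul_zero] at h
      have := (mul_eq_zero.1 h.symm).resolve_left (Real.sinh_pos_iff.2 one_pos).ne'
      linarith
    have h2 := Dk_area_tendsto.const_mul b
    have h3 : Tendsto (fun r : ℝ => 1 / 2 * (sinh (r / 2) / (r / 2)) ^ 2) (𝓝[>] 0) (𝓝 (1 / 2 * 1 ^ 2)) := by
      refine ((sinh_div_tendsto.comp (tendsto_nhdsWithin_iff.2 ⟨?_, ?_⟩)).pow 2).const_mul _
      · have : ContinuousAt (fun r : ℝ => r / 2) 0 := by fun_prop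
        have := this.tendsto.mono_left (nhdsWithin_le_nhds (s := Set.Ioi 0))
        simpa using this
      · filter_upwards [self_mem_nhdsWithin] with r hr
        have hr : 0 < r := hr
        show 0 < r / 2
        positivity
    have h4 : b * π = 1 / 2 * 1 ^ 2 := by
      refine tendsto_nhds_unique h2 (h3.congr' ?_)
      filter_upwards [self_mem_nhdsWithin] with r hr
      have hr : 0 < r := hr
      have h5 := h1 r hr
      have h6 : cosh r = 1 + 2 * sinh (r / 2) ^ 2 := by
        have := Real.cosh_two_mul (r / 2)
        rw [mul_div_cancel₀ _ two_ne_zero, Real.cosh_sq] at this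
        linarith
      rw [← mul_div_assoc, h5, h6]
      field_simp
      ring
    field_simp
    linarith
  intro K hK hiK L hL hiL
  rw [hab K hK hiK L hL hiL, ha, hb]
  ring

end Good

end

/-- Principal kinematic formula in the hyperbolic plane, for a left Haar
(left-invariant) measure `μ` on `SL(2,ℝ)` normalized so that its pushforward under the
orbit map `g ↦ g • i` is the hyperbolic area measure. -/
theorem principal_kinematic_formula_hyperbolic (K L : Set ℍ)
    (hKcomp : IsCompact K) (hKconv : HypConvex K) (hKint : (interior K).Nonempty)
    (hLcomp : IsCompact L) (hLconv : HypConvex L) (hLint : (interior L).Nonempty)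
    (μ : Measure (Matrix.SpecialLinearGroup (Fin 2) ℝ))
    (hinv : μ.IsMulLeftInvariant)
    (hpush : μ.map (fun g => g • UpperHalfPlane.I) = hypAreaMeasure) :
    ∫⁻ g : Matrix.SpecialLinearGroup (Fin 2) ℝ,
        Set.indicator {g : Matrix.SpecialLinearGroup (Fin 2) ℝ |
          (K ∩ (fun z => g • z) '' L).Nonempty} (fun _ => (1 : ENNReal)) g ∂μ
      = ENNReal.ofReal (hypArea K + hypArea L +
          (1 / (2 * π)) * (hypPerim K * hypPerim L + hypArea K * hypArea L)) := by
  have hμ : Good μ := ⟨hinv, hpush⟩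
  have hK : CC K := ⟨hKcomp, hKconv, hKint.mono interior_subset⟩
  have hL : CC L := ⟨hLcomp, hLconv, hLint.mono interior_subset⟩
  have e : {g : Matrix.SpecialLinearGroup (Fin 2) ℝ | (K ∩ (fun z => g • z) '' L).Nonempty} = hitSet K L := by
    ext g
    constructor
    · rintro ⟨_, hk, z, hz, rfl⟩
      exact ⟨z, hz, hk⟩
    · rintro ⟨z, hz, hk⟩
      exact ⟨g • z, hk, z, hz, rfl⟩
  rw [e, lintegral_indicator (hitSet_meas hKcomp hLcomp), setLIntegral_one,
    ← hμ.constants K hK hKint L hL hLint, Ph, measureReal_def,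
    ENNReal.ofReal_toReal (hμ.hit_ne_top hKcomp hLcomp)]
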